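/- arXiv:0704.3216 — 8 statements merged into one kernel-verified Lean document; each statement's English description precedes it below -/
import Mathlib

section
/- Let n ≥ 2 and let Ω ⊆ ℂⁿ be a bounded, open, connected set. Let K ⊆ Ω be a compact set such that Ω \ K is connected. Then for every function f : ℂⁿ → ℂ that is holomorphic on Ω \ K (i.e. complex-differentiable at every point of Ω \ K), there exists a unique function F holomorphic on Ω such that F(z) = f(z) for all z ∈ Ω \ K. -/
section

open Complex MeasureTheory Metric Set Filter Topology

variable {E : Type*} [NormedAddCommGroup E] [NormedSpace ℂ E]

theorem continuousOn_fderiv_of_differentiableOn_complex [ProperSpace E] {U : Set E} (hU : IsOpen U)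
    {f : E → ℂ} (hf : DifferentiableOn ℂ f U) : ContinuousOn (fderiv ℂ f) U := by
  refine fun z hz ↦ ContinuousAt.continuousWithinAt ?_
  obtain ⟨r, hr, hball⟩ := nhds_basis_closedBall.mem_iff.1 (hU.mem_nhds hz)
  have huc : UniformContinuousOn f (closedBall z r) :=
    (isCompact_closedBall z r).uniformContinuousOn_of_continuous (hf.continuousOn.mono hball)
  rw [Metric.continuousAt_iff]
  intro ε hε
  obtain ⟨δ, hδ, hfδ⟩ := Metric.uniformContinuousOn_iff.1 huc (ε * r / 8) (by positivity)
  refine ⟨min δ (r / 2), by positivity, fun {w} hw ↦ ?_⟩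
  have hw1 : ‖w - z‖ < δ := by rw [← dist_eq_norm]; exact hw.trans_le (min_le_left _ _)
  have hw2 : ‖w - z‖ < r / 2 := by rw [← dist_eq_norm]; exact hw.trans_le (min_le_right _ _)
  have hmem : ∀ x ∈ ball z (r / 2), x ∈ closedBall z r ∧ x + (w - z) ∈ closedBall z r := by
    intro x hx
    rw [mem_ball, dist_eq_norm] at hx
    simp only [mem_closedBall, dist_eq_norm]
    refine ⟨by linarith, ?_⟩
    calc ‖x + (w - z) - z‖ = ‖(x - z) + (w - z)‖ := by congr 1; abel
      _ ≤ ‖x - z‖ + ‖w - z‖ := norm_add_le _ _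
      _ ≤ r := by linarith
  have hd : ∀ x ∈ closedBall z r, DifferentiableAt ℂ f x := fun x hx ↦
    hf.differentiableAt (hU.mem_nhds (hball hx))
  let g : E → ℂ := fun x ↦ f (x + (w - z)) - f x
  have hg : ∀ x ∈ ball z (r / 2), HasFDerivAt g (fderiv ℂ f (x + (w - z)) - fderiv ℂ f x) x := by
    intro x hx
    exact ((hasFDerivAt_comp_add_right _).2 (hd _ (hmem x hx).2).hasFDerivAt).sub
      (hd _ (hmem x hx).1).hasFDerivAt
  have hgb : ∀ x ∈ ball z (r / 2), ‖g x‖ ≤ ε * r / 8 := by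
    intro x hx
    rw [← dist_eq_norm]
    refine (hfδ _ (hmem x hx).2 _ (hmem x hx).1 ?_).le
    rw [dist_eq_norm]
    simpa using hw1
  have hz0 : z ∈ ball z (r / 2) := mem_ball_self (by positivity)
  have key := norm_fderiv_le_div_of_mapsTo_ball (f := g) (c := z) (R₁ := r / 2) (R₂ := ε * r / 4)
    (fun x hx ↦ (hg x hx).differentiableAt.differentiableWithinAt)
    (fun x hx ↦ by
      rw [mem_closedBall, dist_eq_norm]
      linarith [norm_sub_le (g x) (g z), hgb x hx, hgb z hz0]) (by positivity)
  rw [(hg z hz0).fderiv] at key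
  rw [dist_eq_norm]
  have e1 : z + (w - z) = w := by abel
  rw [e1] at key
  refine key.trans_lt ?_
  have : ε * r / 4 / (r / 2) = ε / 2 := by field_simp; norm_num
  linarith

theorem contDiffOn_one_of_differentiableOn_complex [ProperSpace E] {U : Set E} (hU : IsOpen U)
    {f : E → ℂ} (hf : DifferentiableOn ℂ f U) : ContDiffOn ℂ 1 f U :=
  (contDiffOn_succ_iff_fderiv_of_isOpen (n := 0) hU).2
    ⟨hf, by simp, contDiffOn_zero.2 (continuousOn_fderiv_of_differentiableOn_complex hU hf)⟩

/-- **Identity theorem** for holomorphic functions on a complex normed space. -/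
theorem eqOn_zero_of_differentiableOn_of_eventuallyEq {U : Set E} (hU : IsOpen U)
    (hUc : IsPreconnected U) {f : E → ℂ} (hf : DifferentiableOn ℂ f U) {z₀ : E} (hz₀ : z₀ ∈ U)
    (h0 : f =ᶠ[𝓝 z₀] 0) : EqOn f 0 U := by
  have hsub : U ⊆ {z | f =ᶠ[𝓝 z] 0} := by
    refine hUc.subset_of_closure_inter_subset (isOpen_setOfPred_eventually_nhds) ⟨z₀, hz₀, h0⟩ ?_
    rintro z ⟨hz, hzU⟩
    obtain ⟨r, hr, hball⟩ := Metric.isOpen_iff.1 hU z hzU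
    obtain ⟨y, hy, hyz⟩ := Metric.mem_closure_iff.1 hz r hr
    rw [dist_comm] at hyz
    filter_upwards [ball_mem_nhds z hr] with x hx
    let L : ℂ → E := fun t ↦ y + t • (x - y)
    have hLd : Differentiable ℂ L := by fun_prop
    have hLc : Continuous L := hLd.continuous
    have hV : IsOpen (L ⁻¹' ball z r) := isOpen_ball.preimage hLc
    have hVc : IsPreconnected (L ⁻¹' ball z r) := by
      refine Convex.isPreconnected ?_
      intro a ha b hb s t hs ht hst
      have : L (s • a + t • b) = s • L a + t • L b := by
        simp only [L]
        have h1 : (s : ℂ) + t = 1 := by exact_mod_cast hst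
        have h2 : (t : ℂ) = 1 - s := by rw [← h1]; ring
        simp only [← Complex.coe_smul, smul_eq_mul, h2]
        module
      change L _ ∈ ball z r
      rw [this]
      exact convex_ball z r ha hb hs ht hst
    have hfL : DifferentiableOn ℂ (f ∘ L) (L ⁻¹' ball z r) :=
      (hf.mono hball).comp hLd.differentiableOn fun _ h ↦ h
    have := (hfL.analyticOnNhd hV).eqOn_zero_of_preconnected_of_eventuallyEq_zero hVc
      (z₀ := 0) (by simpa [L] using hyz)
      ((hLc.tendsto' 0 y (by simp [L])).eventually hy)
      (x := 1) (by simpa [L] using hx)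
    simpa [L] using this
  exact fun z hz ↦ (hsub hz).self_of_nhds

/-- Twice the antiholomorphic part of the real derivative of `h` in the direction `v`. -/
noncomputable def dbar (v : E) (h : E → ℂ) (z : E) : ℂ :=
  fderiv ℝ h z v + I * fderiv ℝ h z (I • v)

theorem differentiableAt_complex_of_real {f : E → ℂ} {z : E} (hf : DifferentiableAt ℝ f z)
    (h : ∀ v, dbar v f z = 0) : DifferentiableAt ℂ f z := by
  unfold dbar at h
  have hI : ∀ v, fderiv ℝ f z (I • v) = I * fderiv ℝ f z v := fun v ↦ by
    linear_combination (-I) * h v + fderiv ℝ f z (I • v) * I_mul_I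
  let A : E →L[ℂ] ℂ :=
    { toFun := fderiv ℝ f z
      map_add' := map_add _
      map_smul' := fun c v ↦ by
        have : c • v = c.re • v + c.im • (I • v) := by
          conv_lhs => rw [← re_add_im c]
          simp only [← Complex.coe_smul]
          module
        rw [this, map_add, map_smul, map_smul, hI]
        simp only [real_smul, RingHom.id_apply, smul_eq_mul]
        conv_rhs => rw [← re_add_im c]
        ring
      cont := (fderiv ℝ f z).cont }
  exact (hasFDerivAt_of_restrictScalars ℝ (f' := A) hf.hasFDerivAt rfl).differentiableAt


theorem ContDiff.continuous_dbar {h : E → ℂ} (hh : ContDiff ℝ 1 h) (v : E) :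
    Continuous (dbar v h) := by
  have := hh.continuous_fderiv (by simp)
  unfold dbar
  fun_prop

theorem HasCompactSupport.dbar {h : E → ℂ} (hc : HasCompactSupport h) (v : E) :
    HasCompactSupport (dbar v h) :=
  hc.fderiv (𝕜 := ℝ) |>.mono fun z hz ↦ by
    contrapose! hz
    simp only [Function.mem_support, not_not] at hz ⊢
    simp [_root_.dbar, hz]

/-- Lebesgue measure on the rectangle of polar coordinates of the disc of radius `R`. -/
noncomputable def polarMeasure (R : ℝ) : Measure (ℝ × ℝ) :=
  (volume.restrict (Ioc 0 R)).prod (volume.restrict (Ioc (-Real.pi) Real.pi))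

instance (R : ℝ) : IsFiniteMeasure (polarMeasure R) := by
  unfold polarMeasure; infer_instance

/-- The Cauchy transform of `h` along the complex direction `e`, truncated at radius `R` and
written in polar coordinates. -/
noncomputable def cauchyTransform (R : ℝ) (e : E) (h : E → ℂ) (z : E) : ℂ :=
  ∫ x, exp (-(x.2 * I)) * h (z - (x.1 * exp (x.2 * I)) • e) ∂(polarMeasure R)

theorem norm_exp_neg_ofReal_mul_I (t : ℝ) : ‖exp (-(t * I))‖ = 1 := by
  rw [← neg_mul, ← ofReal_neg, norm_exp_ofReal_mul_I]

theorem hasFDerivAt_cauchyTransform {h : E → ℂ} (hh : ContDiff ℝ 1 h) (hc : HasCompactSupport h)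
    (R : ℝ) (e z : E) :
    HasFDerivAt (cauchyTransform R e h)
      (∫ x, exp (-((x.2 : ℝ) * I)) • fderiv ℝ h (z - ((x.1 : ℝ) * exp (x.2 * I)) • e)
        ∂(polarMeasure R)) z := by
  have hcf := hh.continuous_fderiv (by simp)
  obtain ⟨C, hC⟩ := hcf.bounded_above_of_compact_support (hc.fderiv (𝕜 := ℝ))
  obtain ⟨C', hC'⟩ := hh.continuous.bounded_above_of_compact_support hc
  have hcont : ∀ w : E, Continuous fun x : ℝ × ℝ ↦
      exp (-(x.2 * I)) * h (w - (x.1 * exp (x.2 * I)) • e) := fun w ↦ by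
    have := hh.continuous
    fun_prop
  refine hasFDerivAt_integral_of_dominated_of_fderiv_le (𝕜 := ℝ) (s := univ)
    (F' := fun w x ↦ exp (-((x.2 : ℝ) * I)) • fderiv ℝ h (w - ((x.1 : ℝ) * exp (x.2 * I)) • e))
    (bound := fun _ ↦ C) univ_mem (.of_forall fun w ↦ (hcont w).aestronglyMeasurable)
    (Integrable.of_bound (hcont z).aestronglyMeasurable C' (.of_forall fun x ↦ ?_))
    (Continuous.aestronglyMeasurable (by fun_prop)) (.of_forall fun x w _ ↦ ?_)
    (integrable_const (μ := polarMeasure R) C) (.of_forall fun x w _ ↦ ?_)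
  · rw [norm_mul, norm_exp_neg_ofReal_mul_I, one_mul]
    exact hC' _
  · rw [norm_smul, norm_exp_neg_ofReal_mul_I, one_mul]
    exact hC _
  · refine HasFDerivAt.const_mul ?_ _
    exact ((hh.differentiable (by simp)) _).hasFDerivAt.comp w ((hasFDerivAt_id w).sub_const _)

theorem dbar_cauchyTransform {h : E → ℂ} (hh : ContDiff ℝ 1 h) (hc : HasCompactSupport h)
    (R : ℝ) (e v z : E) :
    dbar v (cauchyTransform R e h) z = cauchyTransform R e (dbar v h) z := by
  have hcf := hh.continuous_fderiv (by simp)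
  obtain ⟨C, hC⟩ := hcf.bounded_above_of_compact_support (hc.fderiv (𝕜 := ℝ))
  have hint : Integrable (fun x : ℝ × ℝ ↦
      exp (-((x.2 : ℝ) * I)) • fderiv ℝ h (z - ((x.1 : ℝ) * exp (x.2 * I)) • e))
      (polarMeasure R) := by
    refine Integrable.of_bound (Continuous.aestronglyMeasurable (by fun_prop)) C
      (.of_forall fun x ↦ ?_)
    rw [norm_smul, norm_exp_neg_ofReal_mul_I, one_mul]
    exact hC _
  rw [dbar, (hasFDerivAt_cauchyTransform hh hc R e z).fderiv,
    ContinuousLinearMap.integral_apply hint, ContinuousLinearMap.integral_apply hint,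
    ← integral_const_mul, ← integral_add (hint.apply_continuousLinearMap _)
      ((hint.apply_continuousLinearMap _).const_mul _), cauchyTransform]
  congr 1 with x
  simp only [dbar, smul_apply, smul_eq_mul]
  ring

theorem exp_neg_mul_dbar (h : E → ℂ) (e z : E) (t : ℝ) :
    exp (-(t * I)) * dbar e h z =
      fderiv ℝ h z (exp (t * I) • e) + I * fderiv ℝ h z ((I * exp (t * I)) • e) := by
  have h1 : exp (t * I) • e = Real.cos t • e + Real.sin t • (I • e) := by
    rw [exp_mul_I, ← ofReal_cos, ← ofReal_sin]
    simp only [← Complex.coe_smul]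
    module
  have h2 : (I * exp (t * I)) • e = Real.cos t • (I • e) - Real.sin t • e := by
    rw [exp_mul_I, ← ofReal_cos, ← ofReal_sin, mul_add, mul_left_comm, I_mul_I]
    simp only [← Complex.coe_smul]
    module
  rw [h1, h2, ← neg_mul, exp_mul_I, cos_neg, sin_neg, ← ofReal_cos, ← ofReal_sin, dbar]
  simp only [map_add, map_sub, map_smul, real_smul]
  linear_combination (-Real.sin t * fderiv ℝ h z (I • e)) * I_mul_I

/-- **Cauchy–Pompeiu formula** for compactly supported functions, along a complex line. -/
theorem cauchyTransform_dbar {h : E → ℂ} (hh : ContDiff ℝ 1 h) (hc : HasCompactSupport h)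
    {R : ℝ} (hR : 0 ≤ R) (e z : E) (hz : ∀ t : ℝ, h (z - (R * exp (t * I)) • e) = 0) :
    cauchyTransform R e (dbar e h) z = 2 * Real.pi * h z := by
  have hcf := hh.continuous_fderiv (by simp)
  have hd := hh.differentiable (by simp)
  obtain ⟨C, hC⟩ := hcf.bounded_above_of_compact_support (hc.fderiv (𝕜 := ℝ))
  have hC0 : 0 ≤ C := (norm_nonneg _).trans (hC 0)
  let A : ℝ × ℝ → ℂ := fun x ↦
    fderiv ℝ h (z - ((x.1 : ℝ) * exp (x.2 * I)) • e) (exp (x.2 * I) • e)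
  let B : ℝ × ℝ → ℂ := fun x ↦
    fderiv ℝ h (z - ((x.1 : ℝ) * exp (x.2 * I)) • e) ((I * exp (x.2 * I)) • e)
  have hAc : Continuous A := by fun_prop
  have hBc : Continuous B := by fun_prop
  have hA : Integrable A (polarMeasure R) := by
    refine Integrable.of_bound hAc.aestronglyMeasurable (C * ‖e‖) (.of_forall fun x ↦ ?_)
    refine (ContinuousLinearMap.le_opNorm _ _).trans ?_
    rw [norm_smul, norm_exp_ofReal_mul_I, one_mul]
    gcongr
    exact hC _
  have hB : Integrable B (polarMeasure R) := by
    refine Integrable.of_bound hBc.aestronglyMeasurable (C * ‖e‖) (.of_forall fun x ↦ ?_)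
    refine (ContinuousLinearMap.le_opNorm _ _).trans ?_
    rw [norm_smul, norm_mul, norm_I, norm_exp_ofReal_mul_I, one_mul, one_mul]
    gcongr
    exact hC _
  have hAint : ∫ x, A x ∂(polarMeasure R) = 2 * Real.pi * h z := by
    have hr : ∀ t : ℝ, ∫ r in Ioc 0 R, A (r, t) = h z := by
      intro t
      rw [← intervalIntegral.integral_of_le hR]
      have hder : ∀ r : ℝ, HasDerivAt (fun r : ℝ ↦ -h (z - (r * exp (t * I)) • e)) (A (r, t)) r := by
        intro r
        have h1 : HasDerivAt (fun r : ℝ ↦ z - ((r : ℂ) * exp (t * I)) • e)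
            (-(((1 : ℂ) * exp (t * I)) • e)) r :=
          ((ofRealCLM.hasDerivAt.mul_const _).smul_const e).const_sub z
        have := ((hd _).hasFDerivAt.comp_hasDerivAt r h1).neg
        exact this.congr_deriv (by simp [A])
      rw [intervalIntegral.integral_eq_sub_of_hasDerivAt (fun r _ ↦ hder r)
        (Continuous.intervalIntegrable (by fun_prop) _ _), hz t]
      simp
    rw [polarMeasure, integral_prod_symm _ hA]
    simp only [hr, integral_const]
    simp [Real.pi_pos.le, ← two_mul]
  have hBint : ∫ x, B x ∂(polarMeasure R) = 0 := by
    rw [polarMeasure, integral_prod _ hB]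
    refine integral_eq_zero_of_ae ?_
    filter_upwards [ae_restrict_mem measurableSet_Ioc] with r hr
    have hr0 : (r : ℂ) ≠ 0 := by exact_mod_cast hr.1.ne'
    rw [← intervalIntegral.integral_of_le (by linarith [Real.pi_pos])]
    have hder : ∀ t : ℝ, HasDerivAt (fun t : ℝ ↦ -(h (z - (r * exp (t * I)) • e) / r))
        (B (r, t)) t := by
      intro t
      have h0 : HasDerivAt (fun t : ℝ ↦ exp ((t : ℂ) * I)) (exp (t * I) * (1 * I)) t :=
        (ofRealCLM.hasDerivAt.mul_const I).cexp
      have h1 : HasDerivAt (fun t : ℝ ↦ z - ((r : ℂ) * exp (t * I)) • e)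
          (-(((r : ℂ) * (exp (t * I) * (1 * I))) • e)) t :=
        ((h0.const_mul _).smul_const e).const_sub z
      have h2 := (((hd _).hasFDerivAt.comp_hasDerivAt t h1).div_const (r : ℂ)).neg
      refine h2.congr_deriv ?_
      have : ((r : ℂ) * (exp (t * I) * (1 * I))) • e = r • ((I * exp (t * I)) • e) := by
        rw [← Complex.coe_smul, smul_smul]; congr 1; ring
      rw [this, map_neg, map_smul, real_smul]
      simp only [B]
      field_simp
    rw [intervalIntegral.integral_eq_sub_of_hasDerivAt (fun t _ ↦ hder t)
      (Continuous.intervalIntegrable (by fun_prop) _ _)]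
    have : exp (-(Real.pi * I)) = exp (Real.pi * I) := by rw [exp_neg, exp_pi_mul_I]; norm_num
    simp [this]
  have : cauchyTransform R e (dbar e h) z = ∫ x, (A x + I * B x) ∂(polarMeasure R) := by
    rw [cauchyTransform]
    congr 1 with x
    rw [exp_neg_mul_dbar]
  rw [this, integral_add hA (hB.const_mul I), integral_const_mul, hAint, hBint]
  simp

theorem dbar_congr {f g : E → ℂ} {z : E} (h : f =ᶠ[𝓝 z] g) (v : E) : dbar v f z = dbar v g z := by
  rw [dbar, dbar, h.fderiv_eq]

@[simp]
theorem dbar_const (c : ℂ) (v z : E) : dbar v (fun _ ↦ c) z = 0 := by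
  simp [dbar]

theorem dbar_eq_zero {f : E → ℂ} {z : E} (hf : DifferentiableAt ℂ f z) (v : E) :
    dbar v f z = 0 := by
  rw [dbar, hf.fderiv_restrictScalars ℝ]
  simp only [ContinuousLinearMap.coe_restrictScalars', map_smul, smul_eq_mul, ← mul_assoc, I_mul_I]
  ring

theorem dbar_mul {f g : E → ℂ} {z : E} (hf : DifferentiableAt ℝ f z) (hg : DifferentiableAt ℝ g z)
    (v : E) : dbar v (fun x ↦ f x * g x) z = f z * dbar v g z + dbar v f z * g z := by
  rw [dbar, fderiv_fun_mul hf hg]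
  simp only [dbar, add_apply, smul_apply, smul_eq_mul]
  ring

theorem dbar_sub {f g : E → ℂ} {z : E} (hf : DifferentiableAt ℝ f z) (hg : DifferentiableAt ℝ g z)
    (v : E) : dbar v (fun x ↦ f x - g x) z = dbar v f z - dbar v g z := by
  rw [dbar, fderiv_fun_sub hf hg]
  simp only [dbar, sub_apply]
  ring

theorem dbar_neg (f : E → ℂ) (v z : E) : dbar v (fun x ↦ -f x) z = -dbar v f z := by
  simp only [dbar, fderiv_fun_neg, neg_apply]
  ring

theorem dbar_comm {f : E → ℂ} (hf : ContDiff ℝ 2 f) (v w z : E) :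
    dbar v (dbar w f) z = dbar w (dbar v f) z := by
  have hd : DifferentiableAt ℝ (fderiv ℝ f) z :=
    (hf.fderiv_right (m := 1) (by norm_num)).differentiable (by simp) z
  have key : ∀ a : E, fderiv ℝ (dbar a f) z =
      (fderiv ℝ (fderiv ℝ f) z).flip a + I • (fderiv ℝ (fderiv ℝ f) z).flip (I • a) := fun a ↦ by
    have h := fun b : E ↦ hd.hasFDerivAt.clm_apply (hasFDerivAt_const b z)
    refine ((h a).add ((h (I • a)).const_mul I)).fderiv.trans ?_
    simp
  have hs : IsSymmSndFDerivAt ℝ f z := hf.contDiffAt.isSymmSndFDerivAt (by simp)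
  rw [dbar, dbar, key, key]
  simp only [add_apply, smul_apply, smul_eq_mul, ContinuousLinearMap.flip_apply]
  rw [hs v w, hs v (I • w), hs (I • v) w, hs (I • v) (I • w)]
  ring

theorem ContDiff.dbar {f : E → ℂ} (hf : ContDiff ℝ 2 f) (v : E) : ContDiff ℝ 1 (dbar v f) := by
  have h := hf.fderiv_right (m := 1) (by norm_num)
  exact (h.clm_apply contDiff_const).add (contDiff_const.mul (h.clm_apply contDiff_const))

theorem exists_contDiff_cutoff [FiniteDimensional ℝ E] {K Ω : Set E} (hK : IsCompact K)
    (hΩ : IsOpen Ω) (hKΩ : K ⊆ Ω) :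
    ∃ χ : E → ℂ, ContDiff ℝ 2 χ ∧ HasCompactSupport χ ∧ tsupport χ ⊆ Ω ∧
      ∀ z ∈ K, χ =ᶠ[𝓝 z] fun _ ↦ 1 := by
  obtain ⟨L, hL, hKL, hLΩ⟩ := exists_compact_between hK hΩ hKΩ
  obtain ⟨φ, h1, h0, -⟩ := exists_contMDiffMap_one_nhds_of_subset_interior
    (modelWithCornersSelf ℝ E) (n := 2) hK.isClosed hKL
  have hsupp : Function.support (fun z ↦ (φ z : ℂ)) ⊆ L := fun z hz ↦ by
    by_contra hzL
    exact hz (by simp [h0 z hzL])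
  refine ⟨fun z ↦ (φ z : ℂ), ofRealCLM.contDiff.comp φ.contMDiff.contDiff,
    .of_support_subset_isCompact hL hsupp, (closure_minimal hsupp hL.isClosed).trans hLΩ,
    fun z hz ↦ ?_⟩
  filter_upwards [(eventually_nhdsSet_iff_forall.1 h1) z hz] with x hx
  simp [hx]

/-- A function holomorphic on `Ω \ K` agrees, on a nonempty open subset of `Ω \ K`, with a function
holomorphic on `Ω`. -/
theorem exists_holomorphic_eventuallyEq [FiniteDimensional ℂ E] {e : E} (he : e ≠ 0)
    {ℓ : E →L[ℂ] ℂ} (hℓ : ℓ ≠ 0) (hℓe : ℓ e = 0)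
    {Ω K : Set E} (hΩ : IsOpen Ω) (hΩb : Bornology.IsBounded Ω) (hK : IsCompact K) (hKΩ : K ⊆ Ω)
    (hKne : K.Nonempty) {f : E → ℂ} (hf : DifferentiableOn ℂ f (Ω \ K)) :
    ∃ F : E → ℂ, DifferentiableOn ℂ F Ω ∧ ∃ z ∈ Ω \ K, F =ᶠ[𝓝 z] f := by
  have : FiniteDimensional ℝ E := FiniteDimensional.complexToReal E
  have : ProperSpace E := FiniteDimensional.proper ℝ E
  obtain ⟨χ, hχ, hχc, hχΩ, hχK⟩ := exists_contDiff_cutoff hK hΩ hKΩ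
  have hχd : Differentiable ℝ χ := hχ.differentiable (by simp)
  have hW : IsOpen (Ω \ K) := hΩ.sdiff hK.isClosed
  have hfd : ∀ z ∈ Ω \ K, DifferentiableAt ℂ f z := fun z hz ↦
    hf.differentiableAt (hW.mem_nhds hz)
  have hfC : ContDiffOn ℝ 1 f (Ω \ K) :=
    (contDiffOn_one_of_differentiableOn_complex hW hf).restrict_scalars ℝ
  have hχ0 : ∀ z ∉ tsupport χ, χ =ᶠ[𝓝 z] fun _ ↦ 0 := fun z hz ↦
    notMem_tsupport_iff_eventuallyEq.1 hz
  have hdχ : ∀ z ∉ Ω \ K, ∀ v, dbar v χ =ᶠ[𝓝 z] fun _ ↦ 0 := fun z hz v ↦ by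
    by_cases hzK : z ∈ K
    · filter_upwards [(hχK z hzK).eventually_nhds] with x hx
      rw [dbar_congr hx, dbar_const]
    · filter_upwards [(hχ0 z fun h ↦ hz ⟨hχΩ h, hzK⟩).eventually_nhds] with x hx
      rw [dbar_congr hx, dbar_const]
  let ω : E → E → ℂ := fun v z ↦ -dbar v χ z * f z
  have hω0 : ∀ z ∉ Ω \ K, ∀ v, ω v =ᶠ[𝓝 z] fun _ ↦ 0 := fun z hz v ↦ by
    filter_upwards [hdχ z hz v] with x hx
    simp [ω, hx]
  have hωC : ∀ v, ContDiff ℝ 1 (ω v) := fun v ↦ contDiff_iff_contDiffAt.2 fun z ↦ by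
    by_cases hz : z ∈ Ω \ K
    · exact (hχ.dbar v).neg.contDiffAt.mul (hfC.contDiffAt (hW.mem_nhds hz))
    · exact contDiffAt_const.congr_of_eventuallyEq (hω0 z hz v)
  have hωs : ∀ v, ∀ z ∉ tsupport χ, ω v z = 0 := fun v z hz ↦ by
    simp [ω, dbar_congr (hχ0 z hz)]
  have hωc : ∀ v, HasCompactSupport (ω v) := fun v ↦ .intro hχc (hωs v)
  have hωsymm : ∀ v w, dbar v (ω w) = dbar w (ω v) := fun v w ↦ by
    ext z
    by_cases hz : z ∈ Ω \ K
    · have h := fun a b : E ↦ dbar_mul (f := fun x ↦ -dbar a χ x) (g := f) (z := z)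
        (((hχ.dbar a).differentiable (by simp) z).neg) ((hfd z hz).restrictScalars ℝ) b
      simp only [ω]
      rw [h, h, dbar_neg, dbar_neg, dbar_comm hχ v w, dbar_eq_zero (hfd z hz), dbar_eq_zero (hfd z hz)]
      ring
    · rw [dbar_congr (hω0 z hz w), dbar_congr (hω0 z hz v), dbar_const, dbar_const]
  obtain ⟨M, hM0, hM⟩ := hΩb.exists_pos_norm_lt
  let R := 2 * M / ‖e‖
  have he' : 0 < ‖e‖ := norm_pos_iff.2 he
  have hR : 0 ≤ R := by positivity
  let c : ℂ := (2 * Real.pi : ℂ)⁻¹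
  let u : E → ℂ := fun z ↦ c * cauchyTransform R e (ω e) z
  have hud : ∀ z, DifferentiableAt ℝ u z := fun z ↦
    (hasFDerivAt_cauchyTransform (hωC e) (hωc e) R e z).differentiableAt.const_mul c
  have hdu : ∀ z ∈ Ω, ∀ v, dbar v u z = ω v z := fun z hz v ↦ by
    have h1 := dbar_mul (f := fun _ ↦ c) (g := cauchyTransform R e (ω e)) (z := z)
      (differentiableAt_const c)
      (hasFDerivAt_cauchyTransform (hωC e) (hωc e) R e z).differentiableAt v
    rw [dbar_const, zero_mul, add_zero, dbar_cauchyTransform (hωC e) (hωc e), hωsymm v e,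
      cauchyTransform_dbar (hωC v) (hωc v) hR e z fun t ↦ hωs v _ fun hmem ↦ ?_] at h1
    · rw [h1]
      have : (Real.pi : ℂ) ≠ 0 := by exact_mod_cast Real.pi_ne_zero
      simp only [c]
      field_simp
    · have h2 := hM _ (hχΩ hmem)
      have h3 : ‖((R : ℂ) * exp (t * I)) • e‖ = 2 * M := by
        rw [norm_smul, norm_mul, norm_exp_ofReal_mul_I, norm_real, Real.norm_of_nonneg hR]
        simp only [R]
        field_simp
      have h4 := norm_sub_norm_le (((R : ℂ) * exp (t * I)) • e) z
      rw [norm_sub_rev] at h4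
      linarith [hM z hz]
  let g : E → ℂ := fun z ↦ (1 - χ z) * f z
  have hg : ∀ z ∈ Ω, DifferentiableAt ℝ g z ∧ ∀ v, dbar v g z = ω v z := fun z hz ↦ by
    by_cases hzK : z ∈ K
    · have h0 : g =ᶠ[𝓝 z] fun _ ↦ 0 := by
        filter_upwards [hχK z hzK] with x hx
        simp [g, hx]
      refine ⟨(differentiableAt_const 0).congr_of_eventuallyEq h0, fun v ↦ ?_⟩
      rw [dbar_congr h0, dbar_const, (hω0 z (fun h ↦ h.2 hzK) v).self_of_nhds]
    · have hfz := hfd z ⟨hz, hzK⟩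
      have h1 : DifferentiableAt ℝ (fun x ↦ 1 - χ x) z := (hχd z).const_sub 1
      refine ⟨h1.mul (hfz.restrictScalars ℝ), fun v ↦ ?_⟩
      rw [dbar_mul h1 (hfz.restrictScalars ℝ), dbar_eq_zero hfz,
        dbar_sub (differentiableAt_const 1) (hχd z), dbar_const]
      simp [ω]
  refine ⟨fun z ↦ g z - u z, fun z hz ↦ ?_, ?_⟩
  · refine (differentiableAt_complex_of_real (f := fun z ↦ g z - u z)
      ((hg z hz).1.sub (hud z)) fun v ↦ ?_).differentiableWithinAt
    rw [dbar_sub (hg z hz).1 (hud z), (hg z hz).2, hdu z hz, sub_self]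
  have hKL : K ⊆ tsupport χ := fun z hz ↦ subset_tsupport χ (by
    simp [(hχK z hz).self_of_nhds])
  obtain ⟨p, hp, hmax⟩ := (show IsCompact (tsupport χ) from hχc).exists_isMaxOn (hKne.mono hKL)
    (f := fun z ↦ (ℓ z).re) (by fun_prop)
  have hH : ∀ z, (ℓ p).re < (ℓ z).re → z ∉ tsupport χ := fun z hz h ↦ (hmax h).not_gt hz
  obtain ⟨v, hv⟩ : ∃ v, ℓ v = 1 := by
    obtain ⟨w, hw⟩ := DFunLike.ne_iff.1 hℓ
    exact ⟨(ℓ w)⁻¹ • w, by simpa using inv_mul_cancel₀ hw⟩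
  have hcont : Continuous fun t : ℝ ↦ p + (t : ℂ) • v := by fun_prop
  have hev : ∀ᶠ t : ℝ in 𝓝[>] 0, p + (t : ℂ) • v ∈ Ω :=
    ((hcont.tendsto' 0 p (by simp)).eventually (hΩ.mem_nhds (hχΩ hp))).filter_mono
      nhdsWithin_le_nhds
  obtain ⟨t, htΩ, ht⟩ := (hev.and self_mem_nhdsWithin).exists
  have hq : (ℓ p).re < (ℓ (p + (t : ℂ) • v)).re := by
    simpa [hv] using ht
  refine ⟨p + (t : ℂ) • v, ⟨htΩ, fun h ↦ hH _ hq (hKL h)⟩, ?_⟩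
  have hopen : IsOpen {z | (ℓ p).re < (ℓ z).re} := isOpen_lt (by fun_prop) (by fun_prop)
  filter_upwards [hopen.mem_nhds hq] with z hz
  have hu0 : u z = 0 := by
    have : ∀ s : ℂ, ω e (z - s • e) = 0 := fun s ↦ hωs e _ (hH _ (by simpa [hℓe] using hz))
    simp [u, cauchyTransform, this]
  simp [g, hu0, image_eq_zero_of_notMem_tsupport (hH z hz)]

end

/-- **Hartogs extension theorem in ℂⁿ.** For `n ≥ 2`, a bounded open connected
`Ω ⊆ ℂⁿ` and a compact `K ⊆ Ω` with `Ω \ K` connected, every function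
holomorphic on `Ω \ K` extends to a function holomorphic on `Ω`, uniquely
(as a holomorphic function on `Ω`, i.e. up to its values on `Ω`). -/
theorem hartogs_extension_Cn (n : ℕ) (hn : 2 ≤ n)
    (Ω : Set (EuclideanSpace ℂ (Fin n))) (hΩopen : IsOpen Ω)
    (hΩbdd : Bornology.IsBounded Ω) (hΩconn : IsConnected Ω)
    (K : Set (EuclideanSpace ℂ (Fin n))) (hKcpt : IsCompact K) (hKΩ : K ⊆ Ω)
    (hΩK : IsConnected (Ω \ K))
    (f : EuclideanSpace ℂ (Fin n) → ℂ) (hf : DifferentiableOn ℂ f (Ω \ K)) :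
    ∃ F : EuclideanSpace ℂ (Fin n) → ℂ,
      (DifferentiableOn ℂ F Ω ∧ Set.EqOn F f (Ω \ K)) ∧
      ∀ G : EuclideanSpace ℂ (Fin n) → ℂ,
        (DifferentiableOn ℂ G Ω ∧ Set.EqOn G f (Ω \ K)) → Set.EqOn G F Ω := by
  have hW : IsOpen (Ω \ K) := hΩopen.sdiff hKcpt.isClosed
  obtain ⟨F, hF, hFf⟩ : ∃ F : EuclideanSpace ℂ (Fin n) → ℂ, DifferentiableOn ℂ F Ω ∧
      Set.EqOn F f (Ω \ K) := by
    rcases K.eq_empty_or_nonempty with rfl | hKne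
    · exact ⟨f, by simpa using hf, Set.eqOn_refl _ _⟩
    let i : Fin n := ⟨0, by lia⟩
    let j : Fin n := ⟨1, by lia⟩
    have hij : j ≠ i := by simp [i, j]
    obtain ⟨F, hF, z, hz, hFz⟩ := exists_holomorphic_eventuallyEq
      (e := EuclideanSpace.single i (1 : ℂ)) (by simp)
      (ℓ := EuclideanSpace.proj j) (fun h ↦ by
        simpa using DFunLike.congr_fun h (EuclideanSpace.single j (1 : ℂ)))
      (by simp [hij]) hΩopen hΩbdd hKcpt hKΩ hKne hf
    refine ⟨F, hF, fun w hw ↦ sub_eq_zero.1 ?_⟩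
    exact eqOn_zero_of_differentiableOn_of_eventuallyEq hW hΩK.isPreconnected
      ((hF.mono Set.sdiff_subset).sub hf) hz (by
        filter_upwards [hFz] with x hx
        simp [hx]) hw
  refine ⟨F, ⟨hF, hFf⟩, fun G ⟨hG, hGf⟩ w hw ↦ sub_eq_zero.1 ?_⟩
  obtain ⟨z, hz⟩ := hΩK.nonempty
  exact eqOn_zero_of_differentiableOn_of_eventuallyEq hΩopen hΩconn.isPreconnected
    (hG.sub hF) hz.1 (by
      filter_upwards [hW.mem_nhds hz] with x hx
      simp [hGf hx, hFf hx]) hw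
end

section
/- Let n ≥ 2 and let X ⊆ ℂⁿ be an open connected set admitting a smooth (C^∞) strongly (n−1)-convex exhaustion function ρ : X → ℝ, i.e. {z ∈ X : ρ(z) ≤ c} is compact for every c ∈ ℝ and the Levi form of ρ has at least 2 positive eigenvalues at every point of X. Let Ω ⊆ X be open and connected, and let K ⊆ Ω be compact with Ω \ K connected. Then every function f holomorphic on Ω \ K extends uniquely to a function F holomorphic on Ω with F = f on Ω \ K. -/
/-- The Levi-form quadratic expression `Q_f(z)(v) = D²f(z)(v,v) + D²f(z)(iv,iv)`,
which equals four times the Levi form `Σ (∂²f/∂z_j∂z̄_k)(z) v_j v̄_k`. -/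
noncomputable def leviQ (n : ℕ) (f : EuclideanSpace ℂ (Fin n) → ℝ)
    (z v : EuclideanSpace ℂ (Fin n)) : ℝ :=
  iteratedFDeriv ℝ 2 f z ![v, v]
    + iteratedFDeriv ℝ 2 f z ![Complex.I • v, Complex.I • v]

/-- The Levi form of `f` at `z` has at least `p` positive eigenvalues: there is a
complex-linear subspace `F ⊆ ℂⁿ` of complex dimension `p` on which `Q_f(z)` is
positive away from `0`. -/
def LeviPosEigenvalues (n : ℕ) (f : EuclideanSpace ℂ (Fin n) → ℝ)
    (z : EuclideanSpace ℂ (Fin n)) (p : ℕ) : Prop :=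
  ∃ F : Submodule ℂ (EuclideanSpace ℂ (Fin n)),
    Module.finrank ℂ F = p ∧ ∀ v ∈ F, v ≠ 0 → 0 < leviQ n f z v

namespace Hartogs

open Set Filter Topology MeasureTheory Metric

variable {E : Type*} [NormedAddCommGroup E] [NormedSpace ℂ E]

/-- Twice the `∂̄`-derivative of `f` at `z` in the direction `v`. -/
noncomputable def dbar (f : E → ℂ) (z v : E) : ℂ :=
  fderiv ℝ f z v + Complex.I * fderiv ℝ f z (Complex.I • v)

theorem dbar_congr {f g : E → ℂ} {z : E} (h : f =ᶠ[𝓝 z] g) (v : E) :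
    dbar f z v = dbar g z v := by
  simp only [dbar, h.fderiv_eq]

theorem dbar_const (c : ℂ) (z v : E) : dbar (fun _ : E => c) z v = 0 := by
  simp [dbar]

theorem dbar_eq_zero_of_notMem_tsupport {f : E → ℂ} {z : E} (h : z ∉ tsupport f) (v : E) :
    dbar f z v = 0 :=
  (dbar_congr (notMem_tsupport_iff_eventuallyEq.1 h) v).trans (dbar_const 0 z v)

theorem dbar_sub {f g : E → ℂ} {z : E} (hf : DifferentiableAt ℝ f z)
    (hg : DifferentiableAt ℝ g z) (v : E) :
    dbar (fun x => f x - g x) z v = dbar f z v - dbar g z v := by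
  simp only [dbar, fderiv_fun_sub hf hg, sub_apply]
  ring

theorem dbar_mul {f g : E → ℂ} {z : E} (hf : DifferentiableAt ℝ f z)
    (hg : DifferentiableAt ℝ g z) (v : E) :
    dbar (fun x => f x * g x) z v = f z * dbar g z v + g z * dbar f z v := by
  simp only [dbar, fderiv_fun_mul hf hg, add_apply,
    smul_apply, smul_eq_mul]
  ring

theorem dbar_const_mul {f : E → ℂ} {z : E} (hf : DifferentiableAt ℝ f z) (c : ℂ) (v : E) :
    dbar (fun x => c * f x) z v = c * dbar f z v := by
  rw [dbar_mul (differentiableAt_const c) hf, dbar_const, mul_zero, add_zero]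

theorem dbar_eq_zero {f : E → ℂ} {z : E} (hf : DifferentiableAt ℂ f z) (v : E) :
    dbar f z v = 0 := by
  simp only [dbar, hf.fderiv_restrictScalars ℝ, ContinuousLinearMap.coe_restrictScalars',
    map_smul, smul_eq_mul]
  linear_combination (fderiv ℂ f z v) * Complex.I_mul_I

theorem differentiableAt_of_dbar_eq_zero {f : E → ℂ} {z : E} (hf : DifferentiableAt ℝ f z)
    (h : ∀ v, dbar f z v = 0) : DifferentiableAt ℂ f z := by
  have hI : ∀ v, fderiv ℝ f z (Complex.I • v) = Complex.I * fderiv ℝ f z v := fun v => by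
    have := h v
    simp only [dbar] at this
    linear_combination (-Complex.I) * this + fderiv ℝ f z (Complex.I • v) * Complex.I_mul_I
  rw [differentiableAt_iff_restrictScalars ℝ hf]
  refine ⟨⟨⟨⟨fderiv ℝ f z, map_add _⟩, fun c v => ?_⟩, (fderiv ℝ f z).continuous⟩, ?_⟩
  · have hc : c • v = c.re • v + c.im • Complex.I • v := by
      conv_lhs => rw [← Complex.re_add_im c]
      rw [add_smul, mul_smul, Complex.coe_smul, Complex.coe_smul]
    have := congrArg (fderiv ℝ f z) hc
    simp only [map_add, map_smul, hI] at this
    simp only [RingHom.id_apply, smul_eq_mul]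
    refine this.trans ?_
    conv_rhs => rw [← Complex.re_add_im c]
    simp only [Complex.real_smul]
    ring
  · ext v
    rfl

theorem dbar_smul_direction (f : E → ℂ) (z e : E) (θ : ℝ) :
    Complex.exp (-(θ * Complex.I)) * dbar f z e =
      fderiv ℝ f z (Complex.exp (θ * Complex.I) • e) +
        Complex.I * fderiv ℝ f z (Complex.I • Complex.exp (θ * Complex.I) • e) := by
  have hw : Complex.exp (θ * Complex.I) = (Real.cos θ : ℂ) + Real.sin θ * Complex.I := by
    rw [Complex.exp_mul_I]; simp
  have hw' : Complex.exp (-(θ * Complex.I)) = (Real.cos θ : ℂ) - Real.sin θ * Complex.I := by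
    rw [← neg_mul, Complex.exp_mul_I]; simp [sub_eq_add_neg]
  have h1 : Complex.exp (θ * Complex.I) • e =
      Real.cos θ • e + Real.sin θ • Complex.I • e := by
    rw [hw, add_smul, mul_smul, Complex.coe_smul, Complex.coe_smul]
  have h2 : Complex.I • Complex.exp (θ * Complex.I) • e =
      Real.cos θ • Complex.I • e - Real.sin θ • e := by
    rw [h1, smul_add, smul_comm Complex.I, smul_comm Complex.I (Real.sin θ), smul_smul Complex.I,
      Complex.I_mul_I, neg_one_smul, smul_neg, sub_eq_add_neg]
  rw [h2, h1, hw']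
  simp only [dbar, map_add, map_sub, map_smul, Complex.real_smul]
  linear_combination (-(Real.sin θ : ℂ) * fderiv ℝ f z (Complex.I • e)) * Complex.I_mul_I

theorem contDiff_dbar {f : E → ℂ} (hf : ContDiff ℝ 2 f) (v : E) :
    ContDiff ℝ 1 (fun x => dbar f x v) := by
  have h : ContDiff ℝ 1 (fderiv ℝ f) := hf.fderiv_right (by norm_num)
  simp only [dbar]
  exact (h.clm_apply contDiff_const).add
    (contDiff_const.mul (h.clm_apply contDiff_const))

theorem dbar_dbar_comm {f : E → ℂ} (hf : ContDiff ℝ 2 f) (z v w : E) :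
    dbar (fun x => dbar f x v) z w = dbar (fun x => dbar f x w) z v := by
  have h : Differentiable ℝ (fderiv ℝ f) :=
    (hf.fderiv_right (m := 1) (by norm_num)).differentiable one_ne_zero
  have hs : IsSymmSndFDerivAt ℝ f z := hf.contDiffAt.isSymmSndFDerivAt (by simp)
  have key : ∀ a b : E, fderiv ℝ (fun x => dbar f x a) z b =
      fderiv ℝ (fderiv ℝ f) z b a + Complex.I * fderiv ℝ (fderiv ℝ f) z b (Complex.I • a) := by
    intro a b
    have h1 : ∀ c : E, HasFDerivAt (fun x => fderiv ℝ f x c)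
        ((fderiv ℝ (fderiv ℝ f) z).flip c) z := fun c => by
      simpa using (h z).hasFDerivAt.clm_apply (hasFDerivAt_const c z)
    have h2 := (h1 a).add ((h1 (Complex.I • a)).const_mul Complex.I)
    have h3 : HasFDerivAt (fun x => dbar f x a) _ z := h2
    rw [h3.fderiv]
    simp
  have e1 := hs.eq v w
  have e2 := hs.eq (Complex.I • v) w
  have e3 := hs.eq v (Complex.I • w)
  have e4 := hs.eq (Complex.I • v) (Complex.I • w)
  rw [dbar, dbar, key, key, key, key, e1, e2, e3, e4]
  ring

/-- A holomorphic function on an open set is continuously differentiable. -/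
theorem contDiffOn_of_differentiableOn [ProperSpace E] {f : E → ℂ} {U : Set E} (hU : IsOpen U)
    (hf : DifferentiableOn ℂ f U) : ContDiffOn ℂ 1 f U := by
  have hcont : ContinuousOn (fderiv ℂ f) U := by
    intro x hx
    refine ContinuousAt.continuousWithinAt ?_
    obtain ⟨r, hr, hrU⟩ := Metric.isOpen_iff.1 hU x hx
    have huc : UniformContinuousOn f (closedBall x (r / 2)) :=
      (isCompact_closedBall x (r / 2)).uniformContinuousOn_of_continuous
        (hf.continuousOn.mono ((closedBall_subset_ball (by linarith)).trans hrU))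
    rw [Metric.uniformContinuousOn_iff] at huc
    rw [Metric.continuousAt_iff]
    intro ε hε
    obtain ⟨δ, hδ, hd⟩ := huc (ε * (r / 4) / 4) (by positivity)
    refine ⟨min δ (r / 4), by positivity, fun {y} hy => ?_⟩
    have hyδ : dist y x < δ := hy.trans_le (min_le_left _ _)
    have hyr : dist y x < r / 4 := hy.trans_le (min_le_right _ _)
    have hmem : ∀ h ∈ ball (0 : E) (r / 4),
        x + h ∈ closedBall x (r / 2) ∧ y + h ∈ closedBall x (r / 2) := by
      intro h hh
      rw [mem_ball_zero_iff] at hh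
      rw [dist_eq_norm] at hyr
      simp only [mem_closedBall, dist_eq_norm]
      constructor
      · rw [add_sub_cancel_left]; linarith
      · rw [show y + h - x = (y - x) + h by abel]
        linarith [norm_add_le (y - x) h]
    have hdiff : ∀ h ∈ ball (0 : E) (r / 4), ∀ p, p + h ∈ closedBall x (r / 2) →
        DifferentiableAt ℂ (fun t => f (p + t)) h := by
      intro h _ p hp
      have : DifferentiableAt ℂ f (p + h) :=
        (hf _ (hrU (closedBall_subset_ball (by linarith) hp))).differentiableAt
          (hU.mem_nhds (hrU (closedBall_subset_ball (by linarith) hp)))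
      exact this.comp h (by fun_prop)
    have hsmall : ∀ h ∈ ball (0 : E) (r / 4), ‖f (y + h) - f (x + h)‖ < ε * (r / 4) / 4 := by
      intro h hh
      rw [← dist_eq_norm]
      exact hd _ (hmem h hh).2 _ (hmem h hh).1 (by rwa [dist_add_right])
    have h0 : (0 : E) ∈ ball (0 : E) (r / 4) := by simpa using hr
    have hbound := Complex.norm_fderiv_le_div_of_mapsTo_ball
      (f := fun h => f (y + h) - f (x + h)) (c := (0 : E)) (R₁ := r / 4) (R₂ := ε * (r / 4) / 2)
      (fun h hh => ((hdiff h hh y (hmem h hh).2).sub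
        (hdiff h hh x (hmem h hh).1)).differentiableWithinAt)
      (fun h hh => by
        rw [mem_closedBall, dist_eq_norm]
        have := norm_sub_le (f (y + h) - f (x + h)) (f (y + 0) - f (x + 0))
        linarith [hsmall h hh, hsmall 0 h0])
      (by positivity)
    rw [fderiv_fun_sub (hdiff 0 h0 y (hmem 0 h0).2) (hdiff 0 h0 x (hmem 0 h0).1),
      fderiv_comp_add_left, fderiv_comp_add_left, add_zero, add_zero] at hbound
    rw [dist_eq_norm]
    refine hbound.trans_lt ?_
    rw [div_lt_iff₀ (by positivity)]
    nlinarith [mul_pos hε hr]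
  have := (contDiffOn_succ_iff_fderiv_of_isOpen (𝕜 := ℂ) (n := 0) (f := f) hU).2
    ⟨hf, by simp, contDiffOn_zero.2 hcont⟩
  simpa using this

/-- The identity theorem for holomorphic functions of several variables. -/
theorem eqOn_of_eventuallyEq {f g : E → ℂ} {U : Set E} (hU : IsOpen U) (hUc : IsPreconnected U)
    (hf : DifferentiableOn ℂ f U) (hg : DifferentiableOn ℂ g U) {z₀ : E} (hz₀ : z₀ ∈ U)
    (h : f =ᶠ[𝓝 z₀] g) : EqOn f g U := by
  have hsub : U ⊆ {z | f =ᶠ[𝓝 z] g} := by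
    refine hUc.subset_of_closure_inter_subset isOpen_setOfPred_eventually_nhds ⟨z₀, hz₀, h⟩ ?_
    rintro x ⟨hx, hxU⟩
    obtain ⟨r, hr, hrU⟩ := Metric.isOpen_iff.1 hU x hxU
    obtain ⟨w, hw, hwx⟩ := Metric.mem_closure_iff.1 hx r hr
    rw [dist_comm] at hwx
    refine Filter.eventually_of_mem (ball_mem_nhds x hr) fun y hy => ?_
    set c : ℂ → E := fun t => w + t • (y - w) with hc
    have hcd : Differentiable ℂ c := by fun_prop
    set V : Set ℂ := c ⁻¹' ball x r with hV
    have hVo : IsOpen V := isOpen_ball.preimage hcd.continuous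
    have hVc : Convex ℝ V := by
      intro s hs t ht a b ha hb hab
      have : c (a • s + b • t) = a • c s + b • c t := by
        obtain rfl : a = 1 - b := by linarith
        simp only [hc, ← Complex.coe_smul, smul_eq_mul]
        push_cast
        module
      rw [hV, mem_preimage, this]
      exact convex_ball x r hs ht ha hb hab
    have hd : ∀ k : E → ℂ, DifferentiableOn ℂ k U → AnalyticOnNhd ℂ (k ∘ c) V :=
      fun k hk => (hk.comp hcd.differentiableOn fun t ht => hrU ht).analyticOnNhd hVo
    have h0 : c 0 = w := by simp [hc]
    have h1 : c 1 = y := by simp [hc]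
    have hev : f ∘ c =ᶠ[𝓝 0] g ∘ c := by
      have : Tendsto c (𝓝 0) (𝓝 w) := h0 ▸ hcd.continuous.tendsto 0
      exact this.eventually hw
    have := (hd f hf).eqOn_of_preconnected_of_eventuallyEq (hd g hg) hVc.isPreconnected
      (show (0 : ℂ) ∈ V by simpa [hV, h0] using hwx) hev
      (show (1 : ℂ) ∈ V by simpa [hV, h1] using hy)
    simpa [h1] using this
  exact fun z hz => (hsub hz).self_of_nhds

/-- The measure `dr dθ` on the half-strip `r > 0`, `0 < θ ≤ 2π`. -/
noncomputable def polarMeasure : Measure (ℝ × ℝ) :=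
  ((volume : Measure ℝ).restrict (Ioi 0)).prod
    ((volume : Measure ℝ).restrict (Ioc 0 (2 * Real.pi)))

theorem integrable_polarMeasure {V : Type*} [NormedAddCommGroup V] {g : ℝ × ℝ → V}
    (hg : Continuous g) {R : ℝ} (h : ∀ p : ℝ × ℝ, R < p.1 → g p = 0) :
    Integrable g polarMeasure := by
  rw [polarMeasure, Measure.prod_restrict]
  change IntegrableOn g _ _
  have hc : IntegrableOn g (Icc 0 R ×ˢ Icc 0 (2 * Real.pi))
      ((volume : Measure ℝ).prod volume) :=
    hg.continuousOn.integrableOn_compact (isCompact_Icc.prod isCompact_Icc)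
  refine IntegrableOn.of_forall_sdiff_eq_zero hc
    (measurableSet_Ioi.prod measurableSet_Ioc) ?_
  rintro ⟨r, θ⟩ ⟨⟨hr, hθ⟩, hn⟩
  refine h _ ?_
  by_contra hR
  exact hn ⟨⟨(show 0 < r from hr).le, not_lt.1 hR⟩, ⟨hθ.1.le, hθ.2⟩⟩

/-- The point `z + r e^{iθ} e` of the complex line through `z` in direction `e`. -/
noncomputable def polarPoint (e z : E) (p : ℝ × ℝ) : E :=
  z + ((p.1 : ℂ) * Complex.exp (p.2 * Complex.I)) • e

theorem continuous_polarPoint (e z : E) : Continuous (polarPoint e z) := by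
  unfold polarPoint
  fun_prop

theorem exists_forall_polarPoint_notMem {e : E} (he : e ≠ 0) {S : Set E}
    (hS : Bornology.IsBounded S) (z₀ : E) :
    ∃ R : ℝ, ∀ z ∈ ball z₀ 1, ∀ p : ℝ × ℝ, R < p.1 → polarPoint e z p ∉ S := by
  obtain ⟨M, hM⟩ := hS.exists_norm_le
  have he' : 0 < ‖e‖ := norm_pos_iff.2 he
  refine ⟨(max M 0 + ‖z₀‖ + 1) / ‖e‖, fun z hz p hp hmem => ?_⟩
  have h1 := hM _ hmem
  have hp0 : 0 ≤ p.1 := le_trans (by positivity) hp.le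
  have h2 : ‖((p.1 : ℂ) * Complex.exp (p.2 * Complex.I)) • e‖ = p.1 * ‖e‖ := by
    rw [norm_smul, norm_mul, Complex.norm_exp_ofReal_mul_I, mul_one, Complex.norm_real,
      Real.norm_of_nonneg hp0]
  have h3 : ‖z‖ < ‖z₀‖ + 1 := by
    rw [mem_ball, dist_eq_norm] at hz
    have := norm_add_le z₀ (z - z₀)
    rw [add_sub_cancel] at this
    linarith
  rw [div_lt_iff₀ he'] at hp
  have h4 := norm_sub_le (polarPoint e z p) z
  rw [show polarPoint e z p - z = ((p.1 : ℂ) * Complex.exp (p.2 * Complex.I)) • e by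
    simp [polarPoint], h2] at h4
  linarith [le_max_left M 0]

/-- The solid Cauchy transform of `H` along complex lines in the direction `e`, in polar
coordinates. -/
noncomputable def lineCauchy (e : E) (H : E → ℂ) (z : E) : ℂ :=
  ∫ p, Complex.exp (-(p.2 * Complex.I)) * H (polarPoint e z p) ∂polarMeasure

theorem hasFDerivAt_lineCauchy {e : E} (he : e ≠ 0) {H : E → ℂ} (hH : ContDiff ℝ 1 H)
    (hHc : HasCompactSupport H) (z₀ : E) :
    HasFDerivAt (lineCauchy e H) (∫ p, Complex.exp (-(p.2 * Complex.I)) •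
      fderiv ℝ H (polarPoint e z₀ p) ∂polarMeasure) z₀ := by
  obtain ⟨R, hR⟩ := exists_forall_polarPoint_notMem he hHc.isBounded z₀
  have hcd : Continuous (fderiv ℝ H) := hH.continuous_fderiv one_ne_zero
  obtain ⟨C, hC⟩ := (hHc.fderiv (𝕜 := ℝ)).exists_bound_of_continuous hcd
  have hexp : Continuous fun p : ℝ × ℝ => Complex.exp (-(p.2 * Complex.I)) := by fun_prop
  have hnorm : ∀ p : ℝ × ℝ, ‖Complex.exp (-(p.2 * Complex.I))‖ = 1 := fun p => by
    rw [← neg_mul, ← Complex.ofReal_neg, Complex.norm_exp_ofReal_mul_I]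
  refine hasFDerivAt_integral_of_dominated_of_fderiv_le (ball_mem_nhds z₀ one_pos)
    (F := fun z p => Complex.exp (-(p.2 * Complex.I)) * H (polarPoint e z p))
    (F' := fun z p => Complex.exp (-(p.2 * Complex.I)) • fderiv ℝ H (polarPoint e z p))
    (bound := fun p => C * max 0 (min 1 (R + 1 - p.1))) ?_ ?_ ?_ ?_ ?_ ?_
  · exact .of_forall fun z =>
      (hexp.mul (hH.continuous.comp (continuous_polarPoint e z))).aestronglyMeasurable
  · refine integrable_polarMeasure (R := R)
      (hexp.mul (hH.continuous.comp (continuous_polarPoint e z₀))) fun p hp => ?_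
    rw [image_eq_zero_of_notMem_tsupport (hR z₀ (mem_ball_self one_pos) p hp), mul_zero]
  · exact (hexp.smul (hcd.comp (continuous_polarPoint e z₀))).aestronglyMeasurable
  · refine .of_forall fun p z hz => ?_
    rw [norm_smul, hnorm, one_mul]
    have hC0 : 0 ≤ C := (norm_nonneg _).trans (hC z)
    rcases le_or_gt p.1 R with h | h
    · rw [min_eq_left (by linarith), max_eq_right zero_le_one, mul_one]
      exact hC _
    · rw [fderiv_of_notMem_tsupport ℝ (hR z hz p h), norm_zero]
      positivity
  · refine integrable_polarMeasure (R := R + 1) (by fun_prop) fun p hp => ?_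
    rw [max_eq_left ((min_le_right _ _).trans (by linarith)), mul_zero]
  · refine .of_forall fun p z _ => ?_
    have h1 : HasFDerivAt H (fderiv ℝ H (polarPoint e z p)) (polarPoint e z p) :=
      (hH.differentiable one_ne_zero _).hasFDerivAt
    exact ((hasFDerivAt_comp_add_right _).2 h1).const_mul _

theorem dbar_lineCauchy {e : E} (he : e ≠ 0) {H : E → ℂ} (hH : ContDiff ℝ 1 H)
    (hHc : HasCompactSupport H) (z v : E) :
    dbar (lineCauchy e H) z v = lineCauchy e (fun x => dbar H x v) z := by
  obtain ⟨R, hR⟩ := exists_forall_polarPoint_notMem he hHc.isBounded z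
  have hcd : Continuous (fderiv ℝ H) := hH.continuous_fderiv one_ne_zero
  have hexp : Continuous fun p : ℝ × ℝ => Complex.exp (-(p.2 * Complex.I)) := by fun_prop
  have hint : Integrable (fun p : ℝ × ℝ => Complex.exp (-(p.2 * Complex.I)) •
      fderiv ℝ H (polarPoint e z p)) polarMeasure := by
    refine integrable_polarMeasure (R := R)
      (hexp.smul (hcd.comp (continuous_polarPoint e z))) fun p hp => ?_
    rw [fderiv_of_notMem_tsupport ℝ (hR z (mem_ball_self one_pos) p hp)]
    ext w
    simp
  rw [dbar, (hasFDerivAt_lineCauchy he hH hHc z).fderiv, ContinuousLinearMap.integral_apply hint,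
    ContinuousLinearMap.integral_apply hint, ← integral_const_mul, ← integral_add]
  · refine integral_congr_ae (.of_forall fun p => ?_)
    simp only [smul_apply, smul_eq_mul, dbar]
    ring
  · exact hint.apply_continuousLinearMap v
  · exact (hint.apply_continuousLinearMap _).const_mul _

/-- The Cauchy–Pompeiu formula on complex lines, for functions of compact support. -/
theorem lineCauchy_dbar {e : E} (he : e ≠ 0) {H : E → ℂ} (hH : ContDiff ℝ 1 H)
    (hHc : HasCompactSupport H) (z : E) :
    lineCauchy e (fun x => dbar H x e) z = -(2 * Real.pi * H z) := by
  obtain ⟨R, hR⟩ := exists_forall_polarPoint_notMem he hHc.isBounded z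
  replace hR := hR z (mem_ball_self one_pos)
  have hcd : Continuous (fderiv ℝ H) := hH.continuous_fderiv one_ne_zero
  have hd : Differentiable ℝ H := hH.differentiable one_ne_zero
  set A : ℝ × ℝ → ℂ := fun p =>
    fderiv ℝ H (polarPoint e z p) (Complex.exp (p.2 * Complex.I) • e) with hA
  set B : ℝ × ℝ → ℂ := fun p =>
    fderiv ℝ H (polarPoint e z p) (Complex.I • Complex.exp (p.2 * Complex.I) • e) with hB
  have hAc : Continuous A :=
    (hcd.comp (continuous_polarPoint e z)).clm_apply (by fun_prop)
  have hBc : Continuous B :=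
    (hcd.comp (continuous_polarPoint e z)).clm_apply (by fun_prop)
  have hAi : Integrable A polarMeasure := by
    refine integrable_polarMeasure (R := R) hAc fun p hp => ?_
    simp [hA, fderiv_of_notMem_tsupport ℝ (hR p hp)]
  have hBi : Integrable B polarMeasure := by
    refine integrable_polarMeasure (R := R) hBc fun p hp => ?_
    simp [hB, fderiv_of_notMem_tsupport ℝ (hR p hp)]
  have hr : ∀ r θ : ℝ, HasDerivAt (fun r : ℝ => H (polarPoint e z (r, θ))) (A (r, θ)) r := by
    intro r θ
    have h1 : HasDerivAt (fun r : ℝ => polarPoint e z (r, θ))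
        (Complex.exp (θ * Complex.I) • e) r := by
      have h2 : HasDerivAt (fun r : ℝ => (r : ℂ) * Complex.exp (θ * Complex.I))
          (Complex.exp (θ * Complex.I)) r := by
        simpa using (Complex.ofRealCLM.hasDerivAt (x := r)).mul_const (Complex.exp (θ * Complex.I))
      exact (h2.smul_const e).const_add z
    exact (hd _).hasFDerivAt.comp_hasDerivAt r h1
  have hθ : ∀ r θ : ℝ, HasDerivAt (fun θ : ℝ => H (polarPoint e z (r, θ))) (r * B (r, θ)) θ := by
    intro r θ
    have h1 : HasDerivAt (fun θ : ℝ => polarPoint e z (r, θ))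
        (r • Complex.I • Complex.exp (θ * Complex.I) • e) θ := by
      have h2 : HasDerivAt (fun θ : ℝ => (r : ℂ) * Complex.exp (θ * Complex.I))
          (r * (Complex.exp (θ * Complex.I) * Complex.I)) θ := by
        have h3 : HasDerivAt (fun θ : ℝ => (θ : ℂ) * Complex.I) Complex.I θ := by
          simpa using (Complex.ofRealCLM.hasDerivAt (x := θ)).mul_const Complex.I
        exact h3.cexp.const_mul _
      have h4 := (h2.smul_const e).const_add z
      rw [mul_smul, mul_comm, mul_smul, Complex.coe_smul] at h4
      exact h4
    have h5 := (hd (polarPoint e z (r, θ))).hasFDerivAt.comp_hasDerivAt θ h1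
    rw [map_smul, Complex.real_smul] at h5
    exact h5
  have hAint : ∫ p, A p ∂polarMeasure = -(2 * Real.pi * H z) := by
    have hslice : ∀ θ : ℝ, ∫ r in Ioi (0 : ℝ), A (r, θ) = - H z := by
      intro θ
      rw [integral_Ioi_of_hasDerivAt_of_tendsto' (f := fun r : ℝ => H (polarPoint e z (r, θ)))
        (m := 0) (fun r _ => hr r θ)]
      · simp [polarPoint]
      · have hcA : Continuous fun r : ℝ => A (r, θ) :=
          hAc.comp (Continuous.prodMk_left θ)
        refine IntegrableOn.of_forall_sdiff_eq_zero (s := Icc 0 R)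
          (hcA.continuousOn.integrableOn_compact isCompact_Icc) measurableSet_Ioi ?_
        rintro r ⟨hr0, hrn⟩
        have : R < r := by
          by_contra hR'
          exact hrn ⟨(show 0 < r from hr0).le, not_lt.1 hR'⟩
        simp [hA, fderiv_of_notMem_tsupport ℝ (hR (r, θ) this)]
      · refine tendsto_const_nhds.congr' ?_
        filter_upwards [eventually_gt_atTop R] with r hr
        exact (image_eq_zero_of_notMem_tsupport (hR (r, θ) hr)).symm
    rw [polarMeasure, integral_prod_symm _ hAi]
    simp only [hslice]
    simp [Real.pi_pos.le]
  have hBint : ∫ p, B p ∂polarMeasure = 0 := by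
    rw [polarMeasure, integral_prod _ hBi]
    refine setIntegral_eq_zero_of_forall_eq_zero fun r hr0 => ?_
    have hr0' : (r : ℂ) ≠ 0 := by exact_mod_cast (show 0 < r from hr0).ne'
    have hcB : Continuous fun θ : ℝ => B (r, θ) :=
      hBc.comp (Continuous.prodMk_right r)
    have := intervalIntegral.integral_eq_sub_of_hasDerivAt (a := 0) (b := 2 * Real.pi)
      (fun θ _ => hθ r θ) ((continuous_const.mul hcB).intervalIntegrable _ _)
    rw [intervalIntegral.integral_const_mul, intervalIntegral.integral_of_le
      (by positivity)] at this
    have hper : H (polarPoint e z (r, 2 * Real.pi)) - H (polarPoint e z (r, 0)) = 0 := by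
      simp [polarPoint]
    rw [hper] at this
    exact (mul_eq_zero.1 this).resolve_left hr0'
  calc lineCauchy e (fun x => dbar H x e) z
      = ∫ p, (A p + Complex.I * B p) ∂polarMeasure := by
        refine integral_congr_ae (.of_forall fun p => ?_)
        exact dbar_smul_direction H _ e p.2
    _ = -(2 * Real.pi * H z) := by
        rw [integral_add hAi (hBi.const_mul _), integral_const_mul, hAint, hBint, mul_zero,
          add_zero]

theorem exists_contDiff_cutoff [FiniteDimensional ℂ E] {K U : Set E} (hK : IsCompact K)
    (hU : IsOpen U) (hKU : K ⊆ U) :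
    ∃ χ : E → ℂ, ContDiff ℝ 2 χ ∧ HasCompactSupport χ ∧ tsupport χ ⊆ U ∧
      ∀ x ∈ K, χ =ᶠ[𝓝 x] fun _ => 1 := by
  have : ProperSpace E := FiniteDimensional.proper ℂ E
  obtain ⟨L, hL, hKL, hLU⟩ := exists_compact_between hK hU hKU
  obtain ⟨χ, h1, h0, -⟩ := exists_contMDiffMap_one_nhds_of_subset_interior
    (n := 2) (modelWithCornersSelf ℝ E) hK.isClosed hKL
  have hsupp : Function.support (fun x => (χ x : ℂ)) ⊆ L := fun x hx => by
    by_contra hxL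
    exact hx (by simp [h0 x hxL])
  refine ⟨fun x => (χ x : ℂ), ?_, HasCompactSupport.of_support_subset_isCompact hL hsupp,
    (closure_minimal hsupp hL.isClosed).trans hLU, fun x hx => ?_⟩
  · exact Complex.ofRealCLM.contDiff.comp χ.contMDiff.contDiff
  · filter_upwards [h1.filter_mono (nhds_le_nhdsSet hx)] with y hy
    simp [hy]

/-- Every component of the complement of a nonempty closed set meets every open neighbourhood
of that set. -/
theorem connectedComponentIn_compl_inter_nonempty {S U : Set E} (hS : IsClosed S)
    (hSne : S.Nonempty) (hU : IsOpen U) (hSU : S ⊆ U) {p : E} (hp : p ∉ S) :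
    (connectedComponentIn Sᶜ p ∩ U).Nonempty := by
  set V := connectedComponentIn Sᶜ p with hV
  have hVo : IsOpen V := hS.isOpen_compl.connectedComponentIn
  have hpV : p ∈ V := mem_connectedComponentIn hp
  have hVS : V ⊆ Sᶜ := connectedComponentIn_subset _ _
  have hfr : (frontier V).Nonempty := by
    rw [nonempty_frontier_iff]
    refine ⟨⟨p, hpV⟩, fun h => ?_⟩
    obtain ⟨s, hs⟩ := hSne
    exact hVS (h ▸ mem_univ s) hs
  obtain ⟨q, hq⟩ := hfr
  rw [hVo.frontier_eq] at hq
  have hqS : q ∈ S := by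
    by_contra hqS
    have hpre : IsPreconnected (insert q V) :=
      isPreconnected_connectedComponentIn.subset_closure (subset_insert q V)
        (insert_subset hq.1 subset_closure)
    exact hq.2 (hpre.subset_connectedComponentIn (mem_insert_of_mem q hpV)
      (insert_subset hqS hVS) (mem_insert q V))
  rw [inter_comm]
  exact mem_closure_iff.1 hq.1 U hU (hSU hqS)

/-- **Hartogs' extension theorem**: compact singularities of holomorphic functions of at least
two variables are removable. That the dimension is at least two is expressed by a nonzero linear
functional `l` having a nonzero vector `e` in its kernel. -/
theorem exists_differentiableOn_extension [FiniteDimensional ℂ E] {e : E} (he : e ≠ 0)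
    {l : E →L[ℂ] ℂ} (hl : l ≠ 0) (hle : l e = 0) {Ω K : Set E} (hΩ : IsOpen Ω)
    (hK : IsCompact K) (hKΩ : K ⊆ Ω) (hΩK : IsPreconnected (Ω \ K)) {f : E → ℂ}
    (hf : DifferentiableOn ℂ f (Ω \ K)) :
    ∃ F : E → ℂ, DifferentiableOn ℂ F Ω ∧ EqOn F f (Ω \ K) := by
  rcases K.eq_empty_or_nonempty with rfl | hKne
  · exact ⟨f, by simpa using hf, fun _ _ => rfl⟩
  have : ProperSpace E := FiniteDimensional.proper ℂ E
  have hΩKo : IsOpen (Ω \ K) := hΩ.sdiff hK.isClosed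
  obtain ⟨χ, hχ, hχc, hχΩ, hχ1⟩ := exists_contDiff_cutoff hK hΩ hKΩ
  have hχd : Differentiable ℝ χ := hχ.differentiable two_ne_zero
  have hfd : ∀ x ∈ Ω \ K, DifferentiableAt ℂ f x := fun x hx =>
    (hf x hx).differentiableAt (hΩKo.mem_nhds hx)
  set H : E → E → ℂ := fun v x => f x * dbar χ x v with hH
  have hH0 : ∀ x ∉ Ω \ K, ∀ v, H v =ᶠ[𝓝 x] fun _ => 0 := by
    intro x hx v
    by_cases hxK : x ∈ K
    · filter_upwards [(hχ1 x hxK).eventuallyEq_nhds] with y hy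
      simp [hH, dbar_congr hy, dbar_const]
    · have hxS : x ∉ tsupport χ := fun h => hx ⟨hχΩ h, hxK⟩
      filter_upwards [(isClosed_tsupport χ).isOpen_compl.mem_nhds hxS] with y hy
      simp [hH, dbar_eq_zero_of_notMem_tsupport hy]
  have hHS : ∀ x ∉ tsupport χ, ∀ v, H v x = 0 := fun x hx v => by
    simp [hH, dbar_eq_zero_of_notMem_tsupport hx]
  have hHcd : ∀ v, ContDiff ℝ 1 (H v) := by
    refine fun v => contDiff_iff_contDiffAt.2 fun x => ?_
    by_cases hx : x ∈ Ω \ K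
    · have h1 : ContDiffAt ℝ 1 f x :=
        ((contDiffOn_of_differentiableOn hΩKo hf).restrict_scalars ℝ).contDiffAt
          (hΩKo.mem_nhds hx)
      exact h1.mul (contDiff_dbar hχ v).contDiffAt
    · exact contDiffAt_const.congr_of_eventuallyEq (hH0 x hx v)
  have hHc : ∀ v, HasCompactSupport (H v) := fun v =>
    HasCompactSupport.of_support_subset_isCompact hχc fun x hx => by
      by_contra hxS
      exact hx (hHS x hxS v)
  have hcomm : ∀ v x, dbar (H e) x v = dbar (H v) x e := by
    intro v x
    by_cases hx : x ∈ Ω \ K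
    · have hd : ∀ w, DifferentiableAt ℝ (fun x => dbar χ x w) x := fun w =>
        (contDiff_dbar hχ w).differentiable one_ne_zero x
      have hfr : DifferentiableAt ℝ f x := (hfd x hx).restrictScalars ℝ
      simp only [hH]
      rw [dbar_mul hfr (hd e), dbar_mul hfr (hd v), dbar_eq_zero (hfd x hx),
        dbar_eq_zero (hfd x hx), dbar_dbar_comm hχ, mul_zero, mul_zero]
    · rw [dbar_congr (hH0 x hx e), dbar_congr (hH0 x hx v), dbar_const, dbar_const]
  set u : E → ℂ := fun z => (2 * Real.pi : ℂ)⁻¹ * lineCauchy e (H e) z with hu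
  have hCd : Differentiable ℝ (lineCauchy e (H e)) := fun z =>
    (hasFDerivAt_lineCauchy he (hHcd e) (hHc e) z).differentiableAt
  have hud : Differentiable ℝ u := fun z => (hCd z).const_mul _
  have hdu : ∀ z v, dbar u z v = -H v z := by
    intro z v
    have hpi : (2 * Real.pi : ℂ) ≠ 0 := by
      exact_mod_cast (mul_pos two_pos Real.pi_pos).ne'
    rw [hu, dbar_const_mul (hCd z), dbar_lineCauchy he (hHcd e) (hHc e)]
    simp only [hcomm v]
    rw [lineCauchy_dbar he (hHcd v) (hHc v), mul_neg, inv_mul_cancel_left₀ hpi]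
  set F : E → ℂ := fun z => (1 - χ z) * f z - u z with hF
  have hFd : DifferentiableOn ℂ F Ω := by
    intro z hz
    refine DifferentiableAt.differentiableWithinAt ?_
    have key : DifferentiableAt ℝ (fun x => (1 - χ x) * f x) z ∧
        ∀ v, dbar (fun x => (1 - χ x) * f x) z v = -H v z := by
      by_cases hzK : z ∈ K
      · have h0 : (fun x => (1 - χ x) * f x) =ᶠ[𝓝 z] fun _ => 0 := by
          filter_upwards [hχ1 z hzK] with y hy
          simp [hy]
        refine ⟨(differentiableAt_const _).congr_of_eventuallyEq h0, fun v => ?_⟩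
        rw [dbar_congr h0, dbar_const, (hH0 z (fun h => h.2 hzK) v).self_of_nhds, neg_zero]
      · have hfz := hfd z ⟨hz, hzK⟩
        have h1 : DifferentiableAt ℝ (fun x => 1 - χ x) z :=
          (differentiableAt_const _).sub (hχd z)
        refine ⟨h1.mul (hfz.restrictScalars ℝ), fun v => ?_⟩
        rw [dbar_mul h1 (hfz.restrictScalars ℝ), dbar_eq_zero hfz,
          dbar_sub (differentiableAt_const _) (hχd z), dbar_const]
        simp [hH]
    refine differentiableAt_of_dbar_eq_zero (key.1.sub (hud z)) fun v => ?_
    rw [hF, dbar_sub key.1 (hud z), key.2, hdu, sub_self]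
  obtain ⟨M, hM⟩ := hχc.exists_bound_of_continuousOn (f := l) l.continuous.continuousOn
  obtain ⟨w, hw⟩ : ∃ w, l w ≠ 0 := by
    by_contra! h
    exact hl (ContinuousLinearMap.ext h)
  set p : E := (((|M| + 1 : ℝ) : ℂ) / l w) • w with hp
  have hlp : M < ‖l p‖ := by
    rw [hp, map_smul, smul_eq_mul, div_mul_cancel₀ _ hw, Complex.norm_real,
      Real.norm_of_nonneg (by positivity)]
    linarith [le_abs_self M]
  have hpS : p ∉ tsupport χ := fun h => (hM p h).not_gt hlp
  have hup : u =ᶠ[𝓝 p] fun _ => 0 := by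
    filter_upwards [(isOpen_lt continuous_const l.continuous.norm).mem_nhds hlp] with z hz
    have : lineCauchy e (H e) z = 0 := by
      refine integral_eq_zero_of_ae (.of_forall fun q => ?_)
      have hq : polarPoint e z q ∉ tsupport χ := fun h => by
        have := hM _ h
        rw [polarPoint, map_add, map_smul, hle, smul_zero, add_zero] at this
        exact this.not_gt hz
      simp [hHS _ hq e]
    simp [hu, this]
  have hSo : IsOpen (tsupport χ)ᶜ := (isClosed_tsupport χ).isOpen_compl
  set V := connectedComponentIn (tsupport χ)ᶜ p with hV
  have hVS : V ⊆ (tsupport χ)ᶜ := connectedComponentIn_subset _ _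
  have hVo : IsOpen V := hSo.connectedComponentIn
  have huV : EqOn u (fun _ => 0) V := by
    refine eqOn_of_eventuallyEq hVo isPreconnected_connectedComponentIn (fun z hz => ?_)
      (differentiableOn_const 0) (mem_connectedComponentIn hpS) hup
    refine (differentiableAt_of_dbar_eq_zero (hud z) fun v => ?_).differentiableWithinAt
    rw [hdu, hHS z (hVS hz), neg_zero]
  have hKS : K ⊆ tsupport χ := fun x hx => subset_tsupport χ (by
    rw [Function.mem_support, (hχ1 x hx).self_of_nhds]
    exact one_ne_zero)
  obtain ⟨y, hyV, hyΩ⟩ := connectedComponentIn_compl_inter_nonempty (isClosed_tsupport χ)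
    (hKne.mono hKS) hΩ hχΩ hpS
  refine ⟨F, hFd, eqOn_of_eventuallyEq hΩKo hΩK (hFd.mono sdiff_subset) hf
    ⟨hyΩ, fun h => hVS hyV (hKS h)⟩ ?_⟩
  filter_upwards [hVo.mem_nhds hyV] with x hx
  simp [hF, huV hx, image_eq_zero_of_notMem_tsupport (hVS hx)]

end Hartogs

/-- **Hartogs extension on an (n−1)-complete open subset of ℂⁿ** (the smooth,
normal special case of the paper's Theorem 2.2): if the open connected set
`X ⊆ ℂⁿ`, `n ≥ 2`, carries a `C^∞` strongly `(n−1)`-convex exhaustion function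
`ρ` (Levi form with at least 2 positive eigenvalues everywhere), then for every
open connected `Ω ⊆ X` and compact `K ⊆ Ω` with `Ω \ K` connected, holomorphic
functions on `Ω \ K` extend uniquely holomorphically to `Ω`. -/
theorem hartogs_extension_n_minus_one_complete (n : ℕ) (hn : 2 ≤ n)
    (X : Set (EuclideanSpace ℂ (Fin n))) (hXopen : IsOpen X) (hXconn : IsConnected X)
    (ρ : EuclideanSpace ℂ (Fin n) → ℝ) (hρsmooth : ContDiffOn ℝ (⊤ : ℕ∞) ρ X)
    (hρexh : ∀ c : ℝ, IsCompact {z ∈ X | ρ z ≤ c})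
    (hρconv : ∀ z ∈ X, LeviPosEigenvalues n ρ z 2)
    (Ω : Set (EuclideanSpace ℂ (Fin n))) (hΩopen : IsOpen Ω) (hΩconn : IsConnected Ω)
    (hΩX : Ω ⊆ X)
    (K : Set (EuclideanSpace ℂ (Fin n))) (hKcpt : IsCompact K) (hKΩ : K ⊆ Ω)
    (hΩK : IsConnected (Ω \ K))
    (f : EuclideanSpace ℂ (Fin n) → ℂ) (hf : DifferentiableOn ℂ f (Ω \ K)) :
    ∃ F : EuclideanSpace ℂ (Fin n) → ℂ,
      (DifferentiableOn ℂ F Ω ∧ Set.EqOn F f (Ω \ K)) ∧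
      ∀ G : EuclideanSpace ℂ (Fin n) → ℂ,
        (DifferentiableOn ℂ G Ω ∧ Set.EqOn G f (Ω \ K)) → Set.EqOn G F Ω := by
  set e : EuclideanSpace ℂ (Fin n) := EuclideanSpace.single ⟨0, by omega⟩ 1 with he
  set l : EuclideanSpace ℂ (Fin n) →L[ℂ] ℂ := EuclideanSpace.proj ⟨1, by omega⟩ with hl
  have he0 : e ≠ 0 := by simp [he]
  have hl0 : l ≠ 0 := fun h => by
    have := congrArg (fun g => g (EuclideanSpace.single ⟨1, by omega⟩ 1)) h
    simp [hl] at this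
  have hle : l e = 0 := by simp [he, hl]
  obtain ⟨F, hFd, hFf⟩ := Hartogs.exists_differentiableOn_extension he0 hl0 hle hΩopen hKcpt hKΩ
    hΩK.isPreconnected hf
  refine ⟨F, ⟨hFd, hFf⟩, fun G ⟨hGd, hGf⟩ => ?_⟩
  obtain ⟨z, hz⟩ := hΩK.nonempty
  refine Hartogs.eqOn_of_eventuallyEq hΩopen hΩconn.isPreconnected hGd hFd hz.1 ?_
  filter_upwards [(hΩopen.sdiff hKcpt.isClosed).mem_nhds hz] with x hx
  rw [hGf hx, hFf hx]
end

section
/- Let n ≥ 2, let Ω ⊆ ℂⁿ (identified with ℝ^{2n}) be an open connected set, and let K ⊆ Ω be a nonempty compact set such that Ω \ K is connected. Then there exists an open connected set D with K ⊆ D, with closure(D) compact and contained in Ω, such that the topological boundary M := frontier(D) is connected and is a C^∞ hypersurface; concretely, for every p ∈ M there exist an open neighborhood V of p and a C^∞ function g : V → ℝ whose (real) differential is nonvanishing at every point of V, such that D ∩ V = {z ∈ V : g(z) < 0} and M ∩ V = {z ∈ V : g(z) = 0}. -/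
open Set Topology Metric

/-- A simply connected, locally path connected normal space is unicoherent. -/
theorem isPreconnected_inter_of_union_eq_univ {X : Type*} [TopologicalSpace X] [NormalSpace X]
    [SimplyConnectedSpace X] [LocallyPathConnectedSpace X] {A B : Set X}
    (hA : IsClosed A) (hB : IsClosed B) (hA' : IsPreconnected A) (hB' : IsPreconnected B)
    (hAB : A ∪ B = univ) : IsPreconnected (A ∩ B) := by
  rw [isPreconnected_iff_subset_of_fully_disjoint_closed (hA.inter hB)]
  intro u v hu hv huv hd
  by_contra! hcon
  obtain ⟨⟨a, ha, hau⟩, ⟨b, hb, hbv⟩⟩ := hcon.imp not_subset.1 not_subset.1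
  have hav : a ∈ v := (huv ha).resolve_left hau
  have hbu : b ∈ u := (huv hb).resolve_right hbv
  obtain ⟨f, hfu, hfv, -⟩ := exists_continuous_zero_one_of_isClosed hu hv hd
  have hfa : f a = 1 := hfv hav
  have hfb : f b = 0 := hfu hbu
  classical
  let φ : X → Circle := fun x ↦
    if x ∈ A then Circle.exp (Real.pi * f x) else Circle.exp (-(Real.pi * f x))
  have hagree : ∀ x ∈ A ∩ B, Circle.exp (Real.pi * f x) = Circle.exp (-(Real.pi * f x)) := by
    intro x hx
    rw [Circle.exp_eq_exp]
    rcases huv hx with h | h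
    · exact ⟨0, by simp [show f x = 0 from hfu h]⟩
    · exact ⟨1, by simp [show f x = 1 from hfv h]; ring⟩
  have hφ : Continuous φ := by
    refine Continuous.if (fun x hx ↦ hagree x ⟨hA.frontier_subset hx, ?_⟩)
      (by fun_prop) (by fun_prop)
    have h1 : x ∈ closure Aᶜ := by
      have := frontier_subset_closure (frontier_compl A ▸ hx)
      exact this
    exact closure_minimal (fun y hy ↦ ((hAB ▸ mem_univ y : y ∈ A ∪ B).resolve_left hy)) hB h1
  have hφA : ∀ x ∈ A, φ x = Circle.exp (Real.pi * f x) := fun x hx ↦ if_pos hx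
  have hφB : ∀ x ∈ B, φ x = Circle.exp (-(Real.pi * f x)) := by
    intro x hx
    by_cases h : x ∈ A
    · rw [hφA x h, hagree x ⟨h, hx⟩]
    · exact if_neg h
  have hφb : φ b = 1 := by simp [hφA b hb.1, hfb]
  obtain ⟨L, ⟨-, hL⟩, -⟩ := Circle.isCoveringMap_exp.existsUnique_continuousMap_lifts
    ⟨φ, hφ⟩ (a₀ := b) (e₀ := 0) (by simp [hφb])
  have hL' : ∀ x, Circle.exp (L x) = φ x := fun x ↦ congrFun hL x
  have h1 : L a = Real.pi * f a + L b :=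
    Circle.isCoveringMap_exp.eqOn_of_comp_eqOn hA' (g₁ := L)
      (g₂ := fun x ↦ Real.pi * f x + L b) (by fun_prop) (by fun_prop)
      (fun x hx ↦ by simp [hL', hφA x hx, Circle.exp_add, hφb]) hb.1 (by simp [hfb]) ha.1
  have h2 : L a = -(Real.pi * f a) + L b :=
    Circle.isCoveringMap_exp.eqOn_of_comp_eqOn hB' (g₁ := L)
      (g₂ := fun x ↦ -(Real.pi * f x) + L b) (by fun_prop) (by fun_prop)
      (fun x hx ↦ by simp [hL', hφB x hx, Circle.exp_add, Circle.exp_neg, hφb]) hb.2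
      (by simp [hfb]) ha.2
  rw [hfa] at h1 h2
  linarith [Real.pi_pos]

/-- Removing a closed set with empty interior which locally does not disconnect does not
disconnect globally. -/
theorem IsPreconnected.diff_of_locally {X : Type*} [TopologicalSpace X] {W S : Set X}
    (hW : IsPreconnected W) (hWo : IsOpen W) (hS : Dense Sᶜ)
    (h : ∀ x ∈ W, ∃ B, IsOpen B ∧ x ∈ B ∧ B ⊆ W ∧ IsPreconnected (B \ S)) :
    IsPreconnected (W \ S) := by
  rw [isPreconnected_iff_subset_of_disjoint]
  intro u v hu hv huv hd
  by_contra! hcon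
  obtain ⟨⟨a, ha, hau⟩, ⟨b, hb, hbv⟩⟩ := hcon.imp not_subset.1 not_subset.1
  have hav : a ∈ v := (huv ha).resolve_left hau
  have hbu : b ∈ u := (huv hb).resolve_right hbv
  have hcov : W ⊆ closure (u ∩ (W \ S)) ∪ closure (v ∩ (W \ S)) := by
    rw [← closure_union, ← union_inter_distrib_right, inter_eq_self_of_subset_right huv]
    exact hS.open_subset_closure_inter hWo
  obtain ⟨x, hxW, hxu, hxv⟩ := isPreconnected_closed_iff.1 hW _ _ isClosed_closure
    isClosed_closure hcov ⟨b, hb.1, subset_closure ⟨hbu, hb⟩⟩ ⟨a, ha.1, subset_closure ⟨hav, ha⟩⟩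
  obtain ⟨B, hBo, hxB, hBW, hB⟩ := h x hxW
  obtain ⟨y, hyB, hyu, hy⟩ := mem_closure_iff.1 hxu B hBo hxB
  obtain ⟨z, hzB, hzv, hz⟩ := mem_closure_iff.1 hxv B hBo hxB
  obtain ⟨w, hw, hw'⟩ := hB u v hu hv ((sdiff_subset_sdiff_left hBW).trans huv)
    ⟨y, ⟨hyB, hy.2⟩, hyu⟩ ⟨z, ⟨hzB, hz.2⟩, hzv⟩
  have : w ∈ (W \ S) ∩ (u ∩ v) := ⟨⟨hBW hw.1, hw.2⟩, hw'⟩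
  rw [hd] at this
  exact this

/-- A closed set is nonseparating if removing it from a connected open set leaves
a connected set. -/
def IsNonseparating {X : Type*} [TopologicalSpace X] (S : Set X) : Prop :=
  IsClosed S ∧ ∀ W : Set X, IsOpen W → IsPreconnected W → IsPreconnected (W \ S)

theorem IsNonseparating.union {X : Type*} [TopologicalSpace X] {S T : Set X}
    (hS : IsNonseparating S) (hT : IsNonseparating T) : IsNonseparating (S ∪ T) := by
  refine ⟨hS.1.union hT.1, fun W hWo hW ↦ ?_⟩
  rw [← sdiff_sdiff]
  exact hT.2 _ (hWo.sdiff hS.1) (hS.2 W hWo hW)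

section NormedSpace

variable {E : Type*} [NormedAddCommGroup E] [NormedSpace ℝ E]

theorem mem_affineSpan_of_segment_inter_segment {x z a b : E} (hx : x ∉ segment ℝ a b)
    (h : ¬ Disjoint (segment ℝ x z) (segment ℝ a b)) : z ∈ affineSpan ℝ {x, a, b} := by
  obtain ⟨w, hwz, hwab⟩ := Set.not_disjoint_iff.1 h
  have hw : w ∈ affineSpan ℝ {x, a, b} := by
    have h1 : segment ℝ a b ⊆ affineSpan ℝ {x, a, b} :=
      (AffineSubspace.convex _).segment_subset (subset_affineSpan ℝ _ (by simp))
        (subset_affineSpan ℝ _ (by simp))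
    exact h1 hwab
  have hxs : x ∈ affineSpan ℝ {x, a, b} := subset_affineSpan ℝ _ (by simp)
  rw [segment_eq_image_lineMap] at hwz
  obtain ⟨t, -, rfl⟩ := hwz
  have ht : t ≠ 0 := by
    rintro rfl
    exact hx (by simpa using hwab)
  have : z = AffineMap.lineMap x (AffineMap.lineMap x z t) t⁻¹ := by
    simp [AffineMap.lineMap_apply, ht]
  rw [this]
  exact AffineMap.lineMap_mem _ hxs hw

variable [FiniteDimensional ℝ E]

theorem affineSpan_triple_ne_top (hE : 2 < Module.finrank ℝ E) (x a b : E) :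
    affineSpan ℝ {x, a, b} ≠ ⊤ := by
  intro h
  have h1 := coplanar_triple ℝ x a b
  have h2 : vectorSpan ℝ {x, a, b} = ⊤ := by
    rw [← direction_affineSpan, h, AffineSubspace.direction_top]
  rw [Coplanar, h2, rank_top, ← Module.finrank_eq_rank] at h1
  have : Module.finrank ℝ E ≤ 2 := by exact_mod_cast h1
  omega

theorem dense_compl_affineSpan_triple_union (hE : 2 < Module.finrank ℝ E) (x y a b : E) :
    Dense ((affineSpan ℝ {x, a, b} : Set E) ∪ affineSpan ℝ {y, a, b})ᶜ := by
  borelize E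
  refine MeasureTheory.Measure.dense_of_ae (μ := MeasureTheory.Measure.addHaar) ?_
  refine MeasureTheory.measure_eq_zero_iff_ae_notMem.1 (MeasureTheory.measure_union_null
    (MeasureTheory.Measure.addHaar_affineSubspace _ _ (affineSpan_triple_ne_top hE x a b))
    (MeasureTheory.Measure.addHaar_affineSubspace _ _ (affineSpan_triple_ne_top hE y a b)))

theorem isNonseparating_segment (hE : 2 < Module.finrank ℝ E) (a b : E) :
    IsNonseparating (segment ℝ a b) := by
  have hclosed : IsClosed (segment ℝ a b) := by
    rw [segment_eq_image_lineMap]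
    exact (isCompact_Icc.image (by fun_prop)).isClosed
  refine ⟨hclosed, fun W hWo hW ↦ hW.diff_of_locally hWo ?_ fun x hx ↦ ?_⟩
  · refine (dense_compl_affineSpan_triple_union hE a a a b).mono (compl_subset_compl.2 ?_)
    exact Subset.trans ((AffineSubspace.convex (affineSpan ℝ {a, a, b})).segment_subset
        (subset_affineSpan ℝ _ (by simp)) (subset_affineSpan ℝ _ (by simp))) subset_union_left
  · obtain ⟨r, hr, hrW⟩ := Metric.isOpen_iff.1 hWo x hx
    refine ⟨ball x r, isOpen_ball, mem_ball_self hr, hrW, ?_⟩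
    refine isPreconnected_of_forall_pair fun y hy z hz ↦ ?_
    obtain ⟨w, hwx, hw⟩ := (dense_compl_affineSpan_triple_union hE y z a b).inter_open_nonempty
      (ball x r) isOpen_ball ⟨x, mem_ball_self hr⟩
    simp only [mem_compl_iff, mem_union, SetLike.mem_coe, not_or] at hw
    have hyw : Disjoint (segment ℝ y w) (segment ℝ a b) := by
      by_contra h
      exact hw.1 (mem_affineSpan_of_segment_inter_segment hy.2 h)
    have hzw : Disjoint (segment ℝ z w) (segment ℝ a b) := by
      by_contra h
      exact hw.2 (mem_affineSpan_of_segment_inter_segment hz.2 h)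
    refine ⟨segment ℝ y w ∪ segment ℝ z w, union_subset ?_ ?_,
      Or.inl (left_mem_segment ℝ y w), Or.inr (left_mem_segment ℝ z w),
      (convex_segment y w).isPreconnected.union w (right_mem_segment ℝ y w)
        (right_mem_segment ℝ z w) (convex_segment z w).isPreconnected⟩
    · exact subset_sdiff.2 ⟨(convex_ball x r).segment_subset hy.1 hwx, hyw⟩
    · exact subset_sdiff.2 ⟨(convex_ball x r).segment_subset hz.1 hwx, hzw⟩

/-- Two points of a connected open set can be joined by a compact connected nonseparating set. -/
theorem IsPreconnected.exists_isNonseparating_joining (hE : 2 < Module.finrank ℝ E) {W : Set E}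
    (hWo : IsOpen W) (hW : IsPreconnected W) {x y : E} (hx : x ∈ W) (hy : y ∈ W) :
    ∃ S ⊆ W, IsNonseparating S ∧ IsCompact S ∧ IsPreconnected S ∧ x ∈ S ∧ y ∈ S := by
  refine hW.induction₂ (fun x y ↦ ∃ S ⊆ W, IsNonseparating S ∧ IsCompact S ∧ IsPreconnected S ∧
    x ∈ S ∧ y ∈ S) (fun x hx ↦ ?_) ?_ ?_ hx hy
  · obtain ⟨r, hr, hrW⟩ := Metric.isOpen_iff.1 hWo x hx
    filter_upwards [mem_nhdsWithin_of_mem_nhds (ball_mem_nhds x hr)] with y hy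
    refine ⟨segment ℝ x y, ((convex_ball x r).segment_subset (mem_ball_self hr) hy).trans hrW,
      isNonseparating_segment hE x y, ?_, (convex_segment x y).isPreconnected,
      left_mem_segment ℝ x y, right_mem_segment ℝ x y⟩
    rw [segment_eq_image_lineMap]
    exact isCompact_Icc.image (by fun_prop)
  · rintro x y z - - - ⟨S, hSW, hS1, hS2, hS3, hxS, hyS⟩ ⟨T, hTW, hT1, hT2, hT3, hyT, hzT⟩
    exact ⟨S ∪ T, union_subset hSW hTW, hS1.union hT1, hS2.union hT2, hS3.union y hyS hyT hT3,
      Or.inl hxS, Or.inr hzT⟩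
  · rintro x y - - ⟨S, hSW, hS1, hS2, hS3, hxS, hyS⟩
    exact ⟨S, hSW, hS1, hS2, hS3, hyS, hxS⟩

/-- A finite subset of a connected open set lies in a compact connected nonseparating subset. -/
theorem IsConnected.exists_isNonseparating_superset (hE : 2 < Module.finrank ℝ E) {W : Set E}
    (hWo : IsOpen W) (hW : IsConnected W) {F : Set E} (hF : F.Finite) (hFW : F ⊆ W) :
    ∃ S ⊆ W, IsNonseparating S ∧ IsCompact S ∧ IsConnected S ∧ F ⊆ S := by
  induction F, hF using Set.Finite.induction_on with
  | empty =>
    obtain ⟨x, hx⟩ := hW.nonempty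
    obtain ⟨S, h1, h2, h3, h4, h5, -⟩ :=
      hW.isPreconnected.exists_isNonseparating_joining hE hWo hx hx
    exact ⟨S, h1, h2, h3, ⟨⟨x, h5⟩, h4⟩, empty_subset _⟩
  | @insert a F _ _ ih =>
    obtain ⟨S, h1, h2, h3, h4, h5⟩ := ih ((subset_insert _ _).trans hFW)
    obtain ⟨x, hx⟩ := h4.nonempty
    obtain ⟨T, k1, k2, k3, k4, k5, k6⟩ :=
      hW.isPreconnected.exists_isNonseparating_joining hE hWo (h1 hx) (hFW (mem_insert a F))
    exact ⟨S ∪ T, union_subset h1 k1, h2.union k2, h3.union k3,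
      ⟨⟨x, Or.inl hx⟩, h4.isPreconnected.union x hx k5 k4⟩,
      insert_subset (Or.inr k6) (h5.trans subset_union_left)⟩

theorem IsConnected.union_biUnion {X ι : Type*} [TopologicalSpace X] {S : Set X} {t : Set ι}
    {A : ι → Set X} (hS : IsConnected S) (hA : ∀ i ∈ t, IsPreconnected (A i))
    (hSA : ∀ i ∈ t, (S ∩ A i).Nonempty) : IsConnected (S ∪ ⋃ i ∈ t, A i) := by
  obtain ⟨x, hx⟩ := hS.nonempty
  refine ⟨⟨x, Or.inl hx⟩, isPreconnected_of_forall x fun y hy ↦ ?_⟩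
  rcases hy with hy | hy
  · exact ⟨S, subset_union_left, hx, hy, hS.isPreconnected⟩
  · obtain ⟨i, hi, hy⟩ := mem_iUnion₂.1 hy
    exact ⟨S ∪ A i, union_subset_union_right _ (subset_biUnion_of_mem (u := A) hi), Or.inl hx,
      Or.inr hy, hS.isPreconnected.union' (hSA i hi) (hA i hi)⟩

/-- A compact subset of a connected open set lies in a compact connected subset. -/
theorem IsConnected.exists_isCompact_isConnected_superset (hE : 2 < Module.finrank ℝ E)
    {W K : Set E} (hW : IsConnected W) (hWo : IsOpen W) (hK : IsCompact K) (hKW : K ⊆ W) :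
    ∃ L ⊆ W, IsCompact L ∧ IsConnected L ∧ K ⊆ L := by
  obtain ⟨δ, hδ, hδW⟩ := hK.exists_cthickening_subset_open hWo hKW
  obtain ⟨t, htK, htf, hKt⟩ := hK.finite_cover_balls hδ
  obtain ⟨S, hSW, -, hSc, hS, htS⟩ :=
    hW.exists_isNonseparating_superset hE hWo htf (htK.trans hKW)
  refine ⟨S ∪ ⋃ x ∈ t, closedBall x δ, union_subset hSW ?_,
    hSc.union (htf.isCompact_biUnion fun x _ ↦ isCompact_closedBall x δ),
    hS.union_biUnion (fun x _ ↦ (convex_closedBall x δ).isPreconnected)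
      (fun x hx ↦ ⟨x, htS hx, mem_closedBall_self hδ.le⟩), ?_⟩
  · exact iUnion₂_subset fun x hx ↦ (closedBall_subset_cthickening (htK hx) δ).trans hδW
  · exact (hKt.trans (iUnion₂_mono fun x _ ↦ ball_subset_closedBall)).trans subset_union_right

theorem IsConnected.exists_isOpen_isConnected_superset (hE : 2 < Module.finrank ℝ E)
    {W K : Set E} (hW : IsConnected W) (hWo : IsOpen W) (hK : IsCompact K) (hKW : K ⊆ W) :
    ∃ G, IsOpen G ∧ IsConnected G ∧ K ⊆ G ∧ IsCompact (closure G) ∧ closure G ⊆ W := by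
  obtain ⟨L, hLW, hLc, hL, hKL⟩ := hW.exists_isCompact_isConnected_superset hE hWo hK hKW
  obtain ⟨δ, hδ, hδW⟩ := hLc.exists_cthickening_subset_open hWo hLW
  have hcl : closure (thickening δ L) ⊆ cthickening δ L := closure_thickening_subset_cthickening δ L
  have heq : thickening δ L = L ∪ ⋃ x ∈ L, ball x δ := by
    rw [← thickening_eq_biUnion_ball, union_eq_self_of_subset_left (self_subset_thickening hδ L)]
  refine ⟨thickening δ L, isOpen_thickening, ?_, hKL.trans (self_subset_thickening hδ L),
    hLc.cthickening.of_isClosed_subset isClosed_closure hcl, hcl.trans hδW⟩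
  rw [heq]
  exact hL.union_biUnion (fun x _ ↦ (convex_ball x δ).isPreconnected)
    (fun x hx ↦ ⟨x, hx, mem_ball_self hδ⟩)

/-- A compact set `K` can be attached to a connected set `S` meeting all balls of a finite cover
of `K`, inside a neighbourhood of `K` and avoiding a nonseparating set `P`. -/
theorem IsNonseparating.exists_isConnected_attach (hE : 2 < Module.finrank ℝ E)
    {P K S t : Set E} (hP : IsNonseparating P) (hK : IsCompact K) (hPK : Disjoint P K)
    (hSc : IsCompact S) (hS : IsConnected S) {δ : ℝ} (hδ : 0 < δ) (htf : t.Finite) (htK : t ⊆ K)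
    (htS : t ⊆ S) (hKt : K ⊆ ⋃ x ∈ t, ball x (δ / 2)) :
    ∃ X, IsCompact X ∧ IsConnected X ∧ K ⊆ X ∧ X ⊆ S ∪ (thickening δ K \ P) := by
  have hx : ∀ x : E, ∃ L : Set E, x ∈ t → L ⊆ ball x δ \ P ∧ IsCompact L ∧ IsConnected L ∧
      K ∩ closedBall x (δ / 2) ⊆ L := by
    intro x
    by_cases hxt : x ∈ t
    · have hxP : x ∉ P := fun h ↦ hPK.le_bot ⟨h, htK hxt⟩
      have hc : IsConnected (ball x δ \ P) :=
        ⟨⟨x, mem_ball_self hδ, hxP⟩, hP.2 _ isOpen_ball (convex_ball x δ).isPreconnected⟩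
      obtain ⟨L, h⟩ := hc.exists_isCompact_isConnected_superset hE (isOpen_ball.sdiff hP.1)
        (hK.inter_right isClosed_closedBall) (K := K ∩ closedBall x (δ / 2)) (subset_sdiff.2
          ⟨inter_subset_right.trans (closedBall_subset_ball (by linarith)),
            hPK.symm.mono_left inter_subset_left⟩)
      exact ⟨L, fun _ ↦ h⟩
    · exact ⟨∅, fun h ↦ absurd h hxt⟩
  choose L hL using hx
  refine ⟨S ∪ ⋃ x ∈ t, L x, hSc.union (htf.isCompact_biUnion fun x hx ↦ (hL x hx).2.1),
    hS.union_biUnion (fun x hx ↦ (hL x hx).2.2.1.isPreconnected) (fun x hx ↦ ⟨x, htS hx,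
      (hL x hx).2.2.2 ⟨htK hx, mem_closedBall_self (by linarith)⟩⟩), fun y hy ↦ ?_, ?_⟩
  · obtain ⟨x, hx, hyx⟩ := mem_iUnion₂.1 (hKt hy)
    exact Or.inr (mem_iUnion₂.2 ⟨x, hx, (hL x hx).2.2.2 ⟨hy, ball_subset_closedBall hyx⟩⟩)
  · refine union_subset_union_right _ (iUnion₂_subset fun x hx ↦ (hL x hx).1.trans ?_)
    exact sdiff_subset_sdiff_left (ball_subset_thickening (htK hx) δ)

/-- In dimension at least three, two disjoint compact sets `K` and `F`, contained respectively in
connected open sets `G` and `W` with `G` disjoint from `F` and `W` disjoint from `K`, lie in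
disjoint compact connected sets. -/
theorem exists_disjoint_isConnected_supersets (hE : 2 < Module.finrank ℝ E) {K F G W : Set E}
    (hK : IsCompact K) (hF : IsCompact F)
    (hFne : F.Nonempty) (hGo : IsOpen G) (hG : IsConnected G) (hKG : K ⊆ G)
    (hGF : Disjoint G F) (hWo : IsOpen W) (hW : IsConnected W) (hFW : F ⊆ W)
    (hWK : Disjoint W K) :
    ∃ X M, IsCompact X ∧ IsConnected X ∧ K ⊆ X ∧ X ⊆ G ∧ IsCompact M ∧ IsConnected M ∧ F ⊆ M ∧
      Disjoint X M := by
  obtain ⟨δ₁, hδ₁, hd⟩ := (hGF.mono_left hKG).exists_thickenings hK hF.isClosed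
  obtain ⟨δ₂, hδ₂, hδG⟩ := hK.exists_thickening_subset_open hGo hKG
  set δ := min δ₁ δ₂
  have hδ : 0 < δ := lt_min hδ₁ hδ₂
  replace hd : Disjoint (thickening δ K) (thickening δ F) :=
    hd.mono (thickening_mono (min_le_left _ _) _) (thickening_mono (min_le_left _ _) _)
  replace hδG : thickening δ K ⊆ G := (thickening_mono (min_le_right _ _) _).trans hδG
  obtain ⟨s, hsK, hsf, hKs⟩ := hK.finite_cover_balls (half_pos hδ)
  obtain ⟨t, htF, htf, hFt⟩ := hF.finite_cover_balls (half_pos hδ)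
  obtain ⟨Q, hQG, hQn, hQc, hQ, hsQ⟩ :=
    hG.exists_isNonseparating_superset hE hGo hsf (hsK.trans hKG)
  have hQF : Disjoint Q F := hGF.mono_left hQG
  have hWQ : IsConnected (W \ Q) := by
    refine ⟨?_, hQn.2 W hWo hW.isPreconnected⟩
    obtain ⟨x, hx⟩ := hFne
    exact ⟨x, hFW hx, fun h ↦ hQF.le_bot ⟨h, hx⟩⟩
  obtain ⟨P, hPW, hPn, hPc, hP, htP⟩ := hWQ.exists_isNonseparating_superset hE
    (hWo.sdiff hQn.1) htf (subset_sdiff.2 ⟨htF.trans hFW, hQF.symm.mono_left htF⟩)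
  obtain ⟨hPW, hPQ⟩ := subset_sdiff.1 hPW
  obtain ⟨X, hXc, hX, hKX, hXs⟩ := hPn.exists_isConnected_attach hE hK (hWK.mono_left hPW) hQc hQ
    hδ hsf hsK hsQ hKs
  obtain ⟨M, hMc, hM, hFM, hMs⟩ := hQn.exists_isConnected_attach hE hF hQF hPc hP
    hδ htf htF htP hFt
  refine ⟨X, M, hXc, hX, hKX, hXs.trans (union_subset hQG (sdiff_subset.trans hδG)), hMc, hM, hFM,
    Disjoint.mono hXs hMs ?_⟩
  refine disjoint_union_left.2 ⟨disjoint_union_right.2 ⟨hPQ.symm, disjoint_sdiff_right⟩,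
    disjoint_union_right.2 ⟨disjoint_sdiff_left, hd.mono sdiff_subset sdiff_subset⟩⟩

/-- Adding to a nonempty connected set containing the frontier of an open set `G` the complement
of `G` yields a connected set. -/
theorem IsPreconnected.union_compl_of_frontier_subset {X : Type*} [TopologicalSpace X]
    [PreconnectedSpace X] {M G : Set X} (hM : IsPreconnected M) (hG : IsOpen G)
    (hGne : G.Nonempty) (hMG : frontier G ⊆ M) : IsPreconnected (M ∪ Gᶜ) := by
  have key : ∀ u v : Set X, IsOpen u → IsOpen v → M ∪ Gᶜ ⊆ u ∪ v → (M ∪ Gᶜ) ∩ (u ∩ v) = ∅ →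
      M ⊆ u → M ∪ Gᶜ ⊆ u := by
    intro u v hu hv hc hd hMu
    have hd' : ∀ x ∈ Gᶜ, x ∈ u → x ∉ v := fun x hx hxu hxv ↦
      (hd ▸ ⟨Or.inr hx, hxu, hxv⟩ : x ∈ (∅ : Set X))
    have h1 : Gᶜ ∩ uᶜ = (closure G)ᶜ ∩ v := by
      ext x
      constructor
      · rintro ⟨hxG, hxu⟩
        refine ⟨fun hx ↦ hxu (hMu (hMG ?_)), (hc (Or.inr hxG)).resolve_left hxu⟩
        rw [hG.frontier_eq]
        exact ⟨hx, hxG⟩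
      · rintro ⟨hxG, hxv⟩
        have hx : x ∈ Gᶜ := fun h ↦ hxG (subset_closure h)
        exact ⟨hx, fun hxu ↦ hd' x hx hxu hxv⟩
    have hclopen : IsClopen (Gᶜ ∩ uᶜ) :=
      ⟨hG.isClosed_compl.inter hu.isClosed_compl, h1 ▸ isClosed_closure.isOpen_compl.inter hv⟩
    rcases isClopen_iff.1 hclopen with h | h
    · refine union_subset hMu fun x hx ↦ ?_
      by_contra hxu
      exact (h ▸ ⟨hx, hxu⟩ : x ∈ (∅ : Set X))
    · obtain ⟨x, hx⟩ := hGne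
      exact absurd hx (h ▸ mem_univ x : x ∈ Gᶜ ∩ uᶜ).1
  rw [isPreconnected_iff_subset_of_disjoint]
  intro u v hu hv hc hd
  rcases isPreconnected_iff_subset_of_disjoint.1 hM u v hu hv (subset_union_left.trans hc)
    (subset_empty_iff.1 (hd ▸ inter_subset_inter_left _ subset_union_left)) with h | h
  · exact Or.inl (key u v hu hv hc hd h)
  · exact Or.inr (key v u hv hu (union_comm u v ▸ hc) (inter_comm u v ▸ hd) h)

open scoped ContDiff

/-- For a smooth function `f`, a suitable arbitrarily small linear perturbation has only countably
many critical points. -/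
theorem ContDiff.exists_countable_fderiv_eq {f : E → ℝ} (hf : ContDiff ℝ ∞ f) {ε : ℝ}
    (hε : 0 < ε) : ∃ a : E →L[ℝ] ℝ, ‖a‖ < ε ∧ {x | fderiv ℝ f x = a}.Countable := by
  borelize E
  have hfin : Module.finrank ℝ (E →L[ℝ] ℝ) = Module.finrank ℝ E := by
    rw [← (LinearMap.toContinuousLinearMap : (E →ₗ[ℝ] ℝ) ≃ₗ[ℝ] E →L[ℝ] ℝ).finrank_eq]
    exact Subspace.dual_finrank_eq
  obtain ⟨Φ⟩ := FiniteDimensional.nonempty_continuousLinearEquiv_of_finrank_eq hfin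
  have hF : Differentiable ℝ (fun x ↦ Φ (fderiv ℝ f x)) :=
    Φ.differentiable.comp ((hf.fderiv_right (m := ∞) (by simp)).differentiable (by simp))
  set F : E → E := fun x ↦ Φ (fderiv ℝ f x) with hFdef
  have hnull : MeasureTheory.Measure.addHaar (F '' {x | (fderiv ℝ F x).det = 0}) = 0 :=
    MeasureTheory.addHaar_image_eq_zero_of_det_fderivWithin_eq_zero _
      (fun x _ ↦ (hF x).hasFDerivAt.hasFDerivWithinAt) (fun x hx ↦ hx)
  have hdense : Dense (F '' {x | (fderiv ℝ F x).det = 0})ᶜ :=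
    MeasureTheory.Measure.dense_of_ae (MeasureTheory.measure_eq_zero_iff_ae_notMem.1 hnull)
  obtain ⟨y, hy, hyF⟩ := hdense.inter_open_nonempty (Φ.symm ⁻¹' ball 0 ε)
    (isOpen_ball.preimage Φ.symm.continuous) ⟨0, by simpa using hε⟩
  refine ⟨Φ.symm y, by simpa using hy, ?_⟩
  have hset : {x | fderiv ℝ f x = Φ.symm y} = {x | F x = y} := by
    ext x
    exact ⟨fun h ↦ by simp [hFdef, show fderiv ℝ f x = _ from h],
      fun h ↦ by simp [← show F x = y from h, hFdef]⟩
  rw [hset]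
  have hdisc : IsDiscrete {x | F x = y} := by
    rw [isDiscrete_iff_nhdsNE]
    intro x hx
    have hdet : (fderiv ℝ F x).det ≠ 0 := fun h ↦ hyF ⟨x, h, hx⟩
    have hanti : ∃ C, AntilipschitzWith C (fderiv ℝ F x) :=
      ⟨_, ((fderiv ℝ F x).toContinuousLinearEquivOfDetNeZero hdet).antilipschitz⟩
    have := (hF x).hasFDerivAt.eventually_ne (c := y) hanti
    rw [← disjoint_iff, Filter.disjoint_principal_right]
    exact this
  have := hdisc.to_subtype
  exact countable_coe_iff.1 (TopologicalSpace.separableSpace_iff_countable.1 inferInstance)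

/-- Two disjoint closed sets, one of which has bounded complement, can be separated by a smooth
function having zero as a regular value. -/
theorem exists_contDiff_regular_separating {X N : Set E} (hX : IsClosed X) (hN : IsClosed N)
    (hXN : Disjoint X N) (hb : Bornology.IsBounded Nᶜ) :
    ∃ g : E → ℝ, ContDiff ℝ ∞ g ∧ (∀ x ∈ X, g x < 0) ∧ (∀ x, g x = 0 → fderiv ℝ g x ≠ 0) ∧
      closure (Nᶜ ∩ {x | g x < 0}) ⊆ Nᶜ := by
  obtain ⟨f, hf, -, hfX, hfN⟩ :=
    exists_contMDiff_zero_iff_one_iff_of_isClosed (n := ⊤) (modelWithCornersSelf ℝ E) hX hN hXN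
  rw [contMDiff_iff_contDiff] at hf
  obtain ⟨R, hR0, hR⟩ := hb.subset_closedBall_lt 0 0
  obtain ⟨a, ha, hac⟩ := hf.exists_countable_fderiv_eq (ε := 1 / (4 * R)) (by positivity)
  have hbd : ∀ x ∈ closedBall (0 : E) R, |a x| < 1 / 4 := by
    intro x hx
    have hx' : ‖x‖ ≤ R := by simpa using hx
    calc |a x| ≤ ‖a‖ * ‖x‖ := a.le_opNorm x
      _ ≤ ‖a‖ * R := by gcongr
      _ < 1 / (4 * R) * R := by gcongr
      _ = 1 / 4 := by field_simp
  obtain ⟨c, hc, hcv⟩ := ((hac.image (fun x ↦ f x - a x)).dense_compl ℝ).inter_open_nonempty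
    (Ioo (1 / 4) (3 / 4)) isOpen_Ioo ⟨1 / 2, by norm_num, by norm_num⟩
  have hsm : ContDiff ℝ ∞ (fun x ↦ f x - a x - c) := (hf.sub a.contDiff).sub contDiff_const
  refine ⟨fun x ↦ f x - a x - c, hsm, fun x hx ↦ ?_, fun x hx hd ↦ hcv ⟨x, ?_, ?_⟩,
    fun x hx hxN ↦ ?_⟩
  · have h1 := (abs_lt.1 (hbd x (hR (fun h ↦ hXN.le_bot ⟨hx, h⟩)))).1
    have h2 := (hfX x).1 hx
    have h3 := hc.1
    dsimp only
    linarith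
  · have hfd : DifferentiableAt ℝ f x := hf.differentiable (by simp) x
    have h1 : HasFDerivAt (fun x ↦ f x - a x - c) (fderiv ℝ f x - a) x :=
      (hfd.hasFDerivAt.sub a.hasFDerivAt).sub_const c
    rw [h1.fderiv, sub_eq_zero] at hd
    exact hd
  · dsimp only at hx ⊢
    linarith
  · have h0 : f x - a x - c ≤ 0 :=
      closure_minimal (t := {x | f x - a x - c ≤ 0})
        (fun y hy ↦ le_of_lt (show f y - a y - c < 0 from hy.2))
        (isClosed_le hsm.continuous continuous_const) hx
    have h1 := (abs_lt.1 (hbd x (closure_minimal (inter_subset_left.trans hR)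
      isClosed_closedBall hx))).2
    have h2 := (hfN x).1 hxN
    have h3 := hc.2
    linarith

/-- Near a regular point, the strict sublevel and superlevel sets of a function are connected in
suitable arbitrarily small neighbourhoods. -/
theorem HasStrictFDerivAt.exists_isPreconnected_levels {g : E → ℝ} {g' : E →L[ℝ] ℝ} {p : E}
    (hg : HasStrictFDerivAt g g' p) (hg' : g' ≠ 0) {U : Set E} (hU : U ∈ 𝓝 p) (c : ℝ) :
    ∃ V ⊆ U, IsOpen V ∧ p ∈ V ∧ IsPreconnected (V ∩ {x | g x < c}) ∧
      IsPreconnected (V ∩ {x | c < g x}) := by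
  have hrange : g'.range = ⊤ := by
    refine LinearMap.range_eq_top.2 (LinearMap.surjective ?_)
    exact fun h ↦ hg' (ContinuousLinearMap.coe_injective h)
  set φ := hg.implicitToOpenPartialHomeomorph g g' hrange
  have hp : p ∈ φ.source := hg.mem_implicitToOpenPartialHomeomorph_source hrange
  have hfst : ∀ x, (φ x).1 = g x := hg.implicitToOpenPartialHomeomorph_fst hrange
  have hn : φ.target ∩ φ.symm ⁻¹' U ∈ 𝓝 (φ p) := by
    refine Filter.inter_mem (φ.open_target.mem_nhds (φ.map_source hp)) ?_
    refine (φ.symm.continuousAt (φ.map_source hp)).preimage_mem_nhds ?_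
    rwa [φ.left_inv hp]
  obtain ⟨r, hr, hrU⟩ := Metric.mem_nhds_iff.1 hn
  obtain ⟨hrt, hrU⟩ := subset_inter_iff.1 hrU
  have hcont : ContinuousOn φ.symm (ball (φ p) r) := φ.continuousOn_symm.mono hrt
  have himage : ∀ I : Set ℝ, φ.symm '' ball (φ p) r ∩ g ⁻¹' I =
      φ.symm '' (ball (φ p) r ∩ Prod.fst ⁻¹' I) := by
    intro I
    ext x
    constructor
    · rintro ⟨⟨q, hq, rfl⟩, hx⟩
      refine ⟨q, ⟨hq, ?_⟩, rfl⟩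
      rwa [mem_preimage, ← hfst, φ.right_inv (hrt hq)] at hx
    · rintro ⟨q, ⟨hq, hqI⟩, rfl⟩
      refine ⟨⟨q, hq, rfl⟩, ?_⟩
      rwa [mem_preimage, ← hfst, φ.right_inv (hrt hq)]
  have hpre : ∀ I : Set ℝ, Convex ℝ I → IsPreconnected (φ.symm '' ball (φ p) r ∩ g ⁻¹' I) := by
    intro I hI
    rw [himage]
    have hconv : Convex ℝ (ball (φ p) r ∩ Prod.fst ⁻¹' I) :=
      (convex_ball _ _).inter (hI.linear_preimage (LinearMap.fst ℝ ℝ _))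
    exact hconv.isPreconnected.image _ (hcont.mono inter_subset_left)
  exact ⟨φ.symm '' ball (φ p) r, image_subset_iff.2 hrU,
    φ.isOpen_image_symm_of_subset_target isOpen_ball hrt,
    ⟨φ p, mem_ball_self hr, φ.left_inv hp⟩, hpre (Iio c) (convex_Iio c), hpre (Ioi c) (convex_Ioi c)⟩

end NormedSpace

section RegularDomain

variable {E : Type*} [NormedAddCommGroup E] [NormedSpace ℝ E]

/-- `U` is an open set whose boundary is locally a regular level set of `g`, with `U` lying
locally on the side where `g` is negative. -/
def IsRegularDomain (g : E → ℝ) (U : Set E) : Prop :=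
  IsOpen U ∧ ∀ p ∈ frontier U, ∃ V, IsOpen V ∧ p ∈ V ∧ (∀ q ∈ V, fderiv ℝ g q ≠ 0) ∧
    IsPreconnected (V ∩ {x | g x < 0}) ∧ IsPreconnected (V ∩ {x | 0 < g x}) ∧
    V ∩ U = V ∩ {x | g x < 0}

theorem inter_closure_eq_of_inter_eq {g : E → ℝ} (hg : Continuous g) {U V : Set E}
    (hV : IsOpen V) (hd : ∀ q ∈ V, fderiv ℝ g q ≠ 0) (h : V ∩ U = V ∩ {x | g x < 0}) :
    V ∩ closure U = V ∩ {x | g x ≤ 0} := by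
  ext x
  refine and_congr_right fun hxV ↦ ⟨fun hx ↦ ?_, fun hx ↦ ?_⟩
  · have h1 : x ∈ closure (V ∩ U) := hV.inter_closure ⟨hxV, hx⟩
    rw [h] at h1
    exact closure_minimal (fun y hy ↦ le_of_lt hy.2) (isClosed_le hg continuous_const) h1
  · by_contra hxU
    have hmin : IsLocalMin g x := by
      filter_upwards [hV.mem_nhds hxV, isClosed_closure.isOpen_compl.mem_nhds hxU] with y hyV hyU
      refine le_trans hx (not_lt.1 fun hlt ↦ hyU (subset_closure ?_))
      exact (h.symm ▸ ⟨hyV, hlt⟩ : y ∈ V ∩ U).2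
    exact hd x hxV hmin.fderiv_eq_zero

theorem IsRegularDomain.compl_closure {g : E → ℝ} (hg : Continuous g) {U : Set E}
    (hU : IsRegularDomain g U) : IsRegularDomain (-g) (closure U)ᶜ := by
  refine ⟨isClosed_closure.isOpen_compl, fun p hp ↦ ?_⟩
  rw [frontier_compl] at hp
  obtain ⟨V, hV, hpV, hd, h1, h2, h3⟩ := hU.2 p (frontier_closure_subset hp)
  refine ⟨V, hV, hpV, fun q hq ↦ ?_, by simpa using h2, by simpa using h1, ?_⟩
  · rw [fderiv_neg]
    exact neg_ne_zero.2 (hd q hq)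
  · have := inter_closure_eq_of_inter_eq hg hV hd h3
    ext x
    have hx := Set.ext_iff.1 this x
    simp only [mem_inter_iff, mem_ofPred_eq, and_congr_right_iff, mem_compl_iff, Pi.neg_apply,
      neg_lt_zero] at hx ⊢
    exact fun hxV ↦ by rw [hx hxV, not_le]

theorem frontier_connectedComponentIn_subset {X : Type*} [TopologicalSpace X]
    [LocallyConnectedSpace X] {U : Set X} (hU : IsOpen U) (x : X) :
    frontier (connectedComponentIn U x) ⊆ frontier U := by
  intro p hp
  rw [hU.connectedComponentIn.frontier_eq] at hp
  rw [hU.frontier_eq]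
  refine ⟨closure_mono (connectedComponentIn_subset U x) hp.1, fun hpU ↦ hp.2 ?_⟩
  obtain ⟨y, hyp, hyx⟩ := mem_closure_iff.1 hp.1 _ (hU.connectedComponentIn (x := p))
    (mem_connectedComponentIn hpU)
  rw [connectedComponentIn_eq hyx, ← connectedComponentIn_eq hyp]
  exact mem_connectedComponentIn hpU

theorem IsRegularDomain.connectedComponentIn {g : E → ℝ} {U : Set E}
    (hU : IsRegularDomain g U) (x : E) : IsRegularDomain g (connectedComponentIn U x) := by
  refine ⟨hU.1.connectedComponentIn, fun p hp ↦ ?_⟩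
  obtain ⟨V, hV, hpV, hd, h1, h2, h3⟩ :=
    hU.2 p (frontier_connectedComponentIn_subset hU.1 x hp)
  refine ⟨V, hV, hpV, hd, h1, h2, ?_⟩
  rw [← h3]
  refine (inter_subset_inter_right _ (connectedComponentIn_subset U x)).antisymm
    (subset_inter inter_subset_left ?_)
  obtain ⟨y, hyV, hy⟩ := mem_closure_iff.1 (frontier_subset_closure hp) V hV hpV
  rw [connectedComponentIn_eq hy]
  exact IsPreconnected.subset_connectedComponentIn (h3 ▸ h1)
    ⟨hyV, connectedComponentIn_subset U x hy⟩ inter_subset_right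

/-- A regular domain whose frontier lies in the frontier of a smaller connected regular domain is
connected. -/
theorem IsRegularDomain.isPreconnected_of_frontier_subset {g : E → ℝ} {D₀ D : Set E}
    (hD₀ : IsRegularDomain g D₀) (hD : IsRegularDomain g D) (hsub : D₀ ⊆ D)
    (hfr : frontier D ⊆ frontier D₀) (hconn : IsConnected D₀) : IsPreconnected D := by
  have key : ∀ u v : Set E, IsOpen u → IsOpen v → D ⊆ u ∪ v → D ∩ (u ∩ v) = ∅ →
      D₀ ⊆ u → D ⊆ u := by
    intro u v hu hv hc hd hDu
    have hd' : ∀ x ∈ D, x ∈ u → x ∉ v := fun x hx hxu hxv ↦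
      (hd ▸ ⟨hx, hxu, hxv⟩ : x ∈ (∅ : Set E))
    have hclosed : IsClosed (D ∩ v) := by
      refine isClosed_of_closure_subset fun q hq ↦ ?_
      by_cases hqD : q ∈ D
      · refine ⟨hqD, (hc hqD).resolve_left fun hqu ↦ ?_⟩
        obtain ⟨y, hyu, hyD, hyv⟩ := mem_closure_iff.1 hq u hu hqu
        exact hd' y hyD hyu hyv
      · have hqf : q ∈ frontier D := by
          rw [hD.1.frontier_eq]
          exact ⟨closure_mono inter_subset_left hq, hqD⟩
        obtain ⟨V, hV, hqV, -, -, -, h⟩ := hD.2 q hqf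
        obtain ⟨V', hV', hqV', -, -, -, h'⟩ := hD₀.2 q (hfr hqf)
        obtain ⟨y, ⟨hyV, hyV'⟩, hyD, hyv⟩ := mem_closure_iff.1 hq _ (hV.inter hV') ⟨hqV, hqV'⟩
        have h1 : g y < 0 := (h ▸ ⟨hyV, hyD⟩ : y ∈ V ∩ {x | g x < 0}).2
        have h2 : y ∈ D₀ := (h'.symm ▸ ⟨hyV', h1⟩ : y ∈ V' ∩ D₀).2
        exact absurd hyv (hd' y hyD (hDu h2))
    rcases isClopen_iff.1 ⟨hclosed, hD.1.inter hv⟩ with h | h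
    · exact fun x hx ↦ (hc hx).resolve_right fun hxv ↦
        (h ▸ ⟨hx, hxv⟩ : x ∈ (∅ : Set E))
    · obtain ⟨x, hx⟩ := hconn.nonempty
      exact absurd (h ▸ mem_univ x : x ∈ D ∩ v).2 (hd' x (hsub hx) (hDu hx))
  rw [isPreconnected_iff_subset_of_disjoint]
  intro u v hu hv hc hd
  rcases isPreconnected_iff_subset_of_disjoint.1 hconn.isPreconnected u v hu hv (hsub.trans hc)
    (subset_empty_iff.1 (hd ▸ inter_subset_inter_left _ hsub)) with h | h
  · exact Or.inl (key u v hu hv hc hd h)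
  · exact Or.inr (key v u hv hu (union_comm u v ▸ hc) (inter_comm u v ▸ hd) h)

open scoped ContDiff in
/-- A connected closed set and a disjoint connected closed set with bounded complement are
separated by a smooth connected hypersurface bounding a connected domain. -/
theorem exists_isRegularDomain_separating [FiniteDimensional ℝ E] {X N : Set E}
    (hXc : IsClosed X) (hX : IsConnected X)
    (hNc : IsClosed N) (hN : IsConnected N) (hXN : Disjoint X N)
    (hb : Bornology.IsBounded Nᶜ) :
    ∃ (g : E → ℝ) (D : Set E), ContDiff ℝ ∞ g ∧ IsRegularDomain g D ∧ IsConnected D ∧ X ⊆ D ∧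
      closure D ⊆ Nᶜ ∧ IsConnected (frontier D) := by
  obtain ⟨g, hg, hgX, hreg, hcl⟩ := exists_contDiff_regular_separating hXc hNc hXN hb
  set U := Nᶜ ∩ {x | g x < 0}
  have hUo : IsOpen U := hNc.isOpen_compl.inter (isOpen_lt hg.continuous continuous_const)
  have hU : IsRegularDomain g U := by
    refine ⟨hUo, fun p hp ↦ ?_⟩
    rw [hUo.frontier_eq] at hp
    have hpN : p ∈ Nᶜ := hcl hp.1
    have hp0 : g p = 0 := le_antisymm
      (closure_minimal (fun y hy ↦ le_of_lt hy.2) (isClosed_le hg.continuous continuous_const) hp.1)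
      (not_lt.1 fun h ↦ hp.2 ⟨hpN, h⟩)
    have hdiff : HasStrictFDerivAt g (fderiv ℝ g p) p :=
      hg.contDiffAt.hasStrictFDerivAt (by simp)
    have hev : {q | fderiv ℝ g q ≠ 0} ∩ Nᶜ ∈ 𝓝 p :=
      Filter.inter_mem ((hg.continuous_fderiv (by simp)).continuousAt.eventually_ne (hreg p hp0))
        (hNc.isOpen_compl.mem_nhds hpN)
    obtain ⟨V, hVU, hV, hpV, h1, h2⟩ := hdiff.exists_isPreconnected_levels (hreg p hp0) hev 0
    refine ⟨V, hV, hpV, fun q hq ↦ (hVU hq).1, h1, h2, ?_⟩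
    rw [← inter_assoc, inter_eq_left.2 fun q hq ↦ (hVU hq).2]
  obtain ⟨x, hx⟩ := hX.nonempty
  obtain ⟨y, hy⟩ := hN.nonempty
  have hXU : X ⊆ U := fun z hz ↦ ⟨fun h ↦ hXN.le_bot ⟨hz, h⟩, hgX z hz⟩
  set D₀ := connectedComponentIn U x
  have hD₀ : IsRegularDomain g D₀ := hU.connectedComponentIn x
  have hXD₀ : X ⊆ D₀ := hX.isPreconnected.subset_connectedComponentIn hx hXU
  have hO : IsRegularDomain (-g) (closure D₀)ᶜ := hD₀.compl_closure hg.continuous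
  have hNO : N ⊆ (closure D₀)ᶜ := fun z hz h ↦
    hcl (closure_mono (connectedComponentIn_subset U x) h) hz
  set C := connectedComponentIn (closure D₀)ᶜ y
  have hC : IsRegularDomain (-g) C := hO.connectedComponentIn y
  have hNC : N ⊆ C := hN.isPreconnected.subset_connectedComponentIn hy hNO
  have hD : IsRegularDomain g (closure C)ᶜ := by
    simpa using hC.compl_closure hg.continuous.neg
  have hCD₀ : C ⊆ (closure D₀)ᶜ := connectedComponentIn_subset _ _
  have hsub : D₀ ⊆ (closure C)ᶜ := by
    refine subset_compl_comm.1 (closure_minimal ?_ hD₀.1.isClosed_compl)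
    exact hCD₀.trans (compl_subset_compl.2 subset_closure)
  have hfr : frontier (closure C)ᶜ ⊆ frontier D₀ := by
    rw [frontier_compl]
    refine frontier_closure_subset.trans
      ((frontier_connectedComponentIn_subset hO.1 y).trans ?_)
    rw [frontier_compl]
    exact frontier_closure_subset
  have hD₀conn : IsConnected D₀ := ⟨⟨x, hXD₀ hx⟩, isPreconnected_connectedComponentIn⟩
  have hDpre : IsPreconnected (closure C)ᶜ :=
    hD₀.isPreconnected_of_frontier_subset hD hsub hfr hD₀conn
  have hDne : (closure C)ᶜ.Nonempty := ⟨x, hsub (hXD₀ hx)⟩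
  refine ⟨g, (closure C)ᶜ, hg, hD, ⟨hDne, hDpre⟩, hXD₀.trans hsub, ?_, ?_, ?_⟩
  · refine (closure_minimal (compl_subset_compl.2 subset_closure) hC.1.isClosed_compl).trans ?_
    exact compl_subset_compl.2 hNC
  · exact nonempty_frontier_iff.2
      ⟨hDne, fun h ↦ (h ▸ mem_univ y : y ∈ (closure C)ᶜ) (subset_closure (hNC hy))⟩
  · have hint := isPreconnected_inter_of_union_eq_univ (isClosed_closure (s := (closure C)ᶜ))
      (isClosed_closure (s := C)) hDpre.closure isPreconnected_connectedComponentIn.closure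
      (eq_univ_of_univ_subset fun z _ ↦ by
        by_cases hz : z ∈ closure C
        · exact Or.inr hz
        · exact Or.inl (subset_closure hz))
    rwa [hD.1.frontier_eq, sdiff_eq, compl_compl]

end RegularDomain

/-- **Lemma 3.2 of the paper, Euclidean case.** A compact set `K` with connected
complement in an open connected `Ω ⊆ ℂⁿ ≅ ℝ^{2n}` can be surrounded by a
connected domain `D ⋐ Ω` whose boundary `M = frontier D` is a connected `C^∞`
hypersurface, locally given by a defining function `g` with nonvanishing
differential, with `D ∩ V = {g < 0}` and `M ∩ V = {g = 0}`. -/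
theorem smooth_connected_boundary_around_compact (n : ℕ) (hn : 2 ≤ n)
    (Ω : Set (EuclideanSpace ℂ (Fin n))) (hΩopen : IsOpen Ω) (hΩconn : IsConnected Ω)
    (K : Set (EuclideanSpace ℂ (Fin n))) (hKcpt : IsCompact K) (hKne : K.Nonempty)
    (hKΩ : K ⊆ Ω) (hΩK : IsConnected (Ω \ K)) :
    ∃ D : Set (EuclideanSpace ℂ (Fin n)),
      IsOpen D ∧ IsConnected D ∧ K ⊆ D ∧
      IsCompact (closure D) ∧ closure D ⊆ Ω ∧
      IsConnected (frontier D) ∧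
      ∀ p ∈ frontier D,
        ∃ V : Set (EuclideanSpace ℂ (Fin n)), IsOpen V ∧ p ∈ V ∧
          ∃ g : EuclideanSpace ℂ (Fin n) → ℝ,
            ContDiffOn ℝ (⊤ : ℕ∞) g V ∧
            (∀ q ∈ V, fderiv ℝ g q ≠ 0) ∧
            D ∩ V = {z ∈ V | g z < 0} ∧
            frontier D ∩ V = {z ∈ V | g z = 0} := by
  have hE : 2 < Module.finrank ℝ (EuclideanSpace ℂ (Fin n)) := by
    rw [finrank_real_of_complex, finrank_euclideanSpace_fin]
    omega
  obtain ⟨G, hGo, hG, hKG, hGc, hGΩ⟩ :=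
    hΩconn.exists_isOpen_isConnected_superset hE hΩopen hKcpt hKΩ
  have hfrG : IsCompact (frontier G) := hGc.of_isClosed_subset isClosed_frontier
    frontier_subset_closure
  have hfrne : (frontier G).Nonempty := by
    have : Nontrivial (EuclideanSpace ℂ (Fin n)) :=
      Module.nontrivial_of_finrank_pos (R := ℝ) (by omega)
    refine nonempty_frontier_iff.2 ⟨hG.nonempty, fun h ↦ ?_⟩
    rw [h, closure_univ] at hGc
    exact NormedSpace.noncompactSpace ℝ (EuclideanSpace ℂ (Fin n)) |>.noncompact_univ hGc
  have hGfr : Disjoint G (frontier G) := by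
    rw [hGo.frontier_eq]
    exact disjoint_sdiff_right
  obtain ⟨X, M, hXc, hX, hKX, hXG, hMc, hM, hfM, hXM⟩ :=
    exists_disjoint_isConnected_supersets hE hKcpt hfrG hfrne hGo hG hKG hGfr
      (hΩopen.sdiff hKcpt.isClosed) hΩK
      (subset_sdiff.2 ⟨frontier_subset_closure.trans hGΩ, (hGfr.mono_left hKG).symm⟩)
      disjoint_sdiff_left
  have hN : IsConnected (M ∪ Gᶜ) := ⟨hM.nonempty.mono subset_union_left,
    hM.isPreconnected.union_compl_of_frontier_subset hGo hG.nonempty hfM⟩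
  have hNG : (M ∪ Gᶜ)ᶜ ⊆ G := by
    rw [compl_union, compl_compl]
    exact inter_subset_right
  obtain ⟨g, D, hg, hD, hDc, hXD, hDN, hfr⟩ := exists_isRegularDomain_separating hXc.isClosed hX
    (hMc.isClosed.union hGo.isClosed_compl) hN
    (disjoint_union_right.2 ⟨hXM, disjoint_compl_right_iff_subset.2 hXG⟩)
    (hGc.isBounded.subset (hNG.trans subset_closure))
  have hDG : closure D ⊆ closure G := (hDN.trans hNG).trans subset_closure
  refine ⟨D, hD.1, hDc, hKX.trans hXD, hGc.of_isClosed_subset isClosed_closure hDG,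
    hDG.trans hGΩ, hfr, fun p hp ↦ ?_⟩
  obtain ⟨V, hV, hpV, hd, -, -, h⟩ := hD.2 p hp
  have hcl := inter_closure_eq_of_inter_eq hg.continuous hV hd h
  refine ⟨V, hV, hpV, g, hg.contDiffOn, hd, ?_, ?_⟩
  · rw [inter_comm, h]
    rfl
  · ext x
    have h1 := Set.ext_iff.1 h x
    have h2 := Set.ext_iff.1 hcl x
    rw [hD.1.frontier_eq]
    simp only [mem_inter_iff, mem_ofPred_eq, and_congr_right_iff, mem_sdiff] at h1 h2 ⊢
    constructor
    · rintro ⟨⟨hx1, hx2⟩, hxV⟩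
      exact ⟨hxV, le_antisymm ((h2 hxV).1 hx1) (not_lt.1 fun hlt ↦ hx2 ((h1 hxV).2 hlt))⟩
    · rintro ⟨hxV, hx0⟩
      exact ⟨⟨(h2 hxV).2 hx0.le, fun hx ↦ ((h1 hxV).1 hx).ne hx0⟩, hxV⟩
end

section
/- Let d ≥ 2 and let k be an integer with 2 ≤ k ≤ d. Define the quadratic form q : ℝ^d → ℝ by q(x) = x_1² + ⋯ + x_k² − x_{k+1}² − ⋯ − x_d². Then for every r > 0 and every δ ∈ ℝ, the set {x ∈ ℝ^d : ‖x‖ < r and q(x) > δ} is preconnected (indeed path-preconnected). -/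
/-- The vectors of `EuclideanSpace ℝ ι` supported on the coordinates satisfying `p`. -/
def supportedOn {ι : Type*} (p : ι → Prop) : Submodule ℝ (EuclideanSpace ℝ ι) where
  carrier := {x | ∀ i, ¬ p i → x i = 0}
  add_mem' := fun {x y} hx hy i hi => by simp [hx i hi, hy i hi]
  zero_mem' := fun i _ => by simp
  smul_mem' := fun c x hx i hi => by simp [hx i hi]

/-- The part `{‖x‖ < r ∧ q x > δ}` of a ball, where `q` is the diagonal quadratic form with sign
`+` on the coordinates satisfying `p` and sign `-` on the others. -/
def superlevelBall {ι : Type*} [Fintype ι] (p : ι → Prop) [DecidablePred p] (r δ : ℝ) :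
    Set (EuclideanSpace ℝ ι) :=
  {x | ‖x‖ < r ∧ ∑ i, (if p i then (x i) ^ 2 else -((x i) ^ 2)) > δ}

section

variable {ι : Type*} {p : ι → Prop}

theorem one_lt_rank_supportedOn {a b : ι} (hab : a ≠ b) (ha : p a) (hb : p b) :
    1 < Module.rank ℝ (supportedOn p) := by
  classical
  let e (c : ι) (hc : p c) : supportedOn p :=
    ⟨EuclideanSpace.single c 1, fun i hi => by
      have : i ≠ c := fun h => hi (h ▸ hc)
      simp [this]⟩
  have hli : LinearIndependent ℝ ![e a ha, e b hb] := by
    refine LinearIndependent.pair_iff.2 fun s t hst => ?_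
    have h (i : ι) := congrArg (fun x : supportedOn p => x.1 i) hst
    exact ⟨by simpa [e, hab] using h a, by simpa [e, hab.symm] using h b⟩
  have h2 : (2 : Cardinal) ≤ Module.rank ℝ (supportedOn p) := by
    simpa using hli.cardinal_lift_le_rank
  exact lt_of_lt_of_le (by norm_num) h2

variable [Fintype ι] [DecidablePred p] {r δ : ℝ}

theorem mem_superlevelBall_of_mem_supportedOn {x : EuclideanSpace ℝ ι} (hx : x ∈ supportedOn p) :
    x ∈ superlevelBall p r δ ↔ ‖x‖ < r ∧ δ < ‖x‖ ^ 2 := by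
  have : ∑ i, (if p i then (x i) ^ 2 else -((x i) ^ 2)) = ‖x‖ ^ 2 := by
    rw [EuclideanSpace.real_norm_sq_eq]
    refine Finset.sum_congr rfl fun i _ => ?_
    split_ifs with h
    · rfl
    · simp [hx i h]
  simp [superlevelBall, this]

/-- Shrinking the negative coordinates does not leave the super-level set. -/
theorem mem_superlevelBall_of_shrink {x y : EuclideanSpace ℝ ι} (hx : x ∈ superlevelBall p r δ)
    (hpos : ∀ i, p i → y i = x i) (hneg : ∀ i, ¬ p i → (y i) ^ 2 ≤ (x i) ^ 2) :
    y ∈ superlevelBall p r δ := by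
  refine ⟨lt_of_le_of_lt ?_ hx.1, lt_of_lt_of_le hx.2 (Finset.sum_le_sum fun i _ => ?_)⟩
  · refine (sq_le_sq₀ (norm_nonneg _) (norm_nonneg _)).1 ?_
    rw [EuclideanSpace.real_norm_sq_eq, EuclideanSpace.real_norm_sq_eq]
    refine Finset.sum_le_sum fun i _ => ?_
    by_cases h : p i
    · rw [hpos i h]
    · exact hneg i h
  · split_ifs with h
    · rw [hpos i h]
    · exact neg_le_neg (hneg i h)

/-- Every point of the super-level set is joined to its projection onto the positive coordinates. -/
theorem exists_joinedIn_supportedOn {x : EuclideanSpace ℝ ι} (hx : x ∈ superlevelBall p r δ) :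
    ∃ u ∈ supportedOn p, JoinedIn (superlevelBall p r δ) x u := by
  let u : EuclideanSpace ℝ ι := WithLp.toLp 2 fun i => if p i then x i else 0
  refine ⟨u, fun i hi => by simp [u, hi], JoinedIn.of_segment_subset ?_⟩
  rintro _ ⟨a, b, ha, hb, hab, rfl⟩
  refine mem_superlevelBall_of_shrink hx (fun i hi => ?_) fun i hi => ?_
  · simp [u, hi, ← add_mul, hab]
  · simp only [PiLp.add_apply, PiLp.smul_apply, smul_eq_mul, u, hi, if_false, mul_zero, add_zero,
      mul_pow]
    exact mul_le_of_le_one_left (sq_nonneg _) (pow_le_one₀ ha (by linarith))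

/-- Points of the open annulus `δ < ‖u‖ ^ 2 < r ^ 2` on the same ray are joined in it. -/
theorem joinedIn_superlevelBall_smul {u : EuclideanSpace ℝ ι} (hu : u ∈ supportedOn p) {c : ℝ}
    (hc : 0 < c) (h : u ∈ superlevelBall p r δ) (hcu : c • u ∈ superlevelBall p r δ) :
    JoinedIn (superlevelBall p r δ) (c • u) u := by
  have hmem (t : ℝ) := mem_superlevelBall_of_mem_supportedOn (r := r) (δ := δ)
    ((supportedOn p).smul_mem t hu)
  have hord : Set.OrdConnected {t : ℝ | 0 ≤ t ∧ t • u ∈ superlevelBall p r δ} := by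
    refine ⟨fun s hs t ht z hz => ⟨hs.1.trans hz.1, (hmem z).2 ?_⟩⟩
    have hz0 : 0 ≤ z := hs.1.trans hz.1
    have h1 := (hmem s).1 hs.2
    have h2 := (hmem t).1 ht.2
    rw [norm_smul, Real.norm_of_nonneg hs.1] at h1
    rw [norm_smul, Real.norm_of_nonneg ht.1] at h2
    rw [norm_smul, Real.norm_of_nonneg hz0]
    have hs0 := hs.1
    have := hz.1
    refine ⟨lt_of_le_of_lt ?_ h2.1, lt_of_lt_of_le h1.2 ?_⟩
    · exact mul_le_mul_of_nonneg_right hz.2 (norm_nonneg _)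
    · gcongr
  have hj : JoinedIn {t : ℝ | 0 ≤ t ∧ t • u ∈ superlevelBall p r δ} c 1 :=
    JoinedIn.of_segment_subset
      (hord.convex.segment_subset ⟨hc.le, hcu⟩ ⟨zero_le_one, by rwa [one_smul]⟩)
  have := hj.map (f := fun t : ℝ => t • u) (by fun_prop)
  rw [one_smul] at this
  exact this.mono (Set.image_subset_iff.2 fun t ht => ht.2)

theorem joinedIn_superlevelBall_of_mem_supportedOn (hrank : 1 < Module.rank ℝ (supportedOn p))
    (hδ : 0 ≤ δ) {u v : EuclideanSpace ℝ ι} (hu : u ∈ supportedOn p) (hv : v ∈ supportedOn p)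
    (hu' : u ∈ superlevelBall p r δ) (hv' : v ∈ superlevelBall p r δ) :
    JoinedIn (superlevelBall p r δ) u v := by
  have hun := (mem_superlevelBall_of_mem_supportedOn hu).1 hu'
  have hvn := (mem_superlevelBall_of_mem_supportedOn hv).1 hv'
  have hu0 : 0 < ‖u‖ :=
    (norm_nonneg u).lt_of_ne' (sq_pos_iff.1 (hδ.trans_lt hun.2))
  have hv0 : 0 < ‖v‖ :=
    (norm_nonneg v).lt_of_ne' (sq_pos_iff.1 (hδ.trans_lt hvn.2))
  have hc : 0 < ‖u‖ / ‖v‖ := div_pos hu0 hv0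
  have hcv : (‖u‖ / ‖v‖) • v ∈ supportedOn p := (supportedOn p).smul_mem _ hv
  have hcn : ‖(‖u‖ / ‖v‖) • v‖ = ‖u‖ := by
    rw [norm_smul, Real.norm_of_nonneg hc.le, div_mul_cancel₀ _ hv0.ne']
  have hj := (isPathConnected_sphere hrank 0 (norm_nonneg u)).joinedIn
    ⟨u, hu⟩ (by simp) ⟨_, hcv⟩ (by simpa using hcn)
  have hj' := (hj.map (f := Subtype.val) continuous_subtype_val).mono
    (V := superlevelBall p r δ) (by
      rintro _ ⟨w, hw, rfl⟩
      have hw' : ‖(w : EuclideanSpace ℝ ι)‖ = ‖u‖ := by simpa using hw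
      rw [mem_superlevelBall_of_mem_supportedOn w.2, hw']
      exact hun)
  exact hj'.trans (joinedIn_superlevelBall_smul hv hc hv' hj'.target_mem)

theorem joinedIn_superlevelBall_zero (hδ : δ < 0) {x : EuclideanSpace ℝ ι}
    (hx : x ∈ superlevelBall p r δ) : JoinedIn (superlevelBall p r δ) 0 x := by
  refine JoinedIn.of_segment_subset ?_
  rintro _ ⟨a, b, ha, hb, hab, rfl⟩
  have hb1 : b ≤ 1 := by linarith
  rw [smul_zero, zero_add]
  refine ⟨lt_of_le_of_lt ?_ hx.1, ?_⟩
  · rw [norm_smul, Real.norm_of_nonneg hb]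
    exact mul_le_of_le_one_left (norm_nonneg _) hb1
  · have h2 := hx.2
    have : ∑ i, (if p i then ((b • x) i) ^ 2 else -(((b • x) i) ^ 2)) =
        b ^ 2 * ∑ i, (if p i then (x i) ^ 2 else -((x i) ^ 2)) := by
      rw [Finset.mul_sum]
      refine Finset.sum_congr rfl fun i _ => ?_
      split_ifs <;> simp [mul_pow]
    rw [this]
    have hb2 : b ^ 2 ≤ 1 := pow_le_one₀ hb hb1
    rcases le_total 0 (∑ i, if p i then (x i) ^ 2 else -((x i) ^ 2)) with h | h
    · exact hδ.trans_le (mul_nonneg (sq_nonneg b) h)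
    · nlinarith

theorem joinedIn_superlevelBall (hrank : 1 < Module.rank ℝ (supportedOn p))
    {x y : EuclideanSpace ℝ ι} (hx : x ∈ superlevelBall p r δ) (hy : y ∈ superlevelBall p r δ) :
    JoinedIn (superlevelBall p r δ) x y := by
  rcases lt_or_ge δ 0 with hδ | hδ
  · exact (joinedIn_superlevelBall_zero hδ hx).symm.trans (joinedIn_superlevelBall_zero hδ hy)
  · obtain ⟨u, hu, hxu⟩ := exists_joinedIn_supportedOn hx
    obtain ⟨v, hv, hyv⟩ := exists_joinedIn_supportedOn hy
    exact (hxu.trans (joinedIn_superlevelBall_of_mem_supportedOn hrank hδ hu hv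
      hxu.target_mem hyv.target_mem)).trans hyv.symm

end


/-- **Connectivity of super-level sets of the Morse quadratic model** (step 2)
of the proof of Proposition 4.1 of the paper). If
`q(x) = x₁² + ⋯ + x_k² − x_{k+1}² − ⋯ − x_d²` with `2 ≤ k ≤ d`, then for every
`r > 0` and every `δ`, the set `{‖x‖ < r ∧ q x > δ}` is preconnected, and in
fact any two of its points are joined by a path inside it. -/
theorem quadratic_superlevel_preconnected (d : ℕ) (hd : 2 ≤ d)
    (k : ℕ) (hk2 : 2 ≤ k) (hkd : k ≤ d)
    (q : EuclideanSpace ℝ (Fin d) → ℝ)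
    (hq : ∀ x : EuclideanSpace ℝ (Fin d),
      q x = ∑ i : Fin d, (if (i : ℕ) < k then (x i) ^ 2 else -((x i) ^ 2)))
    (r : ℝ) (hr : 0 < r) (δ : ℝ) :
    IsPreconnected {x : EuclideanSpace ℝ (Fin d) | ‖x‖ < r ∧ q x > δ} ∧
    ∀ x ∈ {x : EuclideanSpace ℝ (Fin d) | ‖x‖ < r ∧ q x > δ},
      ∀ y ∈ {x : EuclideanSpace ℝ (Fin d) | ‖x‖ < r ∧ q x > δ},
        JoinedIn {x : EuclideanSpace ℝ (Fin d) | ‖x‖ < r ∧ q x > δ} x y := by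
  have hset : {x : EuclideanSpace ℝ (Fin d) | ‖x‖ < r ∧ q x > δ} =
      superlevelBall (fun i : Fin d => (i : ℕ) < k) r δ := by
    ext x
    simp only [superlevelBall, Set.mem_ofPred_eq, hq]
  have hrank : 1 < Module.rank ℝ (supportedOn fun i : Fin d => (i : ℕ) < k) :=
    one_lt_rank_supportedOn (a := ⟨0, by omega⟩) (b := ⟨1, by omega⟩) (by simp)
      (by simp only; omega) (by simp only; omega)
  rw [hset]
  have hjoin := fun x hx y hy =>
    joinedIn_superlevelBall (r := r) (δ := δ) hrank (x := x) (y := y) hx hy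
  refine ⟨isPreconnected_of_forall_pair fun x hx y hy => ?_, hjoin⟩
  obtain ⟨γ, hγ⟩ := hjoin x hx y hy
  exact ⟨Set.range γ, Set.range_subset_iff.2 hγ, γ.source_mem_range, γ.target_mem_range,
    isPreconnected_range γ.continuous⟩
end

section
/- Let m ≥ 2, let U ⊆ ℝ^m be open, let μ : U → ℝ be C^∞, and let p̂ ∈ U be a critical point of μ (the differential of μ vanishes at p̂) such that the second derivative D²μ(p̂), viewed as a symmetric bilinear form on ℝ^m, is nondegenerate and satisfies: there exists a 2-dimensional linear subspace P ⊆ ℝ^m with D²μ(p̂)(v,v) > 0 for every v ∈ P \ {0}. Then for every neighborhood W of p̂ there exists an open connected neighborhood V of p̂ with V ⊆ W such that for every δ ∈ ℝ the set {x ∈ V : μ(x) > μ(p̂) + δ} is preconnected. -/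
open Set Filter Topology Metric

/-- A relatively open union of nonempty preconnected slices over a preconnected base is
preconnected. -/
theorem IsOpen.isPreconnected_of_slices {X Y : Type*} [TopologicalSpace X] [TopologicalSpace Y]
    {O : Set (X × Y)} (hO : IsOpen O) {A : Set X} (hA : IsPreconnected A)
    (hne : ∀ x ∈ A, ∃ y, (x, y) ∈ O) (hslice : ∀ x ∈ A, IsPreconnected {y | (x, y) ∈ O}) :
    IsPreconnected {p | p ∈ O ∧ p.1 ∈ A} := by
  rintro U₁ U₂ hU₁ hU₂ hcover ⟨p, ⟨hpO, hpA⟩, hp⟩ ⟨q, ⟨hqO, hqA⟩, hq⟩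
  obtain ⟨x, hxA, ⟨⟨x₁, y₁⟩, ⟨h₁O, h₁U⟩, rfl⟩, ⟨⟨x₂, y₂⟩, ⟨h₂O, h₂U⟩, hx⟩⟩ :=
    hA (Prod.fst '' (O ∩ U₁)) (Prod.fst '' (O ∩ U₂)) (isOpenMap_fst _ (hO.inter hU₁))
      (isOpenMap_fst _ (hO.inter hU₂))
      (fun x hx ↦ by
        obtain ⟨y, hy⟩ := hne x hx
        rcases hcover ⟨hy, hx⟩ with h | h
        · exact .inl ⟨_, ⟨hy, h⟩, rfl⟩
        · exact .inr ⟨_, ⟨hy, h⟩, rfl⟩)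
      ⟨p.1, hpA, p, ⟨hpO, hp⟩, rfl⟩ ⟨q.1, hqA, q, ⟨hqO, hq⟩, rfl⟩
  obtain rfl : x₂ = x₁ := hx
  have hcont : Continuous fun y : Y ↦ (x₂, y) := by fun_prop
  obtain ⟨y, hyO, hy⟩ := hslice x₂ hxA _ _ (hU₁.preimage hcont) (hU₂.preimage hcont)
    (fun y hy ↦ hcover ⟨hy, hxA⟩) ⟨y₁, h₁O, h₁U⟩ ⟨y₂, h₂O, h₂U⟩
  exact ⟨(x₂, y), ⟨hyO, hxA⟩, hy⟩

section

variable {F G : Type*} [NormedAddCommGroup F] [InnerProductSpace ℝ F]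
  [NormedAddCommGroup G] [InnerProductSpace ℝ G]

/-- Quantitative features, on the product of the closed `r`-balls, of a function which is
increasing in the radial direction of the first factor and concave on the second one. -/
structure IsSaddleOn (f : F × G → ℝ) (r : ℝ) : Prop where
  continuousAt : ∀ x, ‖x‖ ≤ r → ContinuousAt f x
  convex : ∀ u : F, ‖u‖ ≤ r → ∀ δ : ℝ, Convex ℝ {v : G | ‖v‖ < r ∧ δ < f (u, v)}
  shrink : ∀ (u : F) (v : G), ‖u‖ ≤ r → ‖v‖ ≤ r → ∃ v' : G, ‖v'‖ ≤ ‖u‖ ∧ f (u, v) ≤ f (u, v')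
  mono : ∀ (u : F) (v : G) (s : ℝ), ‖u‖ ≤ r → 0 ≤ s → s ≤ 1 → ‖v‖ ≤ ‖s • u‖ →
    f (s • u, v) ≤ f (u, v)
  growth : ∀ u : F, ‖u‖ ≤ r → f 0 + ‖u‖ ^ 2 / 4 ≤ f (u, 0)

namespace IsSaddleOn

variable {f : F × G → ℝ} {r : ℝ}

theorem apply_zero_le (h : IsSaddleOn f r) {v : G} (hv : ‖v‖ ≤ r) : f (0, v) ≤ f 0 := by
  obtain ⟨v', hv', hle⟩ := h.shrink 0 v (by simpa using (norm_nonneg v).trans hv) hv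
  obtain rfl : v' = 0 := by simpa using hv'
  exact hle

/-- The points of the `r`-ball over which `f` stays below `c`. -/
def sublevelBase (f : F × G → ℝ) (r c : ℝ) : Set F :=
  {u | ‖u‖ < r ∧ ∀ v : G, ‖v‖ ≤ r → f (u, v) < c}

theorem zero_mem_sublevelBase (h : IsSaddleOn f r) (hr : 0 < r) {c : ℝ} (hc : f 0 < c) :
    0 ∈ sublevelBase f r c :=
  ⟨by simpa using hr, fun _ hv ↦ (h.apply_zero_le hv).trans_lt hc⟩

theorem smul_mem_sublevelBase (h : IsSaddleOn f r) {c : ℝ} {u : F}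
    (hu : u ∈ sublevelBase f r c) {s : ℝ} (hs₀ : 0 ≤ s) (hs₁ : s ≤ 1) :
    s • u ∈ sublevelBase f r c := by
  have hsu : ‖s • u‖ ≤ ‖u‖ := by
    rw [norm_smul, Real.norm_of_nonneg hs₀]
    exact mul_le_of_le_one_left (norm_nonneg u) hs₁
  refine ⟨hsu.trans_lt hu.1, fun v hv ↦ ?_⟩
  obtain ⟨v', hv', hle⟩ := h.shrink (s • u) v (hsu.trans hu.1.le) hv
  exact (hle.trans (h.mono u v' s hu.1.le hs₀ hs₁ hv')).trans_lt
    (hu.2 v' (hv'.trans (hsu.trans hu.1.le)))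

theorem isOpen_sublevelBase [ProperSpace G] (h : IsSaddleOn f r) (c : ℝ) :
    IsOpen (sublevelBase f r c) := by
  refine isOpen_iff_mem_nhds.2 fun u hu ↦ ?_
  have h₁ : ∀ᶠ u' in 𝓝 u, ‖u'‖ < r := continuous_norm.continuousAt.eventually_lt_const hu.1
  have h₂ : ∀ᶠ u' in 𝓝 u, ∀ v ∈ closedBall (0 : G) r, f (u', v) < c := by
    refine (isCompact_closedBall (0 : G) r).eventually_forall_of_forall_eventually fun v hv ↦ ?_
    have hv' : ‖v‖ ≤ r := by simpa using hv
    exact (h.continuousAt (u, v) (max_le hu.1.le hv')).eventually_lt_const (hu.2 v hv')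
  filter_upwards [h₁, h₂] with u' h₁ h₂
  exact ⟨h₁, fun v hv ↦ h₂ v (by simpa using hv)⟩

theorem starConvex_sublevelBase (h : IsSaddleOn f r) (c : ℝ) :
    StarConvex ℝ 0 (sublevelBase f r c) :=
  starConvex_zero_iff.2 fun _ hu _ hs₀ hs₁ ↦ h.smul_mem_sublevelBase hu hs₀ hs₁

theorem isPreconnected_sublevelBase (h : IsSaddleOn f r) (c : ℝ) :
    IsPreconnected (sublevelBase f r c) := by
  rcases (sublevelBase f r c).eq_empty_or_nonempty with he | hne
  · rw [he]
    exact isPreconnected_empty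
  · obtain ⟨u, hu⟩ := hne
    refine ((h.starConvex_sublevelBase c).isPathConnected ?_).isConnected.isPreconnected
    simpa using h.smul_mem_sublevelBase hu le_rfl zero_le_one

theorem isOpen_superlevel [ProperSpace G] (h : IsSaddleOn f r) (c δ : ℝ) :
    IsOpen {x : F × G | x.1 ∈ sublevelBase f r c ∧ ‖x.2‖ < r ∧ δ < f x} := by
  refine isOpen_iff_mem_nhds.2 fun x hx ↦ ?_
  filter_upwards [continuousAt_fst.eventually_mem ((h.isOpen_sublevelBase c).mem_nhds hx.1),
    continuous_snd.norm.continuousAt.eventually_lt_const hx.2.1,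
    (h.continuousAt x (max_le hx.1.1.le hx.2.1.le)).eventually_const_lt hx.2.2]
    with y h₁ h₂ h₃ using ⟨h₁, h₂, h₃⟩

/-- The projection of a super-level set to the first factor. -/
def superlevelBase (f : F × G → ℝ) (r c δ : ℝ) : Set F :=
  {u | u ∈ sublevelBase f r c ∧ ∃ v : G, ‖v‖ < r ∧ δ < f (u, v)}

theorem isOpen_superlevelBase [ProperSpace G] (h : IsSaddleOn f r) (c δ : ℝ) :
    IsOpen (superlevelBase f r c δ) := by
  convert isOpenMap_fst _ (h.isOpen_superlevel c δ) using 1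
  ext u
  constructor
  · rintro ⟨hu, v, hv⟩
    exact ⟨(u, v), ⟨hu, hv⟩, rfl⟩
  · rintro ⟨x, ⟨hu, hv⟩, rfl⟩
    exact ⟨hu, x.2, hv⟩

theorem mem_superlevelBase_of_smul (h : IsSaddleOn f r) {c δ : ℝ} {u : F}
    (hu : u ∈ sublevelBase f r c) {s : ℝ} (hs₀ : 0 ≤ s) (hs₁ : s ≤ 1)
    (hsu : s • u ∈ superlevelBase f r c δ) : u ∈ superlevelBase f r c δ := by
  obtain ⟨hsu, v, hv, hδ⟩ := hsu
  obtain ⟨v', hv', hle⟩ := h.shrink (s • u) v hsu.1.le hv.le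
  exact ⟨hu, v', hv'.trans_lt hsu.1, (hδ.trans_le hle).trans_le (h.mono u v' s hu.1.le hs₀ hs₁ hv')⟩

/-- Every ray from the origin meets the projection of a super-level set. -/
theorem exists_smul_mem_superlevelBase [ProperSpace G] (h : IsSaddleOn f r) (hr : 0 < r) {δ : ℝ}
    (hδ₀ : f 0 ≤ δ) (hδ : δ < f 0 + r ^ 2 / 16) {w : F} (hw : ‖w‖ = 1) :
    ∃ t : ℝ, 0 < t ∧ t • w ∈ superlevelBase f r (f 0 + r ^ 2 / 16) δ := by
  set c := f 0 + r ^ 2 / 16 with hc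
  have hnorm : ∀ t ∈ Icc 0 (r / 2), ‖t • w‖ = t := fun t ht ↦ by
    rw [norm_smul, hw, mul_one, Real.norm_of_nonneg ht.1]
  have hcont : Continuous fun t : ℝ ↦ t • w := by fun_prop
  have hopen : IsOpen {u : F | ‖u‖ < r ∧ ∃ v : G, ‖v‖ < r ∧ δ < f (u, v)} := by
    refine isOpen_iff_mem_nhds.2 fun u ⟨hu, v, hv, hf⟩ ↦ ?_
    have hfc : ContinuousAt (fun u' ↦ f (u', v)) u :=
      (h.continuousAt (u, v) (max_le hu.le hv.le)).comp (f := fun u' ↦ (u', v)) (by fun_prop)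
    filter_upwards [continuous_norm.continuousAt.eventually_lt_const hu,
      hfc.eventually_const_lt hf] with u' h₁ h₂ using ⟨h₁, v, hv, h₂⟩
  obtain ⟨t, ht, htD, htE⟩ := isPreconnected_Icc (a := (0 : ℝ)) (b := r / 2) _ _
    ((h.isOpen_sublevelBase c).preimage hcont) (hopen.preimage hcont)
    (fun t ht ↦ by
      have htr : ‖t • w‖ < r := by rw [hnorm t ht]; linarith [ht.2]
      by_cases htD : t • w ∈ sublevelBase f r c
      · exact .inl htD
      · have : ∃ v : G, ‖v‖ ≤ r ∧ c ≤ f (t • w, v) := by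
          by_contra! hcon
          exact htD ⟨htr, hcon⟩
        obtain ⟨v, hv, hle⟩ := this
        obtain ⟨v', hv', hle'⟩ := h.shrink _ v htr.le hv
        exact .inr ⟨htr, v', hv'.trans_lt htr, hδ.trans_le (hle.trans hle')⟩)
    ⟨0, by simp; positivity, by
      simpa using h.zero_mem_sublevelBase hr (show f 0 < c by rw [hc]; simp; positivity)⟩
    ⟨r / 2, by simp; positivity, by
      have hn := hnorm (r / 2) (by simp; positivity)
      refine ⟨by rw [hn]; linarith, 0, by simpa using hr, hδ.trans_le ?_⟩
      have := h.growth ((r / 2) • w) (by rw [hn]; linarith)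
      rw [hn] at this
      rw [hc]; linarith⟩
  refine ⟨t, ht.1.lt_of_ne ?_, htD, htE.2⟩
  rintro rfl
  obtain ⟨-, v, hv, hf⟩ := htE
  simp only [zero_smul] at hf
  exact (hf.trans_le (h.apply_zero_le hv.le)).not_ge hδ₀

theorem isPreconnected_superlevelBase [ProperSpace G] (h : IsSaddleOn f r) (hr : 0 < r)
    (hF : 1 < Module.rank ℝ F) {δ : ℝ} (hδ : δ < f 0 + r ^ 2 / 16) :
    IsPreconnected (superlevelBase f r (f 0 + r ^ 2 / 16) δ) := by
  rcases lt_or_ge δ (f 0) with hδ₀ | hδ₀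
  · convert h.isPreconnected_sublevelBase (f 0 + r ^ 2 / 16) using 1
    refine Subset.antisymm (fun u hu ↦ hu.1) fun u hu ↦ ⟨hu, 0, by simpa using hr, ?_⟩
    have := h.growth u hu.1.le
    nlinarith [sq_nonneg ‖u‖]
  set A := superlevelBase f r (f 0 + r ^ 2 / 16) δ
  have hcont : Continuous fun p : F × ℝ ↦ p.2 • p.1 := by fun_prop
  have hopen : IsOpen {p : F × ℝ | 0 < p.2 ∧ p.2 • p.1 ∈ A} :=
    (isOpen_lt continuous_const continuous_snd).inter ((h.isOpen_superlevelBase _ _).preimage hcont)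
  have hpre := (hopen.isPreconnected_of_slices (isPreconnected_sphere hF (0 : F) 1)
    (fun w hw ↦ h.exists_smul_mem_superlevelBase hr hδ₀ hδ (by simpa using hw))
    (fun w _ ↦ OrdConnected.isPreconnected ⟨by
      rintro t₁ ⟨ht₁, h₁⟩ t₂ ⟨ht₂, h₂⟩ t ⟨hle₁, hle₂⟩
      have ht : 0 < t := ht₁.trans_le hle₁
      refine ⟨ht, h.mem_superlevelBase_of_smul (s := t₁ / t) ?_ (by positivity)
        ((div_le_one ht).2 hle₁) ?_⟩
      · have := h.smul_mem_sublevelBase h₂.1 (s := t / t₂) (by positivity) ((div_le_one ht₂).2 hle₂)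
        rwa [smul_smul, div_mul_cancel₀ _ ht₂.ne'] at this
      · rwa [smul_smul, div_mul_cancel₀ _ ht.ne']⟩)).image _ hcont.continuousOn
  convert hpre using 1
  refine Subset.antisymm (fun u hu ↦ ?_) ?_
  · have hu₀ : u ≠ 0 := by
      rintro rfl
      obtain ⟨-, v, hv, hf⟩ := hu
      exact (hf.trans_le (h.apply_zero_le hv.le)).not_ge hδ₀
    have hn : 0 < ‖u‖ := norm_pos_iff.2 hu₀
    have heq : ‖u‖ • ‖u‖⁻¹ • u = u := smul_inv_smul₀ hn.ne' u
    exact ⟨(‖u‖⁻¹ • u, ‖u‖), ⟨⟨hn, by rwa [heq]⟩, by simp [norm_smul, hn.ne']⟩, heq⟩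
  · rintro _ ⟨p, ⟨⟨-, hp⟩, -⟩, rfl⟩
    exact hp

theorem exists_isConnected_nhd [ProperSpace G] (h : IsSaddleOn f r) (hr : 0 < r)
    (hF : 1 < Module.rank ℝ F) :
    ∃ V : Set (F × G), IsOpen V ∧ IsConnected V ∧ 0 ∈ V ∧ V ⊆ ball 0 r ∧
      ∀ δ : ℝ, IsPreconnected {x ∈ V | δ < f x} := by
  set c := f 0 + r ^ 2 / 16 with hc
  have h₀ : (0 : F) ∈ sublevelBase f r c :=
    h.zero_mem_sublevelBase hr (by rw [hc]; simp; positivity)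
  refine ⟨sublevelBase f r c ×ˢ ball 0 r, (h.isOpen_sublevelBase c).prod isOpen_ball,
    IsConnected.prod ⟨⟨0, h₀⟩, h.isPreconnected_sublevelBase c⟩
      ((convex_ball _ _).isPathConnected ⟨0, mem_ball_self hr⟩).isConnected,
    ⟨h₀, mem_ball_self hr⟩, ?_, fun δ ↦ ?_⟩
  · rintro x ⟨h₁, h₂⟩
    exact mem_ball_zero_iff.2 (max_lt h₁.1 (mem_ball_zero_iff.1 h₂))
  · rcases le_or_gt c δ with hδ | hδ
    · convert isPreconnected_empty
      refine eq_empty_of_forall_notMem ?_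
      rintro x ⟨⟨h₁, h₂⟩, h₃⟩
      exact ((h₁.2 x.2 (mem_ball_zero_iff.1 h₂).le).trans_le hδ).not_gt h₃
    · convert (h.isOpen_superlevel c δ).isPreconnected_of_slices
        (h.isPreconnected_superlevelBase hr hF hδ) (fun u hu ↦ ?_) (fun u hu ↦ ?_) using 1
      · ext x
        constructor
        · rintro ⟨⟨h₁, h₂⟩, h₃⟩
          exact ⟨⟨h₁, mem_ball_zero_iff.1 h₂, h₃⟩, h₁, x.2, mem_ball_zero_iff.1 h₂, h₃⟩
        · rintro ⟨⟨h₁, h₂, h₃⟩, -⟩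
          exact ⟨⟨h₁, mem_ball_zero_iff.2 h₂⟩, h₃⟩
      · obtain ⟨h₁, v, hv⟩ := hu
        exact ⟨v, h₁, hv⟩
      · convert (h.convex u hu.1.1.le δ).isPreconnected using 1
        ext v
        exact and_iff_right hu.1

end IsSaddleOn

namespace IsSaddleOn
variable {f : F × G → ℝ} {r : ℝ}

/-- Near a critical point with Hessian `‖u‖ ^ 2 - ‖v‖ ^ 2`, a function is a saddle. -/
theorem of_fderiv_estimate {f' : F × G → F × G →L[ℝ] ℝ} {B : F × G →L[ℝ] F × G →L[ℝ] ℝ}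
    (hf : ∀ x, ‖x‖ ≤ r → HasFDerivAt f (f' x) x) (h₀ : f' 0 = 0)
    (hB : ∀ x y, B x y = inner ℝ x.1 y.1 - inner ℝ x.2 y.2)
    (hest : ∀ x y, ‖x‖ ≤ r → ‖y‖ ≤ r → ‖f' x - f' y - B (x - y)‖ ≤ 1 / 2 * ‖x - y‖) :
    IsSaddleOn f r := by
  have key : ∀ x y z, ‖x‖ ≤ r → ‖y‖ ≤ r →
      |f' x z - f' y z - B (x - y) z| ≤ 1 / 2 * ‖x - y‖ * ‖z‖ := fun x y z hx hy ↦
    ((f' x - f' y - B (x - y)).le_opNorm z).trans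
      (mul_le_mul_of_nonneg_right (hest x y hx hy) (norm_nonneg z))
  have key₀ : ∀ x z, ‖x‖ ≤ r → |f' x z - B x z| ≤ 1 / 2 * ‖x‖ * ‖z‖ := fun x z hx ↦ by
    simpa [h₀] using key x 0 z hx (by simpa using (norm_nonneg x).trans hx)
  have hrad : ∀ (u : F) (v : G), ‖u‖ ≤ r → ‖v‖ ≤ ‖u‖ → ‖u‖ ^ 2 / 2 ≤ f' (u, v) (u, 0) := by
    intro u v hu hv
    have := key₀ (u, v) (u, 0) (max_le hu (hv.trans hu))
    simp only [hB, Prod.norm_mk, norm_zero, max_eq_left hv, max_eq_left (norm_nonneg u),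
      real_inner_self_eq_norm_sq, inner_zero_right] at this
    nlinarith [(abs_le.1 this).1]
  have hvert : ∀ (u : F) (v : G), ‖v‖ ≤ r → ‖u‖ ≤ ‖v‖ → f' (u, v) (0, v) ≤ 0 := by
    intro u v hv hu
    have := key₀ (u, v) (0, v) (max_le (hu.trans hv) hv)
    simp only [hB, Prod.norm_mk, norm_zero, max_eq_right hu, max_eq_right (norm_nonneg v),
      real_inner_self_eq_norm_sq, inner_zero_right] at this
    nlinarith [(abs_le.1 this).2, sq_nonneg ‖v‖]
  have hderiv₁ : ∀ (u : F) (v : G) (t : ℝ), ‖t • u‖ ≤ r → ‖v‖ ≤ r →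
      HasDerivAt (fun t : ℝ ↦ f (t • u, v)) (f' (t • u, v) (u, 0)) t := fun u v t hu hv ↦ by
    have hline : HasDerivAt (fun t : ℝ ↦ (t • u, v)) (u, 0) t := by
      simpa using ((hasDerivAt_id t).smul_const u).prodMk (hasDerivAt_const t v)
    exact (hf (t • u, v) (max_le hu hv)).comp_hasDerivAt t hline
  have hderiv₂ : ∀ (u : F) (v d : G) (t : ℝ), ‖u‖ ≤ r → ‖v + t • d‖ ≤ r →
      HasDerivAt (fun t : ℝ ↦ f (u, v + t • d)) (f' (u, v + t • d) (0, d)) t := fun u v d t hu hv ↦ by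
    have hline : HasDerivAt (fun t : ℝ ↦ (u, v + t • d)) (0, d) t := by
      simpa using (hasDerivAt_const t u).prodMk (((hasDerivAt_id t).smul_const d).const_add v)
    exact (hf (u, v + t • d) (max_le hu hv)).comp_hasDerivAt t hline
  have hscale : ∀ (u : F) {s : ℝ}, ‖u‖ ≤ r → 0 ≤ s → s ≤ 1 → ‖s • u‖ ≤ r := fun u s hu hs₀ hs₁ ↦ by
    rw [norm_smul, Real.norm_of_nonneg hs₀]
    exact (mul_le_of_le_one_left (norm_nonneg u) hs₁).trans hu
  have hscale' : ∀ (u : G) {s : ℝ}, ‖u‖ ≤ r → 0 ≤ s → s ≤ 1 → ‖s • u‖ ≤ r := fun u s hu hs₀ hs₁ ↦ by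
    rw [norm_smul, Real.norm_of_nonneg hs₀]
    exact (mul_le_of_le_one_left (norm_nonneg u) hs₁).trans hu
  refine ⟨fun x hx ↦ (hf x hx).continuousAt, fun u hu δ ↦ ?_, fun u v hu hv ↦ ?_,
    fun u v s hu hs₀ hs₁ hv ↦ ?_, fun u hu ↦ ?_⟩
  · rintro v ⟨hv, hδv⟩ w ⟨hw, hδw⟩ a b ha hb hab
    have hball : ∀ t ∈ Icc (0 : ℝ) 1, ‖v + t • (w - v)‖ < r := fun t ht ↦ by
      have := (convex_ball (0 : G) r).add_smul_sub_mem (mem_ball_zero_iff.2 hv)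
        (mem_ball_zero_iff.2 hw) ht
      exact mem_ball_zero_iff.1 this
    have hd : ∀ t ∈ Icc (0 : ℝ) 1, HasDerivAt (fun t : ℝ ↦ f (u, v + t • (w - v)))
        (f' (u, v + t • (w - v)) (0, w - v)) t := fun t ht ↦ hderiv₂ u v _ t hu (hball t ht).le
    have hconc : ConcaveOn ℝ (Icc (0 : ℝ) 1) fun t : ℝ ↦ f (u, v + t • (w - v)) := by
      refine AntitoneOn.concaveOn_of_deriv (convex_Icc 0 1)
        (fun t ht ↦ (hd t ht).continuousAt.continuousWithinAt)
        (fun t ht ↦ (hd t (interior_subset ht)).differentiableAt.differentiableWithinAt) ?_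
      intro s hs t ht hst
      have hs := interior_subset hs
      have ht := interior_subset ht
      rw [(hd s hs).deriv, (hd t ht).deriv]
      have hsub : (u, v + t • (w - v)) - (u, v + s • (w - v)) = ((0 : F), (t - s) • (w - v)) := by
        ext <;> simp [sub_smul]
      have := key (u, v + t • (w - v)) (u, v + s • (w - v)) (0, w - v)
        (max_le hu (hball t ht).le) (max_le hu (hball s hs).le)
      rw [hsub, hB] at this
      simp only [Prod.norm_mk, norm_zero, norm_smul, real_inner_smul_left,
        Real.norm_of_nonneg (sub_nonneg.2 hst), inner_zero_right,
        real_inner_self_eq_norm_sq, max_eq_right (norm_nonneg (w - v)),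
        max_eq_right (mul_nonneg (sub_nonneg.2 hst) (norm_nonneg (w - v)))] at this
      nlinarith [(abs_le.1 this).2, mul_nonneg (sub_nonneg.2 hst) (sq_nonneg ‖w - v‖)]
    have hcomb : a • v + b • w = v + b • (w - v) := by
      rw [← eq_sub_iff_add_eq] at hab
      rw [hab]; module
    rw [hcomb]
    have hb₁ : b ≤ 1 := by linarith
    refine ⟨hball b ⟨hb, hb₁⟩, ?_⟩
    have := (hconc.convex_gt δ) (x := 0) ⟨by simp, by simpa using hδv⟩ (y := 1)
      ⟨by simp, by simpa using hδw⟩ ha hb hab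
    simpa using this.2
  · rcases le_or_gt ‖v‖ ‖u‖ with hvu | hvu
    · exact ⟨v, hvu, le_rfl⟩
    have hv₀ : 0 < ‖v‖ := (norm_nonneg u).trans_lt hvu
    have hs₀ : 0 ≤ ‖u‖ / ‖v‖ := by positivity
    have hs₁ : ‖u‖ / ‖v‖ ≤ 1 := (div_le_one hv₀).2 hvu.le
    have hd : ∀ t ∈ Icc (‖u‖ / ‖v‖) 1, HasDerivAt (fun t : ℝ ↦ f (u, t • v))
        (f' (u, t • v) (0, v)) t := fun t ht ↦ by
      simpa using hderiv₂ u 0 v t hu (by simpa using hscale' v hv (hs₀.trans ht.1) ht.2)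
    refine ⟨(‖u‖ / ‖v‖) • v, ?_, ?_⟩
    · rw [norm_smul, Real.norm_of_nonneg hs₀, div_mul_cancel₀ _ hv₀.ne']
    have := antitoneOn_of_deriv_nonpos (convex_Icc (‖u‖ / ‖v‖) 1)
      (fun t ht ↦ (hd t ht).continuousAt.continuousWithinAt)
      (fun t ht ↦ (hd t (interior_subset ht)).differentiableAt.differentiableWithinAt)
      (fun t ht ↦ by
        rw [(hd t (interior_subset ht)).deriv]
        rw [interior_Icc] at ht
        have ht₀ : 0 < t := hs₀.trans_lt ht.1
        have := hvert u (t • v) (hscale' v hv ht₀.le ht.2.le) (by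
          rw [norm_smul, Real.norm_of_nonneg ht₀.le]
          exact ((div_lt_iff₀ hv₀).1 ht.1).le)
        have hz : ((0 : F), t • v) = t • ((0 : F), v) := by simp
        rw [show f' (u, t • v) (0, t • v) = t * f' (u, t • v) (0, v) from
          (congrArg _ hz).trans (map_smul _ _ _)] at this
        exact nonpos_of_mul_nonpos_right this ht₀)
      (left_mem_Icc.2 hs₁) (right_mem_Icc.2 hs₁) hs₁
    simpa using this
  · have hvr : ‖v‖ ≤ r := hv.trans (hscale u hu hs₀ hs₁)
    have hd : ∀ t ∈ Icc s 1, HasDerivAt (fun t : ℝ ↦ f (t • u, v))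
        (f' (t • u, v) (u, 0)) t := fun t ht ↦
      hderiv₁ u v t (hscale u hu (hs₀.trans ht.1) ht.2) hvr
    have := monotoneOn_of_deriv_nonneg (convex_Icc s 1)
      (fun t ht ↦ (hd t ht).continuousAt.continuousWithinAt)
      (fun t ht ↦ (hd t (interior_subset ht)).differentiableAt.differentiableWithinAt)
      (fun t ht ↦ by
        rw [(hd t (interior_subset ht)).deriv]
        rw [interior_Icc] at ht
        have ht₀ : 0 < t := hs₀.trans_lt ht.1
        have := hrad (t • u) v (hscale u hu ht₀.le ht.2.le) (hv.trans (by
          rw [norm_smul, norm_smul, Real.norm_of_nonneg ht₀.le, Real.norm_of_nonneg hs₀]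
          exact mul_le_mul_of_nonneg_right ht.1.le (norm_nonneg u)))
        have hz : (t • u, (0 : G)) = t • (u, (0 : G)) := by simp
        rw [show f' (t • u, v) (t • u, 0) = t * f' (t • u, v) (u, 0) from
          (congrArg _ hz).trans (map_smul _ _ _)] at this
        exact nonneg_of_mul_nonneg_right ((by positivity : 0 ≤ ‖t • u‖ ^ 2 / 2).trans this) ht₀)
      (left_mem_Icc.2 hs₁) (right_mem_Icc.2 hs₁) hs₁
    simpa using this
  · have hr : ‖(0 : G)‖ ≤ r := by simpa using (norm_nonneg u).trans hu
    have hd : ∀ t ∈ Icc (0 : ℝ) 1, HasDerivAt (fun t : ℝ ↦ f (t • u, 0) - t ^ 2 * (‖u‖ ^ 2 / 4))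
        (f' (t • u, 0) (u, 0) - t * (‖u‖ ^ 2 / 2)) t := fun t ht ↦ by
      refine ((hderiv₁ u 0 t (hscale u hu ht.1 ht.2) hr).sub
        ((hasDerivAt_pow 2 t).mul_const (‖u‖ ^ 2 / 4))).congr_deriv ?_
      push_cast
      ring
    have := monotoneOn_of_deriv_nonneg (convex_Icc 0 1)
      (fun t ht ↦ (hd t ht).continuousAt.continuousWithinAt)
      (fun t ht ↦ (hd t (interior_subset ht)).differentiableAt.differentiableWithinAt)
      (fun t ht ↦ by
        rw [(hd t (interior_subset ht)).deriv]
        rw [interior_Icc] at ht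
        have := hrad (t • u) 0 (hscale u hu ht.1.le ht.2.le) (by simp)
        have hz : (t • u, (0 : G)) = t • (u, (0 : G)) := by simp
        rw [show f' (t • u, 0) (t • u, 0) = t * f' (t • u, 0) (u, 0) from
          (congrArg _ hz).trans (map_smul _ _ _), norm_smul,
          Real.norm_of_nonneg ht.1.le] at this
        refine nonneg_of_mul_nonneg_right (?_ : 0 ≤ t * _) ht.1
        linarith)
      (left_mem_Icc.2 zero_le_one) (right_mem_Icc.2 zero_le_one) zero_le_one
    simp only [zero_smul, one_smul, Prod.mk_zero_zero] at this
    linarith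

end IsSaddleOn

/-- A differentiable function whose derivative is strictly differentiable at a critical point,
with Hessian `‖u‖ ^ 2 - ‖v‖ ^ 2`, has preconnected super-level sets near that point. -/
theorem exists_isConnected_nhd_of_hessian_eq [ProperSpace G] (hF : 1 < Module.rank ℝ F)
    {f : F × G → ℝ} {f' : F × G → F × G →L[ℝ] ℝ} {B : F × G →L[ℝ] F × G →L[ℝ] ℝ}
    (hf : ∀ᶠ x in 𝓝 0, HasFDerivAt f (f' x) x) (h₀ : f' 0 = 0) (hf' : HasStrictFDerivAt f' B 0)
    (hB : ∀ x y, B x y = inner ℝ x.1 y.1 - inner ℝ x.2 y.2) {W : Set (F × G)} (hW : W ∈ 𝓝 0) :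
    ∃ V : Set (F × G), IsOpen V ∧ IsConnected V ∧ 0 ∈ V ∧ V ⊆ W ∧
      ∀ δ : ℝ, IsPreconnected {x ∈ V | δ < f x} := by
  have hest := ((hasStrictFDerivAt_iff_isLittleO (𝕜 := ℝ) (f := f') ..).1 hf').bound (show (0 : ℝ) < 1 / 2 by norm_num)
  rw [nhds_prod_eq] at hest
  obtain ⟨s, hs, hest⟩ := (eventually_prod_self_iff (r := fun x y ↦
    ‖f' x - f' y - B (x - y)‖ ≤ 1 / 2 * ‖x - y‖)).1 hest
  obtain ⟨r, hr, hball⟩ := nhds_basis_closedBall.mem_iff.1 (inter_mem (inter_mem hs hf) hW)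
  have hmem : ∀ x : F × G, ‖x‖ ≤ r → x ∈ closedBall (0 : F × G) r := fun x hx ↦ by simpa using hx
  obtain ⟨V, hV, hVc, hV₀, hVr, h⟩ := (IsSaddleOn.of_fderiv_estimate (f := f)
    (fun x hx ↦ (hball (hmem x hx)).1.2) h₀ hB
    (fun x y hx hy ↦ hest x (hball (hmem x hx)).1.1 y (hball (hmem y hy)).1.1)).exists_isConnected_nhd
      hr hF
  exact ⟨V, hV, hVc, hV₀, fun x hx ↦ (hball (ball_subset_closedBall (hVr hx))).2, h⟩

end

/-- **Sylvester's law of inertia** for a nondegenerate symmetric bilinear form that is positive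
definite on a plane. -/
theorem exists_continuousLinearEquiv_prod_of_symmetric {E : Type} [NormedAddCommGroup E]
    [NormedSpace ℝ E] [FiniteDimensional ℝ E] (B : E →L[ℝ] E →L[ℝ] ℝ)
    (hsymm : ∀ x y, B x y = B y x) (hnondeg : ∀ x, (∀ y, B x y = 0) → x = 0)
    {P : Submodule ℝ E} (hP : Module.finrank ℝ P = 2) (hpos : ∀ v ∈ P, v ≠ 0 → 0 < B v v) :
    ∃ (ι κ : Type) (_ : Fintype ι) (_ : Fintype κ)
      (L : (EuclideanSpace ℝ ι × EuclideanSpace ℝ κ) ≃L[ℝ] E),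
      1 < Module.rank ℝ (EuclideanSpace ℝ ι) ∧
      ∀ x y, B (L x) (L y) = inner ℝ x.1 y.1 - inner ℝ x.2 y.2 := by
  classical
  let b : LinearMap.BilinForm ℝ E := ContinuousLinearMap.coeLM ℝ ∘ₗ B.toLinearMap
  have hb : ∀ x y, b x y = B x y := fun _ _ ↦ rfl
  have hassoc : QuadraticMap.associated (R := ℝ) b.toQuadraticMap = b :=
    QuadraticMap.associated_left_inverse ℝ hsymm
  obtain ⟨w, hw, ⟨e⟩⟩ := QuadraticForm.equivalent_one_neg_one_weighted_sum_squared
    b.toQuadraticMap (by rw [hassoc]; exact hnondeg)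
  let ι := {i // w i = 1}
  let κ := {i // ¬ w i = 1}
  let M : E ≃ₗ[ℝ] EuclideanSpace ℝ ι × EuclideanSpace ℝ κ :=
    e.toLinearEquiv ≪≫ₗ LinearEquiv.funCongrLeft ℝ ℝ (Equiv.sumCompl fun i ↦ w i = 1) ≪≫ₗ
      LinearEquiv.sumArrowLequivProdArrow ι κ ℝ ℝ ≪≫ₗ
      (WithLp.linearEquiv 2 ℝ (ι → ℝ)).symm.prodCongr (WithLp.linearEquiv 2 ℝ (κ → ℝ)).symm
  have hM₁ : ∀ x (i : ι), (M x).1 i = e x i := fun _ _ ↦ rfl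
  have hM₂ : ∀ x (i : κ), (M x).2 i = e x i := fun _ _ ↦ rfl
  have hquad : ∀ x, B x x = ‖(M x).1‖ ^ 2 - ‖(M x).2‖ ^ 2 := fun x ↦ by
    have h : QuadraticMap.weightedSumSquares ℝ w (e x) = B x x := e.map_app x
    rw [← h, QuadraticMap.weightedSumSquares_apply, EuclideanSpace.real_norm_sq_eq,
      EuclideanSpace.real_norm_sq_eq, ← Fintype.sum_subtype_add_sum_subtype (fun i ↦ w i = 1),
      sub_eq_add_neg, ← Finset.sum_neg_distrib]
    congr 1
    · refine Finset.sum_congr rfl fun i _ ↦ ?_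
      rw [hM₁, i.2, one_smul, sq]
    · refine Finset.sum_congr rfl fun i _ ↦ ?_
      rw [hM₂, (hw i).resolve_right i.2, smul_eq_mul]
      ring
  have hbil : ∀ x y, B x y = inner ℝ (M x).1 (M y).1 - inner ℝ (M x).2 (M y).2 := fun x y ↦ by
    have h := hquad (x + y)
    simp only [map_add, add_apply, Prod.fst_add, Prod.snd_add,
      norm_add_sq_real, hsymm y x] at h
    linarith [hquad x, hquad y]
  refine ⟨ι, κ, inferInstance, inferInstance, M.symm.toContinuousLinearEquiv, ?_, fun x y ↦ ?_⟩
  · have hinj : Function.Injective ((LinearMap.fst ℝ _ _ ∘ₗ M.toLinearMap) ∘ₗ P.subtype) := by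
      refine (injective_iff_map_eq_zero _).2 fun v hv ↦ ?_
      by_contra hne
      have hv' : (M v).1 = 0 := hv
      have h := hpos v v.2 (by simpa using hne)
      rw [hquad, hv', norm_zero] at h
      nlinarith [sq_nonneg ‖(M v).2‖]
    have := LinearMap.finrank_le_finrank_of_injective hinj
    rw [← Module.finrank_eq_rank]
    exact_mod_cast (by omega : 1 < Module.finrank ℝ (EuclideanSpace ℝ ι))
  · simp [hbil]


/-- **Local connectivity of super-level sets near a Morse critical point whose
Hessian has at least 2 positive eigenvalues** (step 2) of the proof of
Proposition 4.1 of the paper). If `μ` is `C^∞` near `p̂`, `Dμ(p̂) = 0`, and the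
second derivative `D²μ(p̂)` is a nondegenerate symmetric bilinear form which is
positive definite on some 2-dimensional subspace, then every neighborhood `W`
of `p̂` contains an open connected neighborhood `V` of `p̂` such that
`{x ∈ V | μ x > μ p̂ + δ}` is preconnected for every `δ`. -/
theorem superlevel_preconnected_near_morse_point (m : ℕ) (hm : 2 ≤ m)
    (U : Set (EuclideanSpace ℝ (Fin m))) (hUopen : IsOpen U)
    (μ : EuclideanSpace ℝ (Fin m) → ℝ) (hμ : ContDiffOn ℝ (⊤ : ℕ∞) μ U)
    (phat : EuclideanSpace ℝ (Fin m)) (hphat : phat ∈ U)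
    (hcrit : fderiv ℝ μ phat = 0)
    (hnondeg : ∀ v : EuclideanSpace ℝ (Fin m),
      (∀ w : EuclideanSpace ℝ (Fin m), iteratedFDeriv ℝ 2 μ phat ![v, w] = 0) → v = 0)
    (hpos : ∃ P : Submodule ℝ (EuclideanSpace ℝ (Fin m)),
      Module.finrank ℝ P = 2 ∧
        ∀ v ∈ P, v ≠ 0 → 0 < iteratedFDeriv ℝ 2 μ phat ![v, v]) :
    ∀ W ∈ nhds phat,
      ∃ V : Set (EuclideanSpace ℝ (Fin m)),
        IsOpen V ∧ IsConnected V ∧ phat ∈ V ∧ V ⊆ W ∧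
        ∀ δ : ℝ, IsPreconnected {x ∈ V | μ x > μ phat + δ} := by
  intro W hW
  have hμat : ContDiffAt ℝ (⊤ : ℕ∞) μ phat := hμ.contDiffAt (hUopen.mem_nhds hphat)
  have hμ₂ : ContDiffAt ℝ 2 μ phat := contDiffAt_infty.1 hμat 2
  have hdiff : ∀ᶠ x in 𝓝 phat, HasFDerivAt μ (fderiv ℝ μ x) x := by
    filter_upwards [hUopen.mem_nhds hphat] with x hx
    exact ((hμ.contDiffAt (hUopen.mem_nhds hx)).differentiableAt (by simp)).hasFDerivAt
  have hstrict : HasStrictFDerivAt (fderiv ℝ μ) (fderiv ℝ (fderiv ℝ μ) phat) phat :=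
    (hμ₂.fderiv_right (m := 1) (by norm_num)).hasStrictFDerivAt one_ne_zero
  simp only [iteratedFDeriv_two_apply, Matrix.cons_val_zero, Matrix.cons_val_one] at hnondeg hpos
  obtain ⟨P, hP, hpos⟩ := hpos
  obtain ⟨ι, κ, _, _, L, hrank, hL⟩ := exists_continuousLinearEquiv_prod_of_symmetric
    (fderiv ℝ (fderiv ℝ μ) phat) (hμ₂.isSymmSndFDerivAt (by simp)) hnondeg hP hpos
  let Φ := L.toHomeomorph.trans (Homeomorph.addLeft phat)
  have hΦ : ∀ x, Φ x = phat + L x := fun _ ↦ rfl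
  have hΦ₀ : Φ 0 = phat := by simp [hΦ]
  have hΦd : ∀ x, HasStrictFDerivAt Φ (L : _ →L[ℝ] EuclideanSpace ℝ (Fin m)) x := fun x ↦
    L.hasStrictFDerivAt.const_add phat
  have hΦt : Tendsto Φ (𝓝 0) (𝓝 phat) := hΦ₀ ▸ Φ.continuous.tendsto 0
  let C := (ContinuousLinearMap.compL ℝ (EuclideanSpace ℝ ι × EuclideanSpace ℝ κ)
    (EuclideanSpace ℝ (Fin m)) ℝ).flip (L : _ →L[ℝ] EuclideanSpace ℝ (Fin m))
  obtain ⟨V, hVo, hVc, hV₀, hVW, hV⟩ := exists_isConnected_nhd_of_hessian_eq hrank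
    (f := fun x ↦ μ (Φ x)) (f' := fun x ↦ C (fderiv ℝ μ (Φ x)))
    (B := C ∘L fderiv ℝ (fderiv ℝ μ) phat ∘L
      (L : (EuclideanSpace ℝ ι × EuclideanSpace ℝ κ) →L[ℝ] EuclideanSpace ℝ (Fin m)))
    ((hΦt.eventually hdiff).mono fun x hx ↦ hx.comp x (hΦd x).hasFDerivAt)
    (by simp [hΦ₀, hcrit])
    (C.hasStrictFDerivAt.comp 0 (HasStrictFDerivAt.comp 0 (by rwa [hΦ₀]) (hΦd 0)))
    (fun x y ↦ hL x y) (hΦt hW)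
  refine ⟨Φ '' V, Φ.isOpenMap V hVo, hVc.image Φ Φ.continuous.continuousOn, ⟨0, hV₀, hΦ₀⟩,
    image_subset_iff.2 hVW, fun δ ↦ ?_⟩
  convert (hV (μ phat + δ)).image Φ Φ.continuous.continuousOn using 1
  ext x
  constructor
  · rintro ⟨⟨y, hy, rfl⟩, hx⟩
    exact ⟨y, ⟨hy, hx⟩, rfl⟩
  · rintro ⟨y, ⟨hy, hx⟩, rfl⟩
    exact ⟨⟨y, hy, rfl⟩, hx⟩
end

section
/- Let n ≥ 1, let U ⊆ ℂⁿ be open, let K ⊆ U be compact, let ρ, r : U → ℝ be twice continuously differentiable on U, and let p ≥ 1 be an integer. Suppose that for every z ∈ K there exists a complex-linear subspace F ⊆ ℂⁿ with dim_ℂ F = p such that Q_ρ(z)(v) > 0 for every v ∈ F \ {0}. Then there exists ε₀ > 0 such that for every ε ∈ ℝ with |ε| ≤ ε₀ and every z ∈ K, there exists a complex-linear subspace F ⊆ ℂⁿ with dim_ℂ F = p such that Q_{ρ+εr}(z)(v) > 0 for every v ∈ F \ {0}. -/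
theorem leviQ_add_const_mul {n : ℕ} {ρ r : EuclideanSpace ℂ (Fin n) → ℝ}
    {z : EuclideanSpace ℂ (Fin n)} (hρ : ContDiffAt ℝ 2 ρ z) (hr : ContDiffAt ℝ 2 r z)
    (ε : ℝ) (v : EuclideanSpace ℂ (Fin n)) :
    leviQ n (fun w => ρ w + ε * r w) z v = leviQ n ρ z v + ε * leviQ n r z v := by
  have h : iteratedFDeriv ℝ 2 (fun w => ρ w + ε * r w) z
      = iteratedFDeriv ℝ 2 ρ z + ε • iteratedFDeriv ℝ 2 r z := by
    rw [← iteratedFDeriv_const_smul_apply hr]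
    exact iteratedFDeriv_add_apply hρ (hr.const_smul ε)
  simp only [leviQ, h, add_apply, smul_apply,
    smul_eq_mul]
  ring

theorem leviQ_real_smul {n : ℕ} (f : EuclideanSpace ℂ (Fin n) → ℝ)
    (z v : EuclideanSpace ℂ (Fin n)) (c : ℝ) :
    leviQ n f z (c • v) = c ^ 2 * leviQ n f z v := by
  have h (u : EuclideanSpace ℂ (Fin n)) :
      iteratedFDeriv ℝ 2 f z ![c • u, c • u] = c ^ 2 * iteratedFDeriv ℝ 2 f z ![u, u] := by
    have := (iteratedFDeriv ℝ 2 f z).map_smul_univ (fun _ => c) ![u, u]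
    simp only [Finset.prod_const, Finset.card_univ, Fintype.card_fin, smul_eq_mul] at this
    rw [← this]
    congr 1
    ext i
    fin_cases i <;> rfl
  simp only [leviQ, smul_comm Complex.I c v, h]
  ring

theorem ContDiffAt.continuousAt_leviQ {n : ℕ} {f : EuclideanSpace ℂ (Fin n) → ℝ}
    {z : EuclideanSpace ℂ (Fin n)} (hf : ContDiffAt ℝ 2 f z) (v : EuclideanSpace ℂ (Fin n)) :
    ContinuousAt (fun q : EuclideanSpace ℂ (Fin n) × EuclideanSpace ℂ (Fin n) =>
      leviQ n f q.1 q.2) (z, v) := by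
  have hD : ContinuousAt (iteratedFDeriv ℝ 2 f) z :=
    (hf.iteratedFDeriv_right (m := 0) (i := 2) (by norm_num)).continuousAt
  have hD' : ContinuousAt (fun q : EuclideanSpace ℂ (Fin n) × EuclideanSpace ℂ (Fin n) =>
      iteratedFDeriv ℝ 2 f q.1) (z, v) :=
    ContinuousAt.comp (g := iteratedFDeriv ℝ 2 f) (x := (z, v)) hD continuousAt_fst
  have key (g : EuclideanSpace ℂ (Fin n) → EuclideanSpace ℂ (Fin n)) (hg : Continuous g) :
      ContinuousAt (fun q : EuclideanSpace ℂ (Fin n) × EuclideanSpace ℂ (Fin n) =>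
        iteratedFDeriv ℝ 2 f q.1 ![g q.2, g q.2]) (z, v) :=
    hD'.eval (Continuous.continuousAt (by fun_prop))
  exact (key id continuous_id).add (key (fun u => Complex.I • u) (continuous_const_smul _))

/-- Positivity of the Levi form on a fixed subspace persists under small changes of the point and
of the perturbation parameter. -/
theorem eventually_leviQ_pos {n : ℕ} {ρ r : EuclideanSpace ℂ (Fin n) → ℝ}
    {z : EuclideanSpace ℂ (Fin n)} (hρ : ContDiffAt ℝ 2 ρ z) (hr : ContDiffAt ℝ 2 r z)
    {F : Submodule ℂ (EuclideanSpace ℂ (Fin n))}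
    (hF : ∀ v ∈ F, v ≠ 0 → 0 < leviQ n ρ z v) :
    ∀ᶠ q : ℝ × EuclideanSpace ℂ (Fin n) in nhds (0, z),
      ∀ v ∈ F, v ≠ 0 → 0 < leviQ n ρ q.2 v + q.1 * leviQ n r q.2 v := by
  have hS : IsCompact (Metric.sphere (0 : EuclideanSpace ℂ (Fin n)) 1 ∩ F) :=
    (isCompact_sphere 0 1).inter_right F.closed_of_finiteDimensional
  have hev : ∀ᶠ q : ℝ × EuclideanSpace ℂ (Fin n) in nhds (0, z),
      ∀ v ∈ Metric.sphere (0 : EuclideanSpace ℂ (Fin n)) 1 ∩ F,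
        0 < leviQ n ρ q.2 v + q.1 * leviQ n r q.2 v := by
    refine hS.eventually_forall_of_forall_eventually fun v hv => ?_
    have hproj : ContinuousAt (fun a : (ℝ × EuclideanSpace ℂ (Fin n)) ×
        EuclideanSpace ℂ (Fin n) => (a.1.2, a.2)) ((0, z), v) := by fun_prop
    have h₁ := ContinuousAt.comp (x := ((0, z), v)) (hρ.continuousAt_leviQ v) hproj
    have h₂ := ContinuousAt.comp (x := ((0, z), v)) (hr.continuousAt_leviQ v) hproj
    have h₃ : ContinuousAt (fun a : (ℝ × EuclideanSpace ℂ (Fin n)) ×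
        EuclideanSpace ℂ (Fin n) => a.1.1) ((0, z), v) := by fun_prop
    refine (h₁.add (h₃.mul h₂)).eventually (lt_mem_nhds ?_)
    have hv₀ : v ≠ 0 := by
      rintro rfl
      simpa using hv.1
    simpa using hF v hv.2 hv₀
  filter_upwards [hev] with q hq v hvF hv₀
  have hnorm : 0 < ‖v‖ := norm_pos_iff.2 hv₀
  have hu := hq (‖v‖⁻¹ • v) ⟨by simp [norm_smul, hnorm.ne'],
    (F.restrictScalars ℝ).smul_mem _ hvF⟩
  rw [leviQ_real_smul, leviQ_real_smul, mul_left_comm, ← mul_add] at hu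
  exact pos_of_mul_pos_right hu (sq_nonneg _)

/-- **Stability of positive Levi eigenvalues under small perturbation on a
compact set** (the analytic core of Lemmas 3.5(c) and 3.7 of the paper). If the
Levi form of `ρ` has at least `p` positive eigenvalues at each point of the
compact `K ⊆ U`, then so does the Levi form of `ρ + ε·r` for all sufficiently
small `|ε|`. -/
theorem leviPos_stable_under_small_perturbation (n : ℕ) (hn : 1 ≤ n)
    (U : Set (EuclideanSpace ℂ (Fin n))) (hUopen : IsOpen U)
    (K : Set (EuclideanSpace ℂ (Fin n))) (hKcpt : IsCompact K) (hKU : K ⊆ U)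
    (ρ r : EuclideanSpace ℂ (Fin n) → ℝ)
    (hρ : ContDiffOn ℝ 2 ρ U) (hr : ContDiffOn ℝ 2 r U)
    (p : ℕ) (hp : 1 ≤ p)
    (hpos : ∀ z ∈ K, ∃ F : Submodule ℂ (EuclideanSpace ℂ (Fin n)),
      Module.finrank ℂ F = p ∧ ∀ v ∈ F, v ≠ 0 → 0 < leviQ n ρ z v) :
    ∃ ε₀ : ℝ, 0 < ε₀ ∧ ∀ ε : ℝ, |ε| ≤ ε₀ → ∀ z ∈ K,
      ∃ F : Submodule ℂ (EuclideanSpace ℂ (Fin n)),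
        Module.finrank ℂ F = p ∧
          ∀ v ∈ F, v ≠ 0 → 0 < leviQ n (fun w => ρ w + ε * r w) z v := by
  have hP : ∀ z ∈ K, ∀ᶠ q : ℝ × EuclideanSpace ℂ (Fin n) in nhds (0, z),
      ∃ F : Submodule ℂ (EuclideanSpace ℂ (Fin n)), Module.finrank ℂ F = p ∧
        ∀ v ∈ F, v ≠ 0 → 0 < leviQ n ρ q.2 v + q.1 * leviQ n r q.2 v := by
    intro z hz
    obtain ⟨F, hFp, hF⟩ := hpos z hz
    have hU := hUopen.mem_nhds (hKU hz)
    filter_upwards [eventually_leviQ_pos (hρ.contDiffAt hU) (hr.contDiffAt hU) hF] with q hq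
    exact ⟨F, hFp, hq⟩
  have hev := hKcpt.eventually_forall_of_forall_eventually
    (P := fun (ε : ℝ) z => ∃ F : Submodule ℂ (EuclideanSpace ℂ (Fin n)), Module.finrank ℂ F = p ∧
      ∀ v ∈ F, v ≠ 0 → 0 < leviQ n ρ z v + ε * leviQ n r z v) hP
  obtain ⟨δ, hδ, hball⟩ := Metric.eventually_nhds_iff.1 hev
  refine ⟨δ / 2, half_pos hδ, fun ε hε z hz => ?_⟩
  have hεδ : dist ε 0 < δ := by
    rw [Real.dist_0_eq_abs]
    exact hε.trans_lt (half_lt_self hδ)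
  obtain ⟨F, hFp, hF⟩ := hball hεδ z hz
  have hU := hUopen.mem_nhds (hKU hz)
  refine ⟨F, hFp, fun v hv hv₀ => ?_⟩
  rw [leviQ_add_const_mul (hρ.contDiffAt hU) (hr.contDiffAt hU)]
  exact hF v hv hv₀
end

section
/- Let n ≥ 1, let U ⊆ ℂⁿ be open, let p ∈ U, and let ρ, μ : U → ℝ be twice continuously differentiable on U with Dρ(p) ≠ 0 and Dμ(p) ≠ 0 (real Fréchet differentials). Suppose that {z ∈ U : μ(z) > μ(p)} ⊆ {z ∈ U : ρ(z) < ρ(p)}. Then there exists a real number λ > 0 such that Dμ(p) = −λ·Dρ(p); moreover, for every v ∈ ℂⁿ with Dρ(p)(v) = 0 one has λ·D²ρ(p)(v,v) + D²μ(p)(v,v) ≤ 0, and consequently for every v ∈ ℂⁿ with Dρ(p)(v) = 0 and Dρ(p)(iv) = 0 one has λ·Q_ρ(p)(v) + Q_μ(p)(v) ≤ 0. -/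
open Filter Topology

/-- A function with positive derivative at a point is strictly larger immediately to its right. -/
theorem HasDerivAt.eventually_lt_nhdsGT {f : ℝ → ℝ} {a L : ℝ} (h : HasDerivAt f L a)
    (hL : 0 < L) : ∀ᶠ t in 𝓝[>] a, f a < f t := by
  have hs := (hasDerivAt_iff_tendsto_slope.1 h).mono_left
    (nhdsWithin_mono a fun t (ht : a < t) => ht.ne')
  filter_upwards [hs.eventually (lt_mem_nhds hL), self_mem_nhdsWithin] with t ht hat
  have hat' : 0 < t - a := sub_pos.2 hat
  rw [slope_def_field] at ht
  exact sub_pos.1 ((div_pos_iff_of_pos_right hat').1 ht)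

/-- At a critical point with positive second derivative, a function is strictly larger
immediately to the right. -/
theorem eventually_lt_nhdsGT_of_second_deriv_pos {f f' : ℝ → ℝ} {a L : ℝ}
    (hf : ∀ᶠ t in 𝓝 a, HasDerivAt f (f' t) t) (hfa : f' a = 0) (h : HasDerivAt f' L a)
    (hL : 0 < L) : ∀ᶠ t in 𝓝[>] a, f a < f t := by
  have hpos := h.eventually_lt_nhdsGT hL
  obtain ⟨u, hau, hu⟩ := mem_nhdsGT_iff_exists_Ioo_subset.1
    (inter_mem hpos (mem_nhdsWithin_of_mem_nhds hf))
  filter_upwards [Ioo_mem_nhdsGT hau] with t ht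
  have hder : ∀ s ∈ Set.Icc a t, HasDerivAt f (f' s) s := fun s hs => by
    rcases hs.1.eq_or_lt with rfl | has
    · exact hf.self_of_nhds
    · exact (hu ⟨has, hs.2.trans_lt ht.2⟩).2
  refine strictMonoOn_of_deriv_pos (convex_Icc a t)
    (fun s hs => (hder s hs).continuousAt.continuousWithinAt) (fun s hs => ?_)
    (Set.left_mem_Icc.2 ht.1.le) (Set.right_mem_Icc.2 ht.1.le) ht.1
  rw [interior_Icc] at hs
  rw [(hder s (Set.Ioo_subset_Icc_self hs)).deriv, ← hfa]
  exact (hu ⟨hs.1, hs.2.trans ht.2⟩).1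

/-- If `b` is a nonzero functional and `a ≤ 0` wherever `b > 0`, with `a ≠ 0`, then `b` is a
negative multiple of `a`. -/
theorem ContinuousLinearMap.exists_eq_neg_smul_of_pos_imp_nonpos {E : Type*}
    [NormedAddCommGroup E] [NormedSpace ℝ E] {a b : E →L[ℝ] ℝ} (ha : a ≠ 0) (hb : b ≠ 0)
    (h : ∀ v, 0 < b v → a v ≤ 0) : ∃ c : ℝ, 0 < c ∧ b = -c • a := by
  obtain ⟨w, hw⟩ : ∃ w, b w = 1 := by
    obtain ⟨x, hx⟩ := DFunLike.ne_iff.1 hb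
    exact ⟨(b x)⁻¹ • x, by simpa using inv_mul_cancel₀ hx⟩
  have hker : ∀ v, b v = 0 → a v = 0 := fun v hv => by
    by_contra hav
    have := h (w + ((1 - a w) / a v) • v) (by simp [hw, hv])
    rw [map_add, map_smul, smul_eq_mul, div_mul_cancel₀ _ hav] at this
    linarith
  have hab : ∀ v, a v = b v * a w := fun v => by
    have := hker (v - b v • w) (by simp [hw])
    rw [map_sub, map_smul, smul_eq_mul] at this
    linarith
  have haw : a w < 0 := (h w (by simp [hw])).lt_of_ne fun h0 => ha (by ext v; simp [hab v, h0])
  refine ⟨-(a w)⁻¹, by simpa using haw, ?_⟩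
  ext v
  simp only [neg_neg, smul_apply, smul_eq_mul, hab v]
  field_simp [haw.ne]

/-- The curve `t ↦ p + t v + t² w` has velocity `v + 2 t w`. -/
theorem hasDerivAt_parabola {E : Type*} [NormedAddCommGroup E] [NormedSpace ℝ E] (p v w : E)
    (t : ℝ) : HasDerivAt (fun s : ℝ => p + s • v + s ^ 2 • w) (v + (2 * t) • w) t := by
  simpa using (((hasDerivAt_id t).smul_const v).const_add p).fun_add
    ((hasDerivAt_pow 2 t).smul_const w)

/-- A `C²` function with `Df(p)(v) = 0` and `D²f(p)(v,v) + 2 Df(p)(w) > 0` increases strictly at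
the start of the curve `t ↦ p + t v + t² w`. -/
theorem ContDiffAt.eventually_lt_parabola {E : Type*} [NormedAddCommGroup E] [NormedSpace ℝ E]
    {f : E → ℝ} {p v w : E} (hf : ContDiffAt ℝ 2 f p) (hv : fderiv ℝ f p v = 0)
    (hpos : 0 < iteratedFDeriv ℝ 2 f p ![v, v] + 2 * fderiv ℝ f p w) :
    ∀ᶠ t : ℝ in 𝓝[>] 0, f p < f (p + t • v + t ^ 2 • w) := by
  have hγ := hasDerivAt_parabola p v w
  have hγ0 : p + (0 : ℝ) • v + (0 : ℝ) ^ 2 • w = p := by simp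
  have hdiff : ∀ᶠ z in 𝓝 p, DifferentiableAt ℝ f z :=
    (hf.eventually (by simp)).mono fun z hz => hz.differentiableAt (by simp)
  have hD : HasFDerivAt (fderiv ℝ f) (fderiv ℝ (fderiv ℝ f) p) p :=
    ((hf.fderiv_right (m := 1) (by norm_num)).differentiableAt (by simp)).hasFDerivAt
  have hD' : HasDerivAt (fun t : ℝ => fderiv ℝ f (p + t • v + t ^ 2 • w))
      (fderiv ℝ (fderiv ℝ f) p v) 0 := by
    rw [← hγ0] at hD
    simpa [hγ0, Function.comp_def] using hD.comp_hasDerivAt (0 : ℝ) (hγ 0)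
  have hvel : HasDerivAt (fun t : ℝ => v + (2 * t) • w) ((2 : ℝ) • w) 0 := by
    simpa using ((((hasDerivAt_id (0 : ℝ)).const_mul 2).smul_const w).const_add v)
  have key := eventually_lt_nhdsGT_of_second_deriv_pos (a := 0)
    (f := fun t : ℝ => f (p + t • v + t ^ 2 • w))
    (f' := fun t : ℝ => fderiv ℝ f (p + t • v + t ^ 2 • w) (v + (2 * t) • w))
    (L := fderiv ℝ (fderiv ℝ f) p v v + 2 * fderiv ℝ f p w) ?_ (by simpa using hv)
    (by simpa using hD'.clm_apply hvel) (by simpa [iteratedFDeriv_two_apply] using hpos)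
  · simpa using key
  · have hc : Tendsto (fun t : ℝ => p + t • v + t ^ 2 • w) (𝓝 0) (𝓝 p) := by
      simpa using (hγ 0).continuousAt.tendsto
    filter_upwards [hc.eventually hdiff] with t ht
    exact ht.hasFDerivAt.comp_hasDerivAt t (hγ t)


/-- **Tangency comparison of Levi forms** (the contradiction step at the end of
the proof of Proposition 4.1 of the paper). If `{μ > μ(p)} ⊆ {ρ < ρ(p)}` in `U`
and both differentials are nonzero at `p`, then `Dμ(p) = −λ·Dρ(p)` for some
`λ > 0`, the quadratic forms satisfy `λ·D²ρ(p)(v,v) + D²μ(p)(v,v) ≤ 0` on the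
tangent hyperplane `ker Dρ(p)`, and hence `λ·Q_ρ(p)(v) + Q_μ(p)(v) ≤ 0` on the
complex tangent space. -/
theorem levi_form_comparison_at_tangency (n : ℕ) (hn : 1 ≤ n)
    (U : Set (EuclideanSpace ℂ (Fin n))) (hUopen : IsOpen U)
    (p : EuclideanSpace ℂ (Fin n)) (hp : p ∈ U)
    (ρ μ : EuclideanSpace ℂ (Fin n) → ℝ)
    (hρ : ContDiffOn ℝ 2 ρ U) (hμ : ContDiffOn ℝ 2 μ U)
    (hdρ : fderiv ℝ ρ p ≠ 0) (hdμ : fderiv ℝ μ p ≠ 0)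
    (hincl : {z ∈ U | μ z > μ p} ⊆ {z ∈ U | ρ z < ρ p}) :
    ∃ lam : ℝ, 0 < lam ∧ fderiv ℝ μ p = -lam • fderiv ℝ ρ p ∧
      (∀ v : EuclideanSpace ℂ (Fin n), fderiv ℝ ρ p v = 0 →
        lam * iteratedFDeriv ℝ 2 ρ p ![v, v] + iteratedFDeriv ℝ 2 μ p ![v, v] ≤ 0) ∧
      (∀ v : EuclideanSpace ℂ (Fin n),
        fderiv ℝ ρ p v = 0 → fderiv ℝ ρ p (Complex.I • v) = 0 →
          lam * leviQ n ρ p v + leviQ n μ p v ≤ 0) := by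
  have hρp := hρ.contDiffAt (hUopen.mem_nhds hp)
  have hμp := hμ.contDiffAt (hUopen.mem_nhds hp)
  have hU : ∀ v w : EuclideanSpace ℂ (Fin n),
      ∀ᶠ t : ℝ in 𝓝[>] 0, p + t • v + t ^ 2 • w ∈ U := fun v w => by
    have hc : Tendsto (fun t : ℝ => p + t • v + t ^ 2 • w) (𝓝 0) (𝓝 p) := by
      simpa using (hasDerivAt_parabola p v w 0).continuousAt.tendsto
    exact (hc.eventually (hUopen.mem_nhds hp)).filter_mono nhdsWithin_le_nhds
  have hcontra : ∀ v w : EuclideanSpace ℂ (Fin n),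
      (∀ᶠ t : ℝ in 𝓝[>] 0, μ p < μ (p + t • v + t ^ 2 • w)) →
      ¬ ∀ᶠ t : ℝ in 𝓝[>] 0, ρ p < ρ (p + t • v + t ^ 2 • w) := fun v w h₁ h₂ => by
    obtain ⟨t, ⟨htU, ht₁⟩, ht₂⟩ := (((hU v w).and h₁).and h₂).exists
    exact (hincl ⟨htU, ht₁⟩).2.not_gt ht₂
  have hsecond : ∀ v w : EuclideanSpace ℂ (Fin n), fderiv ℝ ρ p v = 0 → fderiv ℝ μ p v = 0 →
      0 < iteratedFDeriv ℝ 2 μ p ![v, v] + 2 * fderiv ℝ μ p w →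
      iteratedFDeriv ℝ 2 ρ p ![v, v] + 2 * fderiv ℝ ρ p w ≤ 0 := fun v w hρv hμv h => by
    by_contra! h'
    exact hcontra v w (hμp.eventually_lt_parabola hμv h) (hρp.eventually_lt_parabola hρv h')
  obtain ⟨lam, hlam, heq⟩ := ContinuousLinearMap.exists_eq_neg_smul_of_pos_imp_nonpos hdρ hdμ
    fun w hw => by
      have hzero : ∀ f : EuclideanSpace ℂ (Fin n) → ℝ, iteratedFDeriv ℝ 2 f p ![0, 0] = 0 :=
        fun f => (iteratedFDeriv ℝ 2 f p).map_coord_zero 0 rfl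
      have := hsecond 0 w (map_zero _) (map_zero _) (by rw [hzero]; linarith)
      rw [hzero] at this
      linarith
  have htangent : ∀ v : EuclideanSpace ℂ (Fin n), fderiv ℝ ρ p v = 0 →
      lam * iteratedFDeriv ℝ 2 ρ p ![v, v] + iteratedFDeriv ℝ 2 μ p ![v, v] ≤ 0 := fun v hv => by
    have hμρ : ∀ x, fderiv ℝ μ p x = -(lam * fderiv ℝ ρ p x) := fun x => by simp [heq]
    obtain ⟨x, hx⟩ := DFunLike.ne_iff.1 hdμ
    refine le_of_forall_pos_le_add fun ε hε => ?_
    have hw : fderiv ℝ μ p (((ε - iteratedFDeriv ℝ 2 μ p ![v, v]) / 2 / fderiv ℝ μ p x) • x)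
        = (ε - iteratedFDeriv ℝ 2 μ p ![v, v]) / 2 := by
      rw [map_smul, smul_eq_mul, div_mul_cancel₀ _ hx]
    have h := hsecond v _ hv (by simp [hμρ, hv]) (by rw [hw]; linarith)
    rw [hμρ] at hw
    linarith [mul_nonpos_of_nonneg_of_nonpos hlam.le h]
  refine ⟨lam, hlam, heq, htangent, fun v hv hiv => ?_⟩
  unfold leviQ
  linarith [htangent v hv, htangent _ hiv]
end

section
/- Let n ≥ 2 and let X ⊆ ℂⁿ be an open set admitting a smooth (C^∞) exhaustion function ρ : X → ℝ (i.e. {z ∈ X : ρ(z) ≤ c} is compact for every c ∈ ℝ) whose Levi form has at least 2 positive eigenvalues at every point of X. Then X contains no nonempty compact analytic hypersurface; that is, there is no nonempty compact set Y ⊆ X such that for every point p ∈ Y there exist a connected open set V with p ∈ V ⊆ X and a function h holomorphic on V, not identically zero on V, with Y ∩ V = {z ∈ V : h(z) = 0}. -/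
open Metric in
/-- A holomorphic function nonvanishing on a closed disc is bounded below at the centre by any
lower bound for its norm on the boundary circle. -/
theorem Complex.le_norm_center_of_forall_sphere_le_norm {f : ℂ → ℂ} {r δ : ℝ} (hr : 0 < r)
    (hδ : 0 < δ) (hf : ∀ z ∈ closedBall (0 : ℂ) r, DifferentiableAt ℂ f z)
    (hne : ∀ z ∈ closedBall (0 : ℂ) r, f z ≠ 0)
    (hbd : ∀ z ∈ sphere (0 : ℂ) r, δ ≤ ‖f z‖) : δ ≤ ‖f 0‖ := by
  have hd : DiffContOnCl ℂ (fun z => (f z)⁻¹) (ball 0 r) := by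
    apply DifferentiableOn.diffContOnCl
    rw [closure_ball _ hr.ne']
    exact fun z hz => ((hf z hz).inv (hne z hz)).differentiableWithinAt
  have h0 : (0 : ℂ) ∈ closedBall (0 : ℂ) r := mem_closedBall_self hr.le
  have key := Complex.norm_le_of_forall_mem_frontier_norm_le isBounded_ball hd (C := δ⁻¹)
    (fun z hz => by
      rw [frontier_ball _ hr.ne'] at hz
      rw [norm_inv]
      exact inv_anti₀ hδ (hbd z hz))
    (by rwa [closure_ball _ hr.ne'])
  rw [norm_inv] at key
  exact (inv_le_inv₀ (norm_pos_iff.mpr (hne 0 h0)) hδ).mp key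

open Metric in
/-- The zero set of a holomorphic function of at least two variables cannot, near one of its
points `p`, lie in a closed ball whose boundary contains `p`. Here `w` is a complex tangent
direction to the sphere at `p`. -/
theorem exists_zero_norm_sub_gt {E : Type*} [NormedAddCommGroup E] [InnerProductSpace ℂ E]
    {V : Set E} (hV : IsOpen V) {h : E → ℂ} (hh : DifferentiableOn ℂ h V) {p c w : E}
    (hp : p ∈ V) (hp0 : h p = 0) (hc : p ≠ c) (hw : w ≠ 0) (hcw : inner ℂ (p - c) w = 0) :
    ∃ z ∈ V, h z = 0 ∧ ‖p - c‖ < ‖z - c‖ := by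
  by_contra! H
  set u := p - c with hu
  have hu0 : 0 < ‖u‖ := norm_pos_iff.mpr (sub_ne_zero.mpr hc)
  have hw0 : 0 < ‖w‖ := norm_pos_iff.mpr hw
  obtain ⟨ε, hε, hball⟩ := Metric.isOpen_iff.mp hV p hp
  obtain ⟨r, hr, hrε⟩ : ∃ r > 0, r * (‖u‖ + ‖w‖) < ε :=
    ⟨ε / (2 * (‖u‖ + ‖w‖)), by positivity, by field_simp; linarith⟩
  let φ : ℝ → ℂ → E := fun t ζ => p + ((t : ℂ) • u + ζ • w)
  have hφV : ∀ t ∈ Set.Icc 0 r, ∀ ζ ∈ closedBall (0 : ℂ) r, φ t ζ ∈ V := by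
    intro t ht ζ hζ
    apply hball
    rw [mem_closedBall_zero_iff] at hζ
    rw [mem_ball_iff_norm, add_sub_cancel_left]
    calc ‖(t : ℂ) • u + ζ • w‖ ≤ ‖(t : ℂ) • u‖ + ‖ζ • w‖ := norm_add_le _ _
      _ = t * ‖u‖ + ‖ζ‖ * ‖w‖ := by
        rw [norm_smul, norm_smul, Complex.norm_real, Real.norm_of_nonneg ht.1]
      _ ≤ r * ‖u‖ + r * ‖w‖ := by gcongr; exact ht.2
      _ < ε := by linarith
  have hφle : ∀ t : ℝ, 0 ≤ t → ∀ ζ : ℂ, ‖φ t ζ - c‖ ≤ ‖u‖ → t = 0 ∧ ζ = 0 := by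
    intro t ht ζ hle
    have e : φ t ζ - c = ((1 + t : ℝ) : ℂ) • u + ζ • w := by
      simp only [φ, hu]; push_cast; module
    have hort : inner ℂ (((1 + t : ℝ) : ℂ) • u) (ζ • w) = 0 := by
      rw [inner_smul_left, inner_smul_right, hcw]; simp
    have hpyth := norm_add_sq_eq_norm_sq_add_norm_sq_of_inner_eq_zero _ _ hort
    rw [← e, norm_smul _ u, Complex.norm_real, Real.norm_of_nonneg (by linarith)] at hpyth
    have hsq : ‖φ t ζ - c‖ * ‖φ t ζ - c‖ ≤ ‖u‖ * ‖u‖ := by gcongr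
    have htu : 0 ≤ t * (‖u‖ * ‖u‖) := by positivity
    have htu' : 0 ≤ t * t * (‖u‖ * ‖u‖) := by positivity
    have h1 : t * (‖u‖ * ‖u‖) = 0 := by nlinarith [mul_self_nonneg ‖ζ • w‖]
    have h2 : ‖ζ • w‖ * ‖ζ • w‖ = 0 := by nlinarith [mul_self_nonneg ‖ζ • w‖]
    exact ⟨by simpa [hu0.ne'] using h1, by simpa [hw] using h2⟩
  have hne : ∀ t ∈ Set.Icc 0 r, ∀ ζ ∈ closedBall (0 : ℂ) r, t ≠ 0 ∨ ζ ≠ 0 → h (φ t ζ) ≠ 0 := by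
    intro t ht ζ hζ hor h0
    have := hφle t ht.1 ζ (H _ (hφV t ht ζ hζ) h0)
    tauto
  have hφc : Continuous fun q : ℝ × ℂ => φ q.1 q.2 := by fun_prop
  have hcont : ContinuousOn (fun q : ℝ × ℂ => ‖h (φ q.1 q.2)‖)
      (Set.Icc 0 r ×ˢ closedBall (0 : ℂ) r) :=
    (hh.continuousOn.comp hφc.continuousOn fun q hq => hφV _ hq.1 _ hq.2).norm
  obtain ⟨δ, hδ, hδle⟩ : ∃ δ > 0, ∀ t ∈ Set.Icc 0 r, ∀ ζ ∈ sphere (0 : ℂ) r,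
      δ ≤ ‖h (φ t ζ)‖ := by
    have hK : IsCompact (Set.Icc 0 r ×ˢ sphere (0 : ℂ) r) :=
      isCompact_Icc.prod (isCompact_sphere _ _)
    obtain ⟨δ, hδ, hle⟩ := hK.exists_forall_le'
      (hcont.mono (Set.prod_mono_right sphere_subset_closedBall)) (a := 0) fun q hq =>
        norm_pos_iff.mpr (hne _ hq.1 _ (sphere_subset_closedBall hq.2)
          (Or.inr (ne_of_mem_sphere hq.2 hr.ne')))
    exact ⟨δ, hδ, fun t ht ζ hζ => hle (t, ζ) ⟨ht, hζ⟩⟩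
  have hcenter : ∀ t ∈ Set.Ioc 0 r, δ ≤ ‖h (φ t 0)‖ := by
    intro t ht
    have ht' := Set.Ioc_subset_Icc_self ht
    refine Complex.le_norm_center_of_forall_sphere_le_norm (f := fun ζ => h (φ t ζ)) hr hδ
      (fun ζ hζ => ?_) (fun ζ hζ => hne t ht' ζ hζ (Or.inl ht.1.ne')) (hδle t ht')
    have hd : DifferentiableAt ℂ (φ t) ζ := by fun_prop
    exact (hh.differentiableAt (hV.mem_nhds (hφV t ht' ζ hζ))).comp ζ hd
  have hlim : ContinuousOn (fun t : ℝ => ‖h (φ t 0)‖) (Set.Icc 0 r) :=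
    hcont.comp (f := fun t : ℝ => (t, (0 : ℂ))) (by fun_prop)
      fun t ht => ⟨ht, mem_closedBall_self hr.le⟩
  have hfin : δ ≤ ‖h (φ 0 0)‖ := by
    refine ContinuousWithinAt.closure_le (s := Set.Ioc 0 r) (x := (0 : ℝ)) ?_
      continuousWithinAt_const
      ((hlim 0 ⟨le_rfl, hr.le⟩).mono Set.Ioc_subset_Icc_self) hcenter
    rw [closure_Ioc hr.ne]
    exact ⟨le_rfl, hr.le⟩
  have : φ 0 0 = p := by simp [φ]
  rw [this, hp0, norm_zero] at hfin
  linarith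

/-- In an inner product space of dimension at least two, every vector has a nonzero orthogonal
vector. -/
theorem exists_ne_zero_inner_eq_zero_of_two_le_finrank {E : Type*} [NormedAddCommGroup E]
    [InnerProductSpace ℂ E] (hE : 2 ≤ Module.finrank ℂ E) (u : E) :
    ∃ w : E, w ≠ 0 ∧ inner ℂ u w = 0 := by
  have hne : (ℂ ∙ u)ᗮ ≠ ⊥ := by
    rw [Ne, Submodule.orthogonal_eq_bot_iff]
    intro htop
    have h1 : Module.finrank ℂ (ℂ ∙ u) ≤ 1 := by
      simpa using finrank_span_le_card (R := ℂ) ({u} : Set E)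
    rw [htop, finrank_top] at h1
    omega
  obtain ⟨w, hw, hw0⟩ := Submodule.exists_mem_ne_zero_of_ne_bot hne
  exact ⟨w, hw0, Submodule.mem_orthogonal_singleton_iff_inner_right.mp hw⟩

/-- **Lemma 5.3 of the paper** (Euclidean case): an open set `X ⊆ ℂⁿ`, `n ≥ 2`,
carrying a smooth exhaustion function whose Levi form has at least 2 positive
eigenvalues at every point contains no nonempty compact analytic hypersurface,
where an analytic hypersurface is locally the zero set of a holomorphic function
not identically zero. -/
theorem no_compact_analytic_hypersurface (n : ℕ) (hn : 2 ≤ n)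
    (X : Set (EuclideanSpace ℂ (Fin n))) (hXopen : IsOpen X)
    (ρ : EuclideanSpace ℂ (Fin n) → ℝ) (hρsmooth : ContDiffOn ℝ (⊤ : ℕ∞) ρ X)
    (hρexh : ∀ c : ℝ, IsCompact {z ∈ X | ρ z ≤ c})
    (hρconv : ∀ z ∈ X, LeviPosEigenvalues n ρ z 2) :
    ¬ ∃ Y : Set (EuclideanSpace ℂ (Fin n)), Y.Nonempty ∧ IsCompact Y ∧ Y ⊆ X ∧
        ∀ p ∈ Y, ∃ V : Set (EuclideanSpace ℂ (Fin n)),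
          IsOpen V ∧ IsConnected V ∧ p ∈ V ∧ V ⊆ X ∧
          ∃ h : EuclideanSpace ℂ (Fin n) → ℂ,
            DifferentiableOn ℂ h V ∧ ¬ (∀ z ∈ V, h z = 0) ∧
            Y ∩ V = {z ∈ V | h z = 0} := by
  rintro ⟨Y, hYne, hYc, -, hY⟩
  have hfr : 2 ≤ Module.finrank ℂ (EuclideanSpace ℂ (Fin n)) := by simpa using hn
  have : Nontrivial (EuclideanSpace ℂ (Fin n)) :=
    Module.nontrivial_of_finrank_pos (R := ℂ) (by omega)
  have : NoncompactSpace (EuclideanSpace ℂ (Fin n)) := NormedSpace.noncompactSpace ℂ _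
  obtain ⟨c, hc⟩ := (Set.ne_univ_iff_exists_notMem Y).mp hYc.ne_univ
  obtain ⟨p, hpY, hmax⟩ := hYc.exists_isMaxOn hYne
    (f := fun z => ‖z - c‖) (by fun_prop)
  obtain ⟨V, hV, -, hpV, -, h, hh, -, hYV⟩ := hY p hpY
  have hp0 : h p = 0 := (hYV.subset ⟨hpY, hpV⟩).2
  obtain ⟨w, hw, hpw⟩ := exists_ne_zero_inner_eq_zero_of_two_le_finrank hfr (p - c)
  obtain ⟨z, hzV, hz0, hlt⟩ :=
    exists_zero_norm_sub_gt hV hh hpV hp0 (c := c) (ne_of_mem_of_not_mem hpY hc) hw hpw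
  exact (hmax (hYV.symm.subset ⟨hzV, hz0⟩).1).not_gt hlt
end
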